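/- The space Emb(S¹,ℝ⁴) of smooth embeddings of the circle into ℝ⁴, equipped with the C¹-topology, is simply connected: it is path-connected and every loop in it is contractible. -/

import Mathlib

open Real Topology

noncomputable section

/-- ℝ⁴ as coordinate space. -/
abbrev V4 : Type := Fin 4 → ℝ

/-- A map `ℝ → E` of period 1, i.e. a map defined on the circle `ℝ/ℤ`. -/
def Loop1 {E : Type*} (γ : ℝ → E) : Prop := ∀ t, γ (t + 1) = γ t

/-- `γ : ℝ → E` (periodic of period 1) is a smooth embedding of the circle `ℝ/ℤ` into `E`:
it is smooth, an immersion, and injective on `ℝ/ℤ`. -/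
def IsLoopEmb {E : Type*} [NormedAddCommGroup E] [NormedSpace ℝ E] (γ : ℝ → E) : Prop :=
  ContDiff ℝ (⊤ : ℕ∞) γ ∧ Loop1 γ ∧ (∀ t, deriv γ t ≠ 0) ∧
    ∀ s t : ℝ, γ s = γ t → ∃ n : ℤ, s = t + n

/-- The space `Emb(S¹, E)` of smooth embeddings of the circle into `E`, equipped with the
C¹-topology: it is modeled as the set of pairs (curve, derivative of the curve), with the
compact-open (= uniform on the compact circle) topology on 1-jets. -/
def EmbS1 (E : Type*) [NormedAddCommGroup E] [NormedSpace ℝ E] : Type _ :=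
  {f : C(ℝ, E × E) // IsLoopEmb (fun t => (f t).1) ∧
    ∀ t, (f t).2 = deriv (fun s => (f s).1) t}

instance (E : Type*) [NormedAddCommGroup E] [NormedSpace ℝ E] : TopologicalSpace (EmbS1 E) :=
  instTopologicalSpaceSubtype

noncomputable section
/-! ### Part 1: homotopy tools -/
open unitInterval in
theorem contractible_I : ContractibleSpace I :=
  (convex_Icc (0 : ℝ) 1).contractibleSpace ⟨0, by simp⟩

open unitInterval in
theorem simplyConnected_I : SimplyConnectedSpace I :=
  have := contractible_I
  inferInstance

open unitInterval in
/-- The unit square is simply connected. -/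
theorem simplyConnected_II : SimplyConnectedSpace (I × I) := by
  rw [simply_connected_iff_paths_homotopic']
  have := simplyConnected_I
  refine ⟨inferInstance, fun {x y} p q => ?_⟩
  have e1 : p = (p.map continuous_fst).prod (p.map continuous_snd) := rfl
  have e2 : q = (q.map continuous_fst).prod (q.map continuous_snd) := rfl
  rw [e1, e2]
  exact ⟨Path.Homotopic.prodHomotopy
    (SimplyConnectedSpace.paths_homotopic (p.map continuous_fst) (q.map continuous_fst)).some
    (SimplyConnectedSpace.paths_homotopic (p.map continuous_snd) (q.map continuous_snd)).some⟩

open unitInterval in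
/-- Criterion for simple connectedness by a coherent, locally natural system of paths. -/
theorem simplyConnected_of_coherent {X : Type*} [TopologicalSpace X] (x0 : X)
    (P : ∀ x : X, Set (Path.Homotopic.Quotient x x0))
    (hb : ∀ x, ∀ p ∈ P x, ∀ q ∈ P x, p = q)
    (hc : ∀ (γ : C(I, X)) (θ0 : I), ∀ᶠ θ in 𝓝 θ0, ∃ p ∈ P (γ θ0), ∃ q ∈ P (γ θ),
      ∃ d : Path θ0 θ, p = (Path.Homotopic.Quotient.mk (d.map γ.continuous)).trans q) :
    SimplyConnectedSpace X := by
  rw [simply_connected_iff_paths_homotopic']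
  have hne : ∀ x, (P x).Nonempty := fun x => by
    obtain ⟨p, hp, -⟩ := (hc (ContinuousMap.const I x) 0).self_of_nhds
    exact ⟨p, hp⟩
  constructor
  · refine ⟨⟨x0⟩, fun x y => ?_⟩
    obtain ⟨p, -⟩ := hne x
    obtain ⟨q, -⟩ := hne y
    obtain ⟨p, rfl⟩ := Path.Homotopic.Quotient.mk_surjective p
    obtain ⟨q, rfl⟩ := Path.Homotopic.Quotient.mk_surjective q
    exact ⟨p.trans q.symm⟩
  · have key : ∀ (γ : C(I, X)) (x y : X) (hx : γ 0 = x) (hy : γ 1 = y), ∀ p ∈ P x, ∀ q ∈ P y,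
        p = (Path.Homotopic.Quotient.mk (⟨γ, hx, hy⟩ : Path x y)).trans q := by
      intro γ x y hx hy p hp q hq
      subst hx hy
      have := PreconnectedSpace.induction₂' (α := I) (fun θ θ' => ∃ p ∈ P (γ θ), ∃ q ∈ P (γ θ'),
        ∃ d : Path θ θ', p = (Path.Homotopic.Quotient.mk (d.map γ.continuous)).trans q)
        (fun θ => ?_) ⟨?_⟩ 0 1
      · obtain ⟨p', hp', q', hq', d, h⟩ := this
        have := simplyConnected_I
        have hd : Path.Homotopic d ⟨ContinuousMap.id I, rfl, rfl⟩ :=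
          SimplyConnectedSpace.paths_homotopic _ _
        have e2 := hd.map γ
        rw [hb _ _ hp _ hp', hb _ _ hq _ hq', h]
        congr 1
        exact Path.Homotopic.Quotient.eq.2 e2
      · filter_upwards [hc γ θ] with θ' h
        refine ⟨h, ?_⟩
        obtain ⟨p', hp', q', hq', d, h⟩ := h
        refine ⟨q', hq', p', hp', d.symm, ?_⟩
        have e : d.symm.map γ.continuous = (d.map γ.continuous).symm := rfl
        rw [h, e, Path.Homotopic.Quotient.mk_symm, ← Path.Homotopic.Quotient.trans_assoc,
          Path.Homotopic.Quotient.symm_trans, Path.Homotopic.Quotient.refl_trans]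
      · rintro a b c ⟨p1, hp1, q1, hq1, d1, h1⟩ ⟨p2, hp2, q2, hq2, d2, h2⟩
        refine ⟨p1, hp1, q2, hq2, d1.trans d2, ?_⟩
        rw [h1, hb _ _ hq1 _ hp2, h2, Path.map_trans, Path.Homotopic.Quotient.mk_trans]
        rw [Path.Homotopic.Quotient.trans_assoc]
    intro x y p q
    obtain ⟨a, ha⟩ := hne x
    obtain ⟨c, hc⟩ := hne y
    have h1 := key p.toContinuousMap x y p.source p.target a ha c hc
    have h2 := key q.toContinuousMap x y q.source q.target a ha c hc
    have h3 := congrArg (fun r => Path.Homotopic.Quotient.trans r c.symm) (h1.symm.trans h2)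
    simp at h3
    exact Path.Homotopic.Quotient.eq.1 h3

open unitInterval

/-- Images of two paths in a simply connected space are homotopic. -/
theorem homotopic_of_factor {X Y : Type*} [TopologicalSpace X] [TopologicalSpace Y]
    [SimplyConnectedSpace Y] (G : Y → X) (hG : Continuous G) {y1 y2 : Y} (p q : Path y1 y2)
    {x1 x2 : X} (p' q' : Path x1 x2) (hp : ∀ θ, p' θ = G (p θ)) (hq : ∀ θ, q' θ = G (q θ)) :
    Path.Homotopic.Quotient.mk p' = Path.Homotopic.Quotient.mk q' := by
  obtain rfl : x1 = G y1 := by simpa using hp 0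
  obtain rfl : x2 = G y2 := by simpa using hp 1
  have e1 : p' = p.map hG := by ext θ; simp [hp]
  have e2 : q' = q.map hG := by ext θ; simp [hq]
  rw [e1, e2]
  exact Path.Homotopic.Quotient.eq.2 ((SimplyConnectedSpace.paths_homotopic p q).map ⟨G, hG⟩)

/-- Squares in a simply connected space commute up to homotopy. -/
theorem square_factor {X Y : Type*} [TopologicalSpace X] [TopologicalSpace Y]
    [SimplyConnectedSpace Y] (G : Y → X) (hG : Continuous G) {y1 y2 y3 y4 : Y}
    (p : Path y1 y2) (q : Path y2 y4) (r : Path y1 y3) (s : Path y3 y4)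
    {x1 x2 x3 x4 : X} (p' : Path x1 x2) (q' : Path x2 x4) (r' : Path x1 x3) (s' : Path x3 x4)
    (hp : ∀ θ, p' θ = G (p θ)) (hq : ∀ θ, q' θ = G (q θ))
    (hr : ∀ θ, r' θ = G (r θ)) (hs : ∀ θ, s' θ = G (s θ)) :
    (Path.Homotopic.Quotient.mk p').trans (Path.Homotopic.Quotient.mk q') =
    (Path.Homotopic.Quotient.mk r').trans (Path.Homotopic.Quotient.mk s') := by
  rw [← Path.Homotopic.Quotient.mk_trans, ← Path.Homotopic.Quotient.mk_trans]
  refine homotopic_of_factor G hG (p.trans q) (r.trans s) _ _ (fun θ => ?_) (fun θ => ?_)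
  · simp only [Path.trans_apply]; split_ifs <;> simp [hp, hq]
  · simp only [Path.trans_apply]; split_ifs <;> simp [hr, hs]

/-- The diagonal commutation in a square `I × I → X`. -/
theorem square_homotopic {X : Type*} [TopologicalSpace X]
    (H : I × I → X) (hH : Continuous H)
    {x1 x2 x3 x4 : X} (p : Path x1 x2) (q : Path x2 x4) (r : Path x1 x3) (s : Path x3 x4)
    (hp : ∀ θ, p θ = H (θ, 0)) (hq : ∀ θ, q θ = H (1, θ))
    (hr : ∀ θ, r θ = H (0, θ)) (hs : ∀ θ, s θ = H (θ, 1)) :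
    (Path.Homotopic.Quotient.mk p).trans (Path.Homotopic.Quotient.mk q) =
    (Path.Homotopic.Quotient.mk r).trans (Path.Homotopic.Quotient.mk s) := by
  have := simplyConnected_II
  let ι : Path (0 : I) 1 := ⟨ContinuousMap.id I, rfl, rfl⟩
  exact square_factor H hH (ι.prod (Path.refl 0)) ((Path.refl 1).prod ι)
    ((Path.refl 0).prod ι) (ι.prod (Path.refl 1)) p q r s hp hq hr hs

/-- Images of two paths under a nullhomotopic map are homotopic. -/
theorem homotopic_of_nullhomotopic {X Y : Type*} [TopologicalSpace X] [TopologicalSpace Y]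
    (G : C(Y, X)) (hG : G.Nullhomotopic) {y1 y2 : Y} (p q : Path y1 y2) :
    Path.Homotopic (p.map G.continuous) (q.map G.continuous) := by
  obtain ⟨x, ⟨F⟩⟩ := hG
  have ex : ∀ y, ∃ e : Path (G y) x, ∀ θ, e θ = F (θ, y) := fun y =>
    ⟨⟨⟨fun θ => F (θ, y), by fun_prop⟩, by simp, by simp⟩, fun θ => rfl⟩
  choose e he using ex
  have key : ∀ p : Path y1 y2,
      Path.Homotopic.Quotient.mk (p.map G.continuous) =
      (Path.Homotopic.Quotient.mk (e y1)).trans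
        (Path.Homotopic.Quotient.mk (e y2).symm) := by
    intro p
    have := square_homotopic (fun z : I × I => F (z.2, p z.1)) (by fun_prop)
      (p.map G.continuous) (e y2) (e y1) (Path.refl x)
      (by intro θ; simp) (fun θ => by simp [he]) (fun θ => by simp [he]) (by intro θ; simp)
    have h3 := congrArg (fun r => Path.Homotopic.Quotient.trans r
      (Path.Homotopic.Quotient.mk (e y2).symm)) this
    simp only [Path.Homotopic.Quotient.mk_symm, Path.Homotopic.Quotient.trans_assoc,
      Path.Homotopic.Quotient.trans_symm, Path.Homotopic.Quotient.trans_refl] at h3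
    rw [h3, Path.Homotopic.Quotient.mk_refl, Path.Homotopic.Quotient.refl_trans,
      Path.Homotopic.Quotient.mk_symm]
  exact Path.Homotopic.Quotient.eq.1 ((key p).trans (key q).symm)
end

noncomputable section
/-! ### Part 2: basics on the space of embeddings -/
section basics
set_option linter.unusedSectionVars false
variable {E F G : Type*} [NormedAddCommGroup E] [NormedSpace ℝ E]
  [NormedAddCommGroup F] [NormedSpace ℝ F] [NormedAddCommGroup G] [NormedSpace ℝ G]
variable {Z Z' : Type*} [TopologicalSpace Z] [TopologicalSpace Z']

def crv (g : EmbS1 E) : ℝ → E := fun t => (g.1 t).1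

theorem crv_emb (g : EmbS1 E) : IsLoopEmb (crv g) := g.2.1

theorem EmbS1.ext' {g g' : EmbS1 E} (h : ∀ t, crv g t = crv g' t) : g = g' := by
  apply Subtype.ext
  ext1 t
  have h' : (fun t => (g.1 t).1) = (fun t => (g'.1 t).1) := funext h
  refine Prod.ext (h t) ?_
  rw [g.2.2 t, g'.2.2 t, h']

def mkE (f : ℝ → E) (h : IsLoopEmb f) : EmbS1 E :=
  ⟨⟨fun t => (f t, deriv f t), h.1.continuous.prodMk (h.1.continuous_deriv (by simp))⟩,
    h, fun _ => rfl⟩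

@[simp] theorem crv_mkE (f : ℝ → E) (h : IsLoopEmb f) : crv (mkE f h) = f := rfl

@[simp] theorem mkE_crv (g : EmbS1 E) (h : IsLoopEmb (crv g)) : mkE (crv g) h = g :=
  EmbS1.ext' fun _ => rfl

/-- Smooth periodic families of curves, continuous in the `C¹` sense. -/
structure SF (f : Z → ℝ → E) : Prop where
  smooth : ∀ z, ContDiff ℝ (⊤ : ℕ∞) (f z)
  per : ∀ z, Loop1 (f z)
  cont : Continuous fun p : Z × ℝ => f p.1 p.2
  cont' : Continuous fun p : Z × ℝ => deriv (f p.1) p.2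

theorem SF.diff {f : Z → ℝ → E} (h : SF f) (z : Z) (t : ℝ) : DifferentiableAt ℝ (f z) t :=
  ((h.smooth z).differentiable (by simp)) t

theorem SF.comp {f : Z → ℝ → E} (h : SF f) {u : Z' → Z} (hu : Continuous u) :
    SF (fun z => f (u z)) :=
  ⟨fun _ => h.smooth _, fun _ => h.per _,
    h.cont.comp ((hu.comp continuous_fst).prodMk continuous_snd),
    h.cont'.comp ((hu.comp continuous_fst).prodMk continuous_snd)⟩

theorem SF.const {f : ℝ → E} (h : ContDiff ℝ (⊤ : ℕ∞) f) (hp : Loop1 f) :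
    SF (fun _ : Z => f) :=
  ⟨fun _ => h, fun _ => hp, h.continuous.comp continuous_snd,
    (h.continuous_deriv (by simp)).comp continuous_snd⟩

theorem SF.param {c : Z → E} (h : Continuous c) : SF (fun z (_ : ℝ) => c z) :=
  ⟨fun _ => contDiff_const, fun _ _ => rfl, h.comp continuous_fst, by
    simpa using continuous_const⟩

theorem SF.prodMk {f : Z → ℝ → E} {g : Z → ℝ → F} (hf : SF f) (hg : SF g) :
    SF (fun z t => (f z t, g z t)) := by
  refine ⟨fun z => (hf.smooth z).prodMk (hg.smooth z), fun z t => ?_, hf.cont.prodMk hg.cont, ?_⟩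
  · simp [hf.per z t, hg.per z t]
  · refine (hf.cont'.prodMk hg.cont').congr fun p => ?_
    exact (((hf.diff p.1 p.2).hasDerivAt.prodMk (hg.diff p.1 p.2).hasDerivAt).deriv).symm

theorem SF.clm {f : Z → ℝ → E} (hf : SF f) (L : E →L[ℝ] F) : SF (fun z t => L (f z t)) := by
  refine ⟨fun z => L.contDiff.comp (hf.smooth z), fun z t => ?_, L.continuous.comp hf.cont, ?_⟩
  · simp [hf.per z t]
  · refine (L.continuous.comp hf.cont').congr fun p => ?_
    exact ((L.hasFDerivAt.comp_hasDerivAt p.2 (hf.diff p.1 p.2).hasDerivAt).deriv).symm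

theorem SF.bilin {f : Z → ℝ → E} {g : Z → ℝ → F} (hf : SF f) (hg : SF g)
    (B : E →L[ℝ] F →L[ℝ] G) : SF (fun z t => B (f z t) (g z t)) := by
  refine ⟨fun z => ?_, fun z t => ?_, ?_, ?_⟩
  · exact (B.isBoundedBilinearMap.contDiff).comp ((hf.smooth z).prodMk (hg.smooth z))
  · simp [hf.per z t, hg.per z t]
  · exact B.isBoundedBilinearMap.continuous.comp (hf.cont.prodMk hg.cont)
  · have h1 := B.isBoundedBilinearMap.continuous.comp (hf.cont.prodMk hg.cont')
    have h2 := B.isBoundedBilinearMap.continuous.comp (hf.cont'.prodMk hg.cont)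
    refine (h1.add h2).congr fun p => ?_
    have := B.hasFDerivAt_of_bilinear (hf.diff p.1 p.2).hasDerivAt.hasFDerivAt
      (hg.diff p.1 p.2).hasDerivAt.hasFDerivAt
    have := this.hasDerivAt.deriv
    simpa using this.symm

theorem SF.add {f g : Z → ℝ → E} (hf : SF f) (hg : SF g) : SF (fun z t => f z t + g z t) :=
  (hf.prodMk hg).clm (ContinuousLinearMap.fst ℝ E E + ContinuousLinearMap.snd ℝ E E)

theorem SF.sub {f g : Z → ℝ → E} (hf : SF f) (hg : SF g) : SF (fun z t => f z t - g z t) :=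
  (hf.prodMk hg).clm (ContinuousLinearMap.fst ℝ E E - ContinuousLinearMap.snd ℝ E E)

theorem SF.smul {f : Z → ℝ → ℝ} {g : Z → ℝ → E} (hf : SF f) (hg : SF g) :
    SF (fun z t => f z t • g z t) :=
  hf.bilin hg (ContinuousLinearMap.lsmul ℝ ℝ)

theorem SF.mul {A : Type*} [NormedRing A] [NormedAlgebra ℝ A] {f g : Z → ℝ → A}
    (hf : SF f) (hg : SF g) : SF (fun z t => f z t * g z t) :=
  hf.bilin hg (ContinuousLinearMap.mul ℝ A)

theorem SF.fst {f : Z → ℝ → E × F} (hf : SF f) : SF (fun z t => (f z t).1) :=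
  hf.clm (ContinuousLinearMap.fst ℝ E F)

theorem SF.snd {f : Z → ℝ → E × F} (hf : SF f) : SF (fun z t => (f z t).2) :=
  hf.clm (ContinuousLinearMap.snd ℝ E F)

/-- The tautological family. -/
theorem SF.emb : SF (fun g : EmbS1 E => crv g) := by
  have h : Continuous fun p : EmbS1 E × ℝ => p.1.1 p.2 :=
    (ContinuousEval.continuous_eval (F := C(ℝ, E × E)) (X := ℝ) (Y := E × E)).comp
      ((continuous_subtype_val.comp continuous_fst).prodMk continuous_snd)
  refine ⟨fun g => (crv_emb g).1, fun g => (crv_emb g).2.1, continuous_fst.comp h, ?_⟩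
  refine (continuous_snd.comp h).congr fun p => ?_
  exact p.1.2.2 p.2

/-- Lifting a `C¹`-continuous family of embeddings to a continuous map. -/
theorem SF.lift {f : Z → ℝ → E} (h : SF f) (he : ∀ z, IsLoopEmb (f z)) :
    Continuous fun z => mkE (f z) (he z) := by
  refine Continuous.subtype_mk (ContinuousMap.continuous_of_continuous_uncurry _ ?_) _
  exact h.cont.prodMk h.cont'

def InjMod (f : ℝ → E) : Prop := ∀ s t : ℝ, f s = f t → ∃ n : ℤ, s = t + n

theorem Loop1.add_int {f : ℝ → E} (h : Loop1 f) (t : ℝ) (n : ℤ) : f (t + n) = f t := by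
  have : Function.Periodic f 1 := h
  simpa using (this.int_mul n) t

/-- Image of an embedding under an injective continuous linear map. -/
theorem IsLoopEmb.clm {f : ℝ → E} (h : IsLoopEmb f) (L : E →L[ℝ] F)
    (hL : Function.Injective L) : IsLoopEmb (fun t => L (f t)) := by
  refine ⟨L.contDiff.comp h.1, fun t => ?_, fun t => ?_, fun s t hst => h.2.2.2 s t (hL hst)⟩
  · simp [h.2.1 t]
  · have := (L.hasFDerivAt.comp_hasDerivAt t (h.1.differentiable (by simp) t).hasDerivAt).deriv
    change deriv (L ∘ f) t ≠ 0
    rw [this]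
    intro h0
    exact h.2.2.1 t (hL (by simpa using h0))

/-- A curve is an embedding if its image under a continuous linear map is. -/
theorem IsLoopEmb.of_clm {f : ℝ → E} (hf : ContDiff ℝ (⊤ : ℕ∞) f) (hp : Loop1 f)
    (L : E →L[ℝ] F) (h : IsLoopEmb (fun t => L (f t))) : IsLoopEmb f := by
  refine ⟨hf, hp, fun t h0 => h.2.2.1 t ?_, fun s t hst => h.2.2.2 s t (by simp [hst])⟩
  have := (L.hasFDerivAt.comp_hasDerivAt t (hf.differentiable (by simp) t).hasDerivAt).deriv
  change deriv (L ∘ f) t = 0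
  rw [this, h0]; simp

/-- The map on embedding spaces induced by an injective continuous linear map. -/
def mapE (L : E →L[ℝ] F) (hL : Function.Injective L) : C(EmbS1 E, EmbS1 F) :=
  ⟨fun g => mkE (fun t => L (crv g t)) ((crv_emb g).clm L hL), (SF.emb.clm L).lift _⟩

@[simp] theorem crv_mapE (L : E →L[ℝ] F) (hL : Function.Injective L) (g : EmbS1 E) (t : ℝ) :
    crv (mapE L hL g) t = L (crv g t) := rfl

/-- The homeomorphism induced by a linear isomorphism. -/
def homeoE (L : E ≃L[ℝ] F) : EmbS1 E ≃ₜ EmbS1 F where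
  toFun := mapE (L : E →L[ℝ] F) L.injective
  invFun := mapE (L.symm : F →L[ℝ] E) L.symm.injective
  left_inv g := EmbS1.ext' fun t => L.symm_apply_apply _
  right_inv g := EmbS1.ext' fun t => L.apply_symm_apply _
  continuous_toFun := (mapE _ _).continuous
  continuous_invFun := (mapE _ _).continuous

/-! Openness -/

theorem ev_of_ne {f : Z → ℝ → E} (h : SF f) {z0 : Z} {s1 t1 : ℝ} (hne : f z0 s1 ≠ f z0 t1) :
    ∀ᶠ p : Z × (ℝ × ℝ) in 𝓝 (z0, (s1, t1)), f p.1 p.2.1 ≠ f p.1 p.2.2 := by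
  have h1 : Continuous fun p : Z × (ℝ × ℝ) => f p.1 p.2.1 - f p.1 p.2.2 :=
    (h.cont.comp (continuous_fst.prodMk (continuous_fst.comp continuous_snd))).sub
      (h.cont.comp (continuous_fst.prodMk (continuous_snd.comp continuous_snd)))
  have := h1.continuousAt (x := (z0, (s1, t1))).eventually_ne (y := 0)
    (by simpa [sub_eq_zero] using hne)
  filter_upwards [this] with p hp
  rwa [sub_ne_zero] at hp

/-- local injectivity near an immersed point -/
theorem ev_diag {f : Z → ℝ → E} (h : SF f) {z0 : Z} {t1 : ℝ} (hne : deriv (f z0) t1 ≠ 0) :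
    ∀ᶠ p : Z × (ℝ × ℝ) in 𝓝 (z0, (t1, t1)), f p.1 p.2.1 = f p.1 p.2.2 → p.2.1 = p.2.2 := by
  obtain ⟨l, hl⟩ := SeparatingDual.exists_eq_one (R := ℝ) hne
  have hg := h.clm l
  have hc : Continuous fun p : Z × ℝ => deriv (fun t => l (f p.1 t)) p.2 := hg.cont'
  have hpos : 0 < deriv (fun t => l (f z0 t)) t1 := by
    have := (l.hasFDerivAt.comp_hasDerivAt t1 (h.diff z0 t1).hasDerivAt).deriv
    change 0 < deriv (l ∘ f z0) t1
    rw [this, hl]; norm_num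
  have ev := hc.continuousAt (x := (z0, t1)).eventually (lt_mem_nhds hpos)
  rw [nhds_prod_eq, Filter.eventually_prod_iff] at ev
  obtain ⟨pa, ha, pb, hb, hab⟩ := ev
  obtain ⟨ε, hε, hb⟩ := Metric.eventually_nhds_iff_ball.1 hb
  have e1 : ∀ᶠ p : Z × (ℝ × ℝ) in 𝓝 (z0, (t1, t1)), pa p.1 :=
    (continuous_fst.continuousAt (x := (z0, (t1, t1)))).eventually ha
  have e2 : ∀ᶠ p : Z × (ℝ × ℝ) in 𝓝 (z0, (t1, t1)), p.2.1 ∈ Metric.ball t1 ε :=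
    ((continuous_fst.comp continuous_snd).continuousAt (x := (z0, (t1, t1)))).eventually
      (Metric.ball_mem_nhds _ hε)
  have e3 : ∀ᶠ p : Z × (ℝ × ℝ) in 𝓝 (z0, (t1, t1)), p.2.2 ∈ Metric.ball t1 ε :=
    ((continuous_snd.comp continuous_snd).continuousAt (x := (z0, (t1, t1)))).eventually
      (Metric.ball_mem_nhds _ hε)
  filter_upwards [e1, e2, e3] with p h1 h2 h3 heq
  have mono : StrictMonoOn (fun t => l (f p.1 t)) (Metric.ball t1 ε) := by
    refine strictMonoOn_of_deriv_pos (convex_ball _ _) (hg.smooth p.1).continuous.continuousOn ?_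
    intro x hx
    exact hab h1 (hb x (interior_subset hx))
  exact mono.injOn h2 h3 (by simp [heq])

/-- translation of local statements -/
theorem ev_shift {f : Z → ℝ → E} (h : SF f) {A : Z → Prop} {z0 : Z} {s1 t1 : ℝ} (m n : ℤ)
    (H : ∀ᶠ p : Z × (ℝ × ℝ) in 𝓝 (z0, (s1, t1)), A p.1 → f p.1 p.2.1 = f p.1 p.2.2 →
      ∃ n : ℤ, p.2.1 = p.2.2 + n) :
    ∀ᶠ p : Z × (ℝ × ℝ) in 𝓝 (z0, (s1 + m, t1 + n)), A p.1 → f p.1 p.2.1 = f p.1 p.2.2 →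
      ∃ n : ℤ, p.2.1 = p.2.2 + n := by
  have hc : Continuous fun p : Z × (ℝ × ℝ) => (p.1, (p.2.1 - (m : ℝ), p.2.2 - (n : ℝ))) := by
    fun_prop
  have ht : Filter.Tendsto (fun p : Z × (ℝ × ℝ) => (p.1, (p.2.1 - (m : ℝ), p.2.2 - (n : ℝ))))
      (𝓝 (z0, (s1 + m, t1 + n))) (𝓝 (z0, (s1, t1))) := by
    have := hc.tendsto (z0, (s1 + m, t1 + n)); simpa using this
  filter_upwards [ht.eventually H] with p hp hA heq
  have e1 : f p.1 (p.2.1 - m) = f p.1 p.2.1 := by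
    have := (h.per p.1).add_int p.2.1 (-m); simpa [sub_eq_add_neg] using this
  have e2 : f p.1 (p.2.2 - n) = f p.1 p.2.2 := by
    have := (h.per p.1).add_int p.2.2 (-n); simpa [sub_eq_add_neg] using this
  obtain ⟨k, hk⟩ := hp hA (by simp only [e1, e2, heq])
  refine ⟨k + m - n, ?_⟩
  push_cast
  linarith

/-- From local statements to global injectivity. -/
theorem ev_global {f : Z → ℝ → E} (h : SF f) {A : Z → Prop} {z0 : Z}
    (H : ∀ s1 t1 : ℝ, ∀ᶠ p : Z × (ℝ × ℝ) in 𝓝 (z0, (s1, t1)), A p.1 →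
      f p.1 p.2.1 = f p.1 p.2.2 → ∃ n : ℤ, p.2.1 = p.2.2 + n) :
    ∀ᶠ z in 𝓝 z0, A z → InjMod (f z) := by
  have hK : IsCompact (Set.Icc (0 : ℝ) 1 ×ˢ Set.Icc (0 : ℝ) 1) := isCompact_Icc.prod isCompact_Icc
  have := hK.eventually_forall_of_forall_eventually (x₀ := z0) (P := fun z q => A z →
    f z q.1 = f z q.2 → ∃ n : ℤ, q.1 = q.2 + n) (fun q _ => H q.1 q.2)
  filter_upwards [this] with z hz hA s t hst
  have fr : ∀ s : ℝ, f z (Int.fract s) = f z s := fun s => by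
    have := (h.per z).add_int s (-⌊s⌋); simpa [Int.fract, sub_eq_add_neg] using this
  obtain ⟨n, hn⟩ := hz (Int.fract s, Int.fract t)
    ⟨⟨Int.fract_nonneg _, (Int.fract_lt_one _).le⟩, ⟨Int.fract_nonneg _, (Int.fract_lt_one _).le⟩⟩
    hA (by simp only [fr, hst])
  refine ⟨n + ⌊s⌋ - ⌊t⌋, ?_⟩
  simp only [Int.fract] at hn
  push_cast; linarith

theorem Loop1.deriv {f : ℝ → E} (h : Loop1 f) : Loop1 (deriv f) := fun t => by
  have : (fun x => f (x + 1)) = f := funext h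
  rw [← deriv_comp_add_const f 1 t, this]

theorem ev_imm {f : Z → ℝ → E} (h : SF f) {z0 : Z} (h0 : ∀ t, deriv (f z0) t ≠ 0) :
    ∀ᶠ z in 𝓝 z0, ∀ t, deriv (f z) t ≠ 0 := by
  have := (isCompact_Icc (a := (0 : ℝ)) (b := 1)).eventually_forall_of_forall_eventually
    (x₀ := z0) (P := fun z t => deriv (f z) t ≠ 0)
    (fun t _ => h.cont'.continuousAt.eventually_ne (h0 t))
  filter_upwards [this] with z hz t
  have fr : deriv (f z) (Int.fract t) = deriv (f z) t := by
    have := (h.per z).deriv.add_int t (-⌊t⌋); simpa [Int.fract, sub_eq_add_neg] using this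
  rw [← fr]
  exact hz _ ⟨Int.fract_nonneg _, (Int.fract_lt_one _).le⟩

/-- local statement at integer-diagonal points -/
theorem ev_diag' {f : Z → ℝ → E} (h : SF f) {A : Z → Prop} {z0 : Z} {s1 t1 : ℝ} {n : ℤ}
    (hst : s1 = t1 + n)
    (hne : deriv (f z0) t1 ≠ 0) : ∀ᶠ p : Z × (ℝ × ℝ) in 𝓝 (z0, (s1, t1)), A p.1 →
      f p.1 p.2.1 = f p.1 p.2.2 → ∃ n : ℤ, p.2.1 = p.2.2 + n := by
  have h1 := ev_shift h (A := A) (z0 := z0) (s1 := t1) (t1 := t1) n 0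
    (by filter_upwards [ev_diag h hne] with p hp _ h2; exact ⟨0, by simpa using hp h2⟩)
  subst hst
  simpa using h1

theorem ev_emb {f : Z → ℝ → E} (h : SF f) {z0 : Z} (h0 : IsLoopEmb (f z0)) :
    ∀ᶠ z in 𝓝 z0, IsLoopEmb (f z) := by
  have h2 := ev_global h (A := fun _ => True) (z0 := z0) (fun s1 t1 => by
    by_cases heq : f z0 s1 = f z0 t1
    · obtain ⟨n, rfl⟩ := h0.2.2.2 _ _ heq
      exact ev_diag' h (A := fun _ => True) rfl (h0.2.2.1 t1)
    · filter_upwards [ev_of_ne h heq] with p hp _ h2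
      exact absurd h2 hp)
  filter_upwards [ev_imm h h0.2.2.1, h2] with z h1 h2
  exact ⟨h.smooth z, h.per z, h1, h2 trivial⟩

end basics
end

noncomputable section
open unitInterval
/-- Naturality of classes of the form (path into `S`) followed by (path in `S`). -/
theorem cls_nat {S X : Type*} [TopologicalSpace S] [TopologicalSpace X] [SimplyConnectedSpace S]
    (j : S → X) (hj : Continuous j) {s0 : S} {x x' : X} {c c' : S} (p : Path x x')
    (a : Path x (j c)) (a' : Path x' (j c')) (k : Path c s0) (k' : Path c' s0)
    (G : I × I → X) (hG : Continuous G) (κ : Path c c')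
    (hp : ∀ θ, p θ = G (θ, 0)) (ha : ∀ r, a r = G (0, r)) (ha' : ∀ r, a' r = G (1, r))
    (hκ : ∀ θ, j (κ θ) = G (θ, 1)) :
    (Path.Homotopic.Quotient.mk a).trans (Path.Homotopic.Quotient.mk (k.map hj)) =
    (Path.Homotopic.Quotient.mk p).trans
      ((Path.Homotopic.Quotient.mk a').trans (Path.Homotopic.Quotient.mk (k'.map hj))) := by
  have h1 := square_homotopic G hG p a' a (κ.map hj) hp ha' ha hκ
  have h2 : Path.Homotopic.Quotient.mk (k.map hj) =
      (Path.Homotopic.Quotient.mk (κ.map hj)).trans (Path.Homotopic.Quotient.mk (k'.map hj)) := by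
    rw [← Path.Homotopic.Quotient.mk_trans, ← Path.map_trans]
    exact Path.Homotopic.Quotient.eq.2
      ((SimplyConnectedSpace.paths_homotopic k (κ.trans k')).map ⟨j, hj⟩)
  rw [← Path.Homotopic.Quotient.trans_assoc, h1, h2, Path.Homotopic.Quotient.trans_assoc]

/-- Short paths in the interval. -/
theorem ev_path_I {U : Set I} {θ0 : I} (hU : U ∈ 𝓝 θ0) :
    ∀ᶠ θ in 𝓝 θ0, ∃ d : Path θ0 θ, ∀ s, d s ∈ U := by
  obtain ⟨ε, hε, hU⟩ := Metric.mem_nhds_iff.1 hU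
  filter_upwards [Metric.ball_mem_nhds θ0 hε] with θ hθ
  have hθ' : |(θ : ℝ) - θ0| < ε := by simpa [Subtype.dist_eq, Real.dist_eq] using hθ
  have hmem : ∀ s : I, (1 - (s : ℝ)) * θ0 + s * θ ∈ I := fun s => by
    have h1 := s.2.1; have h2 := s.2.2
    have a1 := θ0.2.1; have a2 := θ0.2.2; have b1 := θ.2.1; have b2 := θ.2.2
    constructor <;> nlinarith
  refine ⟨⟨⟨fun s => ⟨(1 - (s : ℝ)) * θ0 + s * θ, hmem s⟩, by fun_prop⟩, by ext; simp,
    by ext; simp⟩, fun s => hU ?_⟩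
  · change dist _ _ < ε
    rw [Subtype.dist_eq, Real.dist_eq]
    have : (1 - (s : ℝ)) * θ0 + s * θ - θ0 = s * (θ - θ0) := by ring
    change |(1 - (s : ℝ)) * θ0 + s * θ - θ0| < ε
    rw [this, abs_mul, abs_of_nonneg s.2.1]
    have h2 := s.2.2; have h1 := s.2.1
    nlinarith [abs_nonneg ((θ : ℝ) - θ0)]

/-- The three dimensional space. -/
abbrev W3 : Type := ℂ × ℝ

/-- punctured three-space -/
abbrev W3x : Type := {x : W3 // x ≠ 0}

/-- complement of a ray -/
def Uray (ε : ℝ) : Set W3 := {x | x.1 ≠ 0 ∨ 0 < ε * x.2}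

theorem Uray_seg {ε : ℝ} (hε : ε ≠ 0) {x : W3} (hx : x ∈ Uray ε) (r : I) :
    (1 - (r : ℝ)) • x + (r : ℝ) • ((0, ε) : W3) ≠ 0 := by
  intro h
  have h1 := congrArg Prod.fst h
  have h2 := congrArg Prod.snd h
  simp at h1 h2
  have r1 := r.2.1; have r2 := r.2.2
  rcases h1 with h1 | h1
  · have : (r : ℝ) = 1 := by
      have : (1 : ℂ) - ((r : ℝ) : ℂ) = 0 := h1
      have := congrArg Complex.re this
      simp at this; linarith
    rw [this] at h2; simp at h2; exact hε h2
  · rcases hx with hx | hx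
    · exact hx h1
    · have e : (1 - (r : ℝ)) * (ε * x.2) + r * ε ^ 2 = 0 := by
        have := congrArg (fun z => ε * z) h2; simp only [mul_zero] at this; linarith
      have p2 : 0 < ε ^ 2 := by positivity
      rcases eq_or_lt_of_le r2 with h | h
      · rw [h] at e; simp at e; exact hε e
      · nlinarith [mul_pos (sub_pos.2 h) hx, mul_nonneg r1 p2.le]

theorem pole_ne {ε : ℝ} (hε : ε ≠ 0) : ((0, ε) : W3) ≠ 0 := by
  intro h; exact hε (congrArg Prod.snd h)

/-- straight path to a pole -/
def raySeg {ε : ℝ} (hε : ε ≠ 0) (x : W3x) (hx : x.1 ∈ Uray ε) : Path x ⟨(0, ε), pole_ne hε⟩ where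
  toFun r := ⟨(1 - (r : ℝ)) • x.1 + (r : ℝ) • ((0, ε) : W3), Uray_seg hε hx r⟩
  continuous_toFun := by fun_prop
  source' := by ext1; simp
  target' := by ext1; simp

theorem raySeg_nat {ε : ℝ} (hε : ε ≠ 0) {x y : W3x} (p : Path x y) (hp : ∀ s, (p s).1 ∈ Uray ε)
    (hx : x.1 ∈ Uray ε) (hy : y.1 ∈ Uray ε) :
    Path.Homotopic.Quotient.mk (raySeg hε x hx) =
      (Path.Homotopic.Quotient.mk p).trans (Path.Homotopic.Quotient.mk (raySeg hε y hy)) := by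
  have := square_homotopic (fun z : I × I => (⟨(1 - (z.2 : ℝ)) • (p z.1).1 +
    (z.2 : ℝ) • ((0, ε) : W3), Uray_seg hε (hp z.1) z.2⟩ : W3x)) (by fun_prop)
    p (raySeg hε y hy) (raySeg hε x hx) (Path.refl _) (by intro θ; ext1; simp)
    (by intro θ; ext1; simp [raySeg]) (by intro θ; ext1; simp [raySeg]) (by intro θ; ext1; simp)
  rw [this, Path.Homotopic.Quotient.mk_refl, Path.Homotopic.Quotient.trans_refl]

theorem isOpen_Uray (ε : ℝ) : IsOpen (Uray ε) := by
  have h1 : IsOpen {x : W3 | x.1 ≠ 0} := isOpen_ne_fun continuous_fst continuous_const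
  have h2 : IsOpen {x : W3 | 0 < ε * x.2} :=
    isOpen_lt continuous_const (continuous_const.mul continuous_snd)
  exact h1.union h2

theorem offline_joined {x y : W3x} (hx : x.1.1 ≠ 0) (hy : y.1.1 ≠ 0) :
    ∃ p : Path x y, ∀ s, (p s).1.1 ≠ 0 := by
  have h : IsPathConnected (({0}ᶜ : Set ℂ)) :=
    isPathConnected_compl_singleton_of_one_lt_rank (by rw [Complex.rank_real_complex]; norm_num) 0
  obtain ⟨q, hq⟩ := h.joinedIn x.1.1 hx y.1.1 hy
  let q2 : Path x.1.2 y.1.2 := (PathConnectedSpace.somePath _ _)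
  refine ⟨⟨⟨fun s => ⟨(q s, q2 s), fun h => hq s (congrArg Prod.fst h)⟩, by fun_prop⟩,
    by ext1; simp, by ext1; simp⟩, fun s => hq s⟩

/-- Punctured three-space is simply connected. -/
theorem simplyConnected_W3x : SimplyConnectedSpace W3x := by
  have h1 : (1 : ℝ) ≠ 0 := one_ne_zero
  have hm : (-1 : ℝ) ≠ 0 := by norm_num
  let N : W3x := ⟨(0, 1), pole_ne h1⟩
  let S : W3x := ⟨(0, -1), pole_ne hm⟩
  let e : W3x := ⟨(1, 0), by intro h; simpa using congrArg Prod.fst h⟩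
  have he1 : e.1 ∈ Uray 1 := Or.inl one_ne_zero
  have hem : e.1 ∈ Uray (-1) := Or.inl one_ne_zero
  let ρ : Path.Homotopic.Quotient S N :=
    (Path.Homotopic.Quotient.mk (raySeg hm e hem)).symm.trans
      (Path.Homotopic.Quotient.mk (raySeg h1 e he1))
  have hρ : ∀ x : W3x, ∀ (h : x.1 ∈ Uray 1) (h' : x.1 ∈ Uray (-1)),
      Path.Homotopic.Quotient.mk (raySeg h1 x h) =
      (Path.Homotopic.Quotient.mk (raySeg hm x h')).trans ρ := by
    intro x h h'
    have hx : x.1.1 ≠ 0 := by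
      rcases h with h | h
      · exact h
      · rcases h' with h' | h'
        · exact h'
        · linarith
    obtain ⟨p, hp⟩ := offline_joined (x := x) (y := e) hx one_ne_zero
    rw [raySeg_nat h1 p (fun s => Or.inl (hp s)) h he1,
      raySeg_nat hm p (fun s => Or.inl (hp s)) h' hem]
    simp only [ρ]
    rw [Path.Homotopic.Quotient.trans_assoc]
    congr 1
    rw [← Path.Homotopic.Quotient.trans_assoc, Path.Homotopic.Quotient.trans_symm,
      Path.Homotopic.Quotient.refl_trans]
  refine simplyConnected_of_coherent N (fun x => {c |
    (∃ h : x.1 ∈ Uray 1, c = Path.Homotopic.Quotient.mk (raySeg h1 x h)) ∨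
    (∃ h : x.1 ∈ Uray (-1), c = (Path.Homotopic.Quotient.mk (raySeg hm x h)).trans ρ)}) ?_ ?_
  · rintro x p (⟨h, rfl⟩ | ⟨h, rfl⟩) q (⟨h', rfl⟩ | ⟨h', rfl⟩)
    · rfl
    · exact hρ x h h'
    · exact (hρ x h' h).symm
    · rfl
  · intro γ θ0
    have hcase : (γ θ0).1 ∈ Uray 1 ∨ (γ θ0).1 ∈ Uray (-1) := by
      by_cases h : (γ θ0).1.1 = 0
      · have h2 : (γ θ0).1.2 ≠ 0 := fun h2 => (γ θ0).2 (Prod.ext h h2)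
        rcases lt_or_gt_of_ne h2 with h3 | h3
        · right; right; linarith
        · left; right; linarith
      · left; left; exact h
    have hnb : ∀ ε : ℝ, (γ θ0).1 ∈ Uray ε → {θ | (γ θ).1 ∈ Uray ε} ∈ 𝓝 θ0 := fun ε h =>
      ((continuous_subtype_val.comp γ.continuous).continuousAt (x := θ0)).preimage_mem_nhds
        ((isOpen_Uray ε).mem_nhds h)
    rcases hcase with h | h
    · filter_upwards [ev_path_I (hnb _ h), hnb _ h] with θ ⟨d, hd⟩ hθ
      exact ⟨_, Or.inl ⟨h, rfl⟩, _, Or.inl ⟨hθ, rfl⟩, d,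
        raySeg_nat h1 (d.map γ.continuous) (fun s => hd s) h hθ⟩
    · filter_upwards [ev_path_I (hnb _ h), hnb _ h] with θ ⟨d, hd⟩ hθ
      refine ⟨_, Or.inr ⟨h, rfl⟩, _, Or.inr ⟨hθ, rfl⟩, d, ?_⟩
      rw [raySeg_nat hm (d.map γ.continuous) (fun s => hd s) h hθ,
        Path.Homotopic.Quotient.trans_assoc]
end

noncomputable section
open unitInterval
/-! ### Part 4: curves with first coordinate `cos` -/

theorem SF.compR {E : Type*} [NormedAddCommGroup E] [NormedSpace ℝ E] {Z : Type*}
    [TopologicalSpace Z] {v : ℝ → E} (hv : ContDiff ℝ (⊤ : ℕ∞) v) {g : Z → ℝ → ℝ} (hg : SF g) :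
    SF (fun z t => v (g z t)) := by
  refine ⟨fun z => hv.comp (hg.smooth z), fun z t => by simp [hg.per z t],
    hv.continuous.comp hg.cont, ?_⟩
  refine (hg.cont'.smul ((hv.continuous_deriv (by simp)).comp hg.cont)).congr fun p => ?_
  have h1 := (hv.differentiable (by simp) (g p.1 p.2)).hasDerivAt
  exact ((h1.scomp p.2 (hg.diff p.1 p.2).hasDerivAt).deriv).symm

/-- the function `cos (2 π t)` -/
def cs (t : ℝ) : ℝ := Real.cos (2 * π * t)
/-- the function `sin (2 π t)` -/
def sn (t : ℝ) : ℝ := Real.sin (2 * π * t)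

theorem cs_smooth : ContDiff ℝ (⊤ : ℕ∞) cs := by unfold cs; fun_prop
theorem sn_smooth : ContDiff ℝ (⊤ : ℕ∞) sn := by unfold sn; fun_prop
theorem cs_per : Loop1 cs := fun t => by
  unfold cs; rw [mul_add, mul_one, Real.cos_add_two_pi]
theorem sn_per : Loop1 sn := fun t => by
  unfold sn; rw [mul_add, mul_one, Real.sin_add_two_pi]
theorem cs_deriv (t : ℝ) : HasDerivAt cs (-(2 * π) * sn t) t := by
  have := (Real.hasDerivAt_cos (2 * π * t)).comp t ((hasDerivAt_id t).const_mul (2 * π))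
  refine this.congr_deriv ?_
  unfold sn; simp; ring
theorem sn_deriv (t : ℝ) : HasDerivAt sn (2 * π * cs t) t := by
  have := (Real.hasDerivAt_sin (2 * π * t)).comp t ((hasDerivAt_id t).const_mul (2 * π))
  refine this.congr_deriv ?_
  unfold cs; simp; ring
theorem cs_neg (t : ℝ) : cs (-t) = cs t := by simp [cs]
theorem sn_neg (t : ℝ) : sn (-t) = - sn t := by simp [sn]
theorem cs_sq (t : ℝ) : cs t ^ 2 + sn t ^ 2 = 1 := Real.cos_sq_add_sin_sq _
theorem cs_ne {t : ℝ} (h : sn t = 0) : cs t ≠ 0 := by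
  intro h'; have := cs_sq t; rw [h, h'] at this; norm_num at this
theorem sn_half (t : ℝ) : sn (t + 1 / 2) = - sn t := by
  unfold sn; rw [show 2 * π * (t + 1 / 2) = 2 * π * t + π by ring, Real.sin_add_pi]
theorem cs_half (t : ℝ) : cs (t + 1 / 2) = - cs t := by
  unfold cs; rw [show 2 * π * (t + 1 / 2) = 2 * π * t + π by ring, Real.cos_add_pi]
theorem sn_eq_zero {t : ℝ} : sn t = 0 ↔ ∃ n : ℤ, 2 * t = n := by
  unfold sn
  rw [Real.sin_eq_zero_iff]
  constructor
  · rintro ⟨n, hn⟩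
    refine ⟨n, ?_⟩
    have := Real.pi_ne_zero
    have h : π * (n - 2 * t) = 0 := by linarith
    rcases mul_eq_zero.1 h with h | h
    · exact absurd h this
    · linarith
  · rintro ⟨n, hn⟩
    exact ⟨n, by rw [← hn]; ring⟩
theorem cs_eq_cs {s t : ℝ} (h : cs s = cs t) : (∃ n : ℤ, s = t + n) ∨ ∃ n : ℤ, s = -t + n := by
  unfold cs at h
  have hp := Real.pi_pos
  rw [Real.cos_eq_cos_iff] at h
  obtain ⟨k, h | h⟩ := h
  · left; refine ⟨-k, ?_⟩
    have : (2 * π) * (s - (t - k)) = 0 := by linarith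
    rcases mul_eq_zero.1 this with h | h
    · linarith
    · push_cast; linarith
  · right; refine ⟨k, ?_⟩
    have : (2 * π) * (s - (-t + k)) = 0 := by linarith
    rcases mul_eq_zero.1 this with h | h
    · linarith
    · linarith

/-- difference quotient across the axis -/
def dq (w : ℝ → W3) (s : ℝ) : W3 :=
  if sn s = 0 then (π * cs s)⁻¹ • deriv w s else (sn s)⁻¹ • (w s - w (-s))

theorem dq_add_int {w : ℝ → W3} (hw : Loop1 w) (s : ℝ) (n : ℤ) : dq w (s + n) = dq w s := by
  unfold dq
  have h : w (-(s + n)) = w (-s) := by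
    have := hw.add_int (-s) (-n); rw [← this]; congr 1; push_cast; ring
  rw [cs_per.add_int, sn_per.add_int, hw.add_int, h, hw.deriv.add_int]

theorem dq_neg {w : ℝ → W3} (hw : Loop1 w) (s : ℝ) : dq w (-s) = dq w s := by
  unfold dq
  rw [cs_neg, sn_neg, neg_neg]
  simp only [neg_eq_zero]
  split_ifs with h
  · obtain ⟨n, hn⟩ := sn_eq_zero.1 h
    have : -s = s + ((-n : ℤ) : ℝ) := by push_cast; linarith
    rw [this, hw.deriv.add_int]
  · rw [inv_neg, neg_smul, ← smul_neg, neg_sub]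

theorem dq_half {w : ℝ → W3} (hw : Loop1 w) (s : ℝ) :
    dq w (s + 1 / 2) = - dq (fun t => w (t + 1 / 2)) s := by
  unfold dq
  rw [sn_half, cs_half]
  simp only [neg_eq_zero]
  have h : w (-(s + 1 / 2)) = w (-s + 1 / 2) := by
    rw [← hw]; congr 1; ring
  split_ifs with h0
  · rw [deriv_comp_add_const, mul_neg, inv_neg, neg_smul]
  · rw [h, inv_neg, neg_smul]

theorem reduce_half (s : ℝ) : ∃ r ∈ Set.Icc (0 : ℝ) (1 / 2), ∃ n : ℤ, s = r + n ∨ s = -r + n := by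
  have h0 := Int.fract_nonneg s
  have h1 := (Int.fract_lt_one s)
  have h2 := Int.fract_add_floor s
  by_cases h : Int.fract s ≤ 1 / 2
  · exact ⟨Int.fract s, ⟨h0, h⟩, ⌊s⌋, Or.inl h2.symm⟩
  · refine ⟨1 - Int.fract s, ⟨by linarith, by linarith⟩, ⌊s⌋ + 1, Or.inr ?_⟩
    push_cast; linarith

theorem dq_reduce {w : ℝ → W3} (hw : Loop1 w) (s : ℝ) :
    ∃ r ∈ Set.Icc (0 : ℝ) (1 / 2), dq w s = dq w r ∧ cs s = cs r := by
  obtain ⟨r, hr, n, rfl | rfl⟩ := reduce_half s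
  · exact ⟨r, hr, dq_add_int hw _ _, cs_per.add_int _ _⟩
  · exact ⟨r, hr, by rw [dq_add_int hw, dq_neg hw], by rw [cs_per.add_int, cs_neg]⟩

theorem dq_add {w u : ℝ → W3} (hw : Differentiable ℝ w) (hu : Differentiable ℝ u) (s : ℝ) :
    dq (fun t => w t + u t) s = dq w s + dq u s := by
  unfold dq
  split_ifs
  · rw [deriv_fun_add (hw s) (hu s), smul_add]
  · rw [← smul_add]; congr 1; exact add_sub_add_comm _ _ _ _

theorem dq_smul {w : ℝ → W3} (hw : Differentiable ℝ w) (c : ℝ) (s : ℝ) :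
    dq (fun t => c • w t) s = c • dq w s := by
  unfold dq
  split_ifs
  · rw [deriv_fun_const_smul c (hw s), smul_comm]
  · rw [← smul_sub, smul_comm]

theorem dq_sin {V : ℝ → W3} (hV : ContDiff ℝ (⊤ : ℕ∞) V) (c : ℝ) (s : ℝ) :
    dq (fun t => (1 / 2 * sn t) • V (c * cs t)) s = V (c * cs s) := by
  unfold dq
  split_ifs with h
  · have h1 : HasDerivAt (fun t => V (c * cs t)) _ s :=
      (hV.differentiable (by simp) (c * cs s)).hasDerivAt.scomp s ((cs_deriv s).const_mul c)
    have h2 := ((sn_deriv s).const_mul (1 / 2)).fun_smul h1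
    rw [h2.deriv, h]
    simp only [mul_zero, zero_smul, zero_add]
    rw [smul_smul]
    convert one_smul ℝ _ using 2
    have := cs_ne h
    have := Real.pi_ne_zero
    field_simp
  · simp only [cs_neg, sn_neg]
    rw [← sub_smul, smul_smul]
    convert one_smul ℝ _ using 2
    field_simp
    ring

/-- averaged derivative -/
def avD (w : ℝ → W3) (s : ℝ) : W3 := ∫ u in (0 : ℝ)..1, deriv w ((2 * u - 1) * s)

theorem avD_eq {w : ℝ → W3} (hw : ContDiff ℝ (⊤ : ℕ∞) w) (s : ℝ) :
    (2 * s) • avD w s = w s - w (-s) := by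
  have hd : ∀ u ∈ Set.uIcc (0 : ℝ) 1, HasDerivAt (fun u : ℝ => w ((2 * u - 1) * s))
      ((2 * s) • deriv w ((2 * u - 1) * s)) u := fun u _ => by
    have h1 := (hw.differentiable (by simp) ((2 * u - 1) * s)).hasDerivAt
    have h2 : HasDerivAt (fun u : ℝ => (2 * u - 1) * s) (2 * s) u := by
      have := ((((hasDerivAt_id u).const_mul 2).sub_const 1).mul_const s)
      simpa using this
    exact h1.scomp u h2
  have hc : Continuous fun u : ℝ => (2 * s) • deriv w ((2 * u - 1) * s) := by
    have := (hw.continuous_deriv (by simp)).comp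
      (by fun_prop : Continuous fun u : ℝ => (2 * u - 1) * s)
    exact this.const_smul (2 * s)
  have := intervalIntegral.integral_eq_sub_of_hasDerivAt hd (hc.intervalIntegrable _ _)
  rw [intervalIntegral.integral_smul] at this
  unfold avD
  rw [this]
  congr 2 <;> ring

theorem dq_eq_avD {w : ℝ → W3} (hw : ContDiff ℝ (⊤ : ℕ∞) w) {s : ℝ} (hs : |s| < 1 / 2) :
    dq w s = (π * Real.sinc (2 * π * s))⁻¹ • avD w s := by
  rw [abs_lt] at hs
  by_cases h0 : s = 0
  · subst h0
    simp [dq, sn, cs, avD]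
  · have hne : sn s ≠ 0 := by
      intro h
      obtain ⟨n, hn⟩ := sn_eq_zero.1 h
      have h1 : (-1 : ℝ) < n := by linarith
      have h2 : (n : ℝ) < 1 := by linarith
      have h1 : (-1 : ℤ) < n := by exact_mod_cast h1
      have h2 : n < 1 := by exact_mod_cast h2
      have : n = 0 := by omega
      rw [this] at hn; push_cast at hn; exact h0 (by linarith)
    have hp := Real.pi_ne_zero
    rw [dq, if_neg hne, ← avD_eq hw, smul_smul, Real.sinc_of_ne_zero (by positivity)]
    congr 1
    change _ = (π * (sn s / (2 * π * s)))⁻¹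
    field_simp

theorem sinc_ne {s : ℝ} (hs : |s| < 1 / 2) : π * Real.sinc (2 * π * s) ≠ 0 := by
  have hp := Real.pi_ne_zero
  rw [abs_lt] at hs
  by_cases h0 : s = 0
  · subst h0; simp
  · rw [Real.sinc_of_ne_zero (by positivity)]
    have hne : sn s ≠ 0 := by
      intro h
      obtain ⟨n, hn⟩ := sn_eq_zero.1 h
      have h1 : (-1 : ℝ) < n := by linarith
      have h2 : (n : ℝ) < 1 := by linarith
      have h1 : (-1 : ℤ) < n := by exact_mod_cast h1
      have h2 : n < 1 := by exact_mod_cast h2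
      have : n = 0 := by omega
      rw [this] at hn; push_cast at hn; exact h0 (by linarith)
    change π * (sn s / (2 * π * s)) ≠ 0
    positivity

section
variable {Z : Type*} [TopologicalSpace Z]

theorem SF.half {w : Z → ℝ → W3} (hw : SF w) : SF (fun z t => w z (t + 1 / 2)) := by
  refine ⟨fun z => (hw.smooth z).comp (by fun_prop), fun z t => ?_, ?_, ?_⟩
  · have := hw.per z (t + 1 / 2); rw [← this]; congr 1; ring
  · exact hw.cont.comp (by fun_prop : Continuous fun p : Z × ℝ => (p.1, p.2 + 1 / 2))
  · refine (hw.cont'.comp (by fun_prop : Continuous fun p : Z × ℝ => (p.1, p.2 + 1 / 2))).congr ?_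
    intro p
    exact (deriv_comp_add_const (w p.1) (1 / 2) p.2).symm

theorem dq_cont_aux {w : Z → ℝ → W3} (hw : SF w) (z : Z) {s : ℝ} (hs : |s| < 1 / 2) :
    ContinuousAt (fun p : Z × ℝ => dq (w p.1) p.2) (z, s) := by
  have h1 : Continuous fun p : Z × ℝ => avD (w p.1) p.2 := by
    refine intervalIntegral.continuous_parametric_intervalIntegral_of_continuous'
      (f := fun (p : Z × ℝ) (u : ℝ) => deriv (w p.1) ((2 * u - 1) * p.2)) ?_ 0 1
    exact hw.cont'.comp (by fun_prop : Continuous fun q : (Z × ℝ) × ℝ =>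
      (q.1.1, (2 * q.2 - 1) * q.1.2))
  have h2 : ContinuousAt (fun p : Z × ℝ => (π * Real.sinc (2 * π * p.2))⁻¹) (z, s) := by
    have : Continuous (fun p : Z × ℝ => π * Real.sinc (2 * π * p.2)) :=
      continuous_const.mul (Real.continuous_sinc.comp (by fun_prop))
    exact this.continuousAt.inv₀ (sinc_ne hs)
  refine (h2.smul h1.continuousAt).congr ?_
  have : ∀ᶠ p : Z × ℝ in 𝓝 (z, s), |p.2| < 1 / 2 :=
    (continuous_snd.abs.continuousAt (x := (z, s))).eventually (gt_mem_nhds hs)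
  filter_upwards [this] with p hp
  exact (dq_eq_avD (hw.smooth p.1) hp).symm

theorem dq_cont {w : Z → ℝ → W3} (hw : SF w) (z : Z) {s : ℝ} (hs : s ∈ Set.Icc (0 : ℝ) (1 / 2)) :
    ContinuousAt (fun p : Z × ℝ => dq (w p.1) p.2) (z, s) := by
  rcases eq_or_lt_of_le hs.2 with h | h
  · subst h
    have h1 := dq_cont_aux hw.half z (s := 0) (by simp)
    have h2 : Continuous fun p : Z × ℝ => (p.1, p.2 - 1 / 2) := by fun_prop
    have h1' : ContinuousAt (fun p : Z × ℝ => dq (fun t => w p.1 (t + 1 / 2)) p.2)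
      ((fun p : Z × ℝ => (p.1, p.2 - 1 / 2)) (z, (1 / 2 : ℝ))) := by simpa using h1
    refine (h1'.comp (x := (z, (1 / 2 : ℝ))) h2.continuousAt).neg.congr ?_
    filter_upwards with p
    have := dq_half (hw.per p.1) (p.2 - 1 / 2)
    rw [sub_add_cancel] at this
    simp [this]
  · exact dq_cont_aux hw z (by rw [abs_of_nonneg hs.1]; exact h)
end

/-- embeddings over the cosine -/
theorem emb_of_dq {w : ℝ → W3} (hw : ContDiff ℝ (⊤ : ℕ∞) w) (hp : Loop1 w)
    (h : ∀ s, dq w s ≠ 0) : IsLoopEmb (fun t => (cs t, w t)) := by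
  refine ⟨cs_smooth.prodMk hw, fun t => by simp [cs_per t, hp t], fun t h0 => ?_,
    fun s t hst => ?_⟩
  · have hd := ((cs_deriv t).prodMk (hw.differentiable (by simp) t).hasDerivAt).deriv
    rw [hd] at h0
    have h1 := congrArg Prod.fst h0
    have h2 := congrArg Prod.snd h0
    simp only [Prod.fst_zero, Prod.snd_zero] at h1 h2
    have hs : sn t = 0 := by
      rcases mul_eq_zero.1 h1 with h | h
      · have := Real.pi_pos; linarith
      · exact h
    apply h t
    rw [dq, if_pos hs, h2, smul_zero]
  · have h1 := congrArg Prod.fst hst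
    have h2 := congrArg Prod.snd hst
    simp only at h1 h2
    rcases cs_eq_cs h1 with h3 | ⟨n, rfl⟩
    · exact h3
    · by_cases h0 : sn t = 0
      · obtain ⟨k, hk⟩ := sn_eq_zero.1 h0
        exact ⟨n - k, by push_cast; linarith⟩
      · exfalso; apply h t
        rw [hp.add_int] at h2
        rw [dq, if_neg h0, h2, sub_self, smul_zero]

theorem dq_of_emb {w : ℝ → W3} (hw : ContDiff ℝ (⊤ : ℕ∞) w)
    (h : IsLoopEmb (fun t => (cs t, w t))) (s : ℝ) : dq w s ≠ 0 := by
  unfold dq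
  split_ifs with h0
  · refine smul_ne_zero (inv_ne_zero (mul_ne_zero Real.pi_ne_zero (cs_ne h0))) fun h1 => ?_
    have hd := ((cs_deriv s).prodMk (hw.differentiable (by simp) s).hasDerivAt).deriv
    apply h.2.2.1 s
    rw [hd, h1, h0]; simp
  · refine smul_ne_zero (inv_ne_zero h0) fun h1 => ?_
    obtain ⟨n, hn⟩ := h.2.2.2 s (-s) (by simp [cs_neg, sub_eq_zero.1 h1])
    exact h0 (sn_eq_zero.2 ⟨n, by linarith⟩)

/-- smooth approximation in three-space on `[-1,1]` -/
theorem exists_smooth_approx {D : ℝ → W3} (hD : ContinuousOn D (Set.Icc (-1) 1)) {ε : ℝ}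
    (hε : 0 < ε) : ∃ V : ℝ → W3, ContDiff ℝ (⊤ : ℕ∞) V ∧ ∀ c ∈ Set.Icc (-1 : ℝ) 1,
      ‖V c - D c‖ < ε := by
  obtain ⟨p, hp⟩ := exists_polynomial_near_of_continuousOn (-1) 1 (fun c => (D c).1.re)
    (Complex.continuous_re.comp_continuousOn (continuous_fst.comp_continuousOn hD)) (ε / 2)
    (by positivity)
  obtain ⟨q, hq⟩ := exists_polynomial_near_of_continuousOn (-1) 1 (fun c => (D c).1.im)
    (Complex.continuous_im.comp_continuousOn (continuous_fst.comp_continuousOn hD)) (ε / 2)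
    (by positivity)
  obtain ⟨r, hr⟩ := exists_polynomial_near_of_continuousOn (-1) 1 (fun c => (D c).2)
    (continuous_snd.comp_continuousOn hD) ε hε
  have hsm : ∀ p : Polynomial ℝ, ContDiff ℝ (⊤ : ℕ∞) fun c => p.eval c := fun p => by
    simpa using p.contDiff_aeval (𝕜 := ℝ) (⊤ : ℕ∞)
  refine ⟨fun c => (((p.eval c : ℝ) : ℂ) + ((q.eval c : ℝ) : ℂ) * Complex.I, r.eval c), ?_, ?_⟩
  · refine ContDiff.prodMk (ContDiff.add ?_ (ContDiff.mul ?_ contDiff_const)) (hsm r)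
    · exact Complex.ofRealCLM.contDiff.comp (hsm p)
    · exact Complex.ofRealCLM.contDiff.comp (hsm q)
  · intro c hc
    rw [Prod.norm_def]
    refine max_lt ?_ (hr c hc)
    refine lt_of_le_of_lt (Complex.norm_le_abs_re_add_abs_im _) ?_
    have h1 := hp c hc
    have h2 := hq c hc
    simp at h1 h2 ⊢
    linarith
end

noncomputable section
open unitInterval
/-! ### Part 5: the space of embeddings over the cosine is simply connected -/
/-- four-space -/
abbrev E4 : Type := ℝ × W3
/-- embeddings with first coordinate `cos` -/
abbrev BB : Type := {g : EmbS1 E4 // ∀ t, (crv g t).1 = cs t}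
/-- constructor -/
def mkB (w : ℝ → W3) (hw : ContDiff ℝ (⊤ : ℕ∞) w) (hp : Loop1 w) (hd : ∀ s, dq w s ≠ 0) : BB :=
  ⟨mkE (fun t => (cs t, w t)) (emb_of_dq hw hp hd), fun _ => rfl⟩
/-- the last three coordinates -/
def wB (g : BB) : ℝ → W3 := fun t => (crv g.1 t).2

theorem crv_wB (g : BB) : crv g.1 = fun t => (cs t, wB g t) := by
  funext t; exact Prod.ext (g.2 t) rfl

theorem SF.wB : SF (fun g : BB => wB g) := (SF.emb.comp continuous_subtype_val).snd

theorem dq_wB (g : BB) (s : ℝ) : dq (wB g) s ≠ 0 := by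
  refine dq_of_emb (SF.wB.smooth g) ?_ s
  rw [← crv_wB]; exact crv_emb _

theorem BB.ext' {g g' : BB} (h : ∀ t, wB g t = wB g' t) : g = g' := by
  apply Subtype.ext
  apply EmbS1.ext'
  intro t
  rw [crv_wB, crv_wB]; simp only [h]

@[simp] theorem wB_mkB (w : ℝ → W3) (hw) (hp) (hd) : wB (mkB w hw hp hd) = w := rfl

theorem SF.liftB {Z : Type*} [TopologicalSpace Z] {w : Z → ℝ → W3} (h : SF w)
    (hd : ∀ z s, dq (w z) s ≠ 0) :
    Continuous fun z => mkB (w z) (h.smooth z) (h.per z) (hd z) :=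
  Continuous.subtype_mk (((SF.const cs_smooth cs_per).prodMk h).lift _) _

/-- first parameter -/
def muP (τ : ℝ) : ℝ := min 1 (2 * τ)
/-- second parameter -/
def nuP (τ : ℝ) : ℝ := max 0 (2 * τ - 1)
theorem continuous_muP : Continuous muP := by unfold muP; fun_prop
theorem continuous_nuP : Continuous nuP := by unfold nuP; fun_prop

/-- the contracting family -/
def famB (w V : ℝ → W3) (τ : ℝ) : ℝ → W3 := fun t =>
  (1 - muP τ) • w t + muP τ • ((1 / 2 * sn t) • V ((1 - nuP τ) * cs t))

/-- admissible contractions -/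
def AdmB (w V : ℝ → W3) : Prop := ∀ s, ‖V (cs s) - dq w s‖ < ‖dq w s‖

theorem exists_cs {c : ℝ} (h1 : -1 ≤ c) (h2 : c ≤ 1) : ∃ s, cs s = c := by
  refine ⟨Real.arccos c / (2 * π), ?_⟩
  have := Real.pi_ne_zero
  unfold cs
  rw [mul_div_cancel₀ _ (by positivity), Real.cos_arccos h1 h2]

theorem AdmB.ne {w V : ℝ → W3} (h : AdmB w V) {c : ℝ} (h1 : -1 ≤ c) (h2 : c ≤ 1) : V c ≠ 0 := by
  obtain ⟨s, rfl⟩ := exists_cs h1 h2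
  intro h0
  have := h s
  rw [h0, zero_sub, norm_neg] at this
  exact lt_irrefl _ this

theorem sinV_smooth {V : ℝ → W3} (hV : ContDiff ℝ (⊤ : ℕ∞) V) (c : ℝ) :
    ContDiff ℝ (⊤ : ℕ∞) (fun t => (1 / 2 * sn t) • V (c * cs t)) :=
  (contDiff_const.mul sn_smooth).smul (hV.comp (contDiff_const.mul cs_smooth))

theorem dq_famB_ne {w V : ℝ → W3} (hw : ContDiff ℝ (⊤ : ℕ∞) w) (hV : ContDiff ℝ (⊤ : ℕ∞) V)
    (h : AdmB w V) (τ : I) (s : ℝ) : dq (famB w V τ) s ≠ 0 := by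
  have t1 := τ.2.1
  have t2 := τ.2.2
  have d1 := hw.differentiable (by simp)
  have d2 := (sinV_smooth hV (1 - nuP τ)).differentiable (by simp)
  have e : dq (famB w V τ) s = (1 - muP τ) • dq w s + muP τ • V ((1 - nuP τ) * cs s) := by
    unfold famB
    have e1 := dq_add (w := fun t => (1 - muP τ) • w t) (u := fun t => muP τ •
      ((1 / 2 * sn t) • V ((1 - nuP τ) * cs t))) (d1.fun_const_smul _) (d2.fun_const_smul _) s
    rw [e1, dq_smul d1, dq_smul d2, dq_sin hV]
  rw [e]
  by_cases hτ : (τ : ℝ) ≤ 1 / 2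
  · have hn : nuP τ = 0 := by unfold nuP; exact max_eq_left (by linarith)
    have hm : muP τ ≤ 1 := min_le_left _ _
    have hm0 : 0 ≤ muP τ := le_min zero_le_one (by linarith)
    rw [hn, sub_zero, one_mul]
    intro h0
    have h1 : dq w s = -(muP τ • (V (cs s) - dq w s)) := by
      rw [eq_neg_iff_add_eq_zero, ← h0, smul_sub, sub_smul, one_smul]; abel
    have h2 := h s
    have h3 : ‖dq w s‖ = muP τ * ‖V (cs s) - dq w s‖ := by
      conv_lhs => rw [h1]
      rw [norm_neg, norm_smul, Real.norm_of_nonneg hm0]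
    have := mul_le_mul_of_nonneg_right hm (norm_nonneg (V (cs s) - dq w s))
    linarith
  · have hm : muP τ = 1 := by unfold muP; exact min_eq_left (by linarith)
    have hn : nuP τ = 2 * τ - 1 := by unfold nuP; exact max_eq_right (by linarith)
    rw [hm, sub_self, zero_smul, zero_add, one_smul]
    have hc : |cs s| ≤ 1 := Real.abs_cos_le_one _
    have : |(1 - nuP τ) * cs s| ≤ 1 := by
      rw [abs_mul, hn]
      have : |1 - (2 * (τ : ℝ) - 1)| ≤ 1 := by rw [abs_le]; constructor <;> linarith
      exact mul_le_one₀ this (abs_nonneg _) hc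
    rw [abs_le] at this
    exact h.ne this.1 this.2

theorem SF.famB {Z : Type*} [TopologicalSpace Z] {w : Z → ℝ → W3} (hw : SF w) {V V' : ℝ → W3}
    (hV : ContDiff ℝ (⊤ : ℕ∞) V) (hV' : ContDiff ℝ (⊤ : ℕ∞) V') {a τ : Z → ℝ}
    (ha : Continuous a) (hτ : Continuous τ) :
    SF (fun z => famB (w z) (fun c => (1 - a z) • V c + a z • V' c) (τ z)) := by
  have hmu : SF (fun z (_ : ℝ) => muP (τ z)) := SF.param (continuous_muP.comp hτ)
  have hmu' : SF (fun z (_ : ℝ) => 1 - muP (τ z)) :=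
    SF.param (continuous_const.sub (continuous_muP.comp hτ))
  have hnu : SF (fun z (_ : ℝ) => 1 - nuP (τ z)) :=
    SF.param (continuous_const.sub (continuous_nuP.comp hτ))
  have ha1 : SF (fun z (_ : ℝ) => a z) := SF.param ha
  have ha2 : SF (fun z (_ : ℝ) => 1 - a z) := SF.param (continuous_const.sub ha)
  have hc : SF (fun _ : Z => cs) := SF.const cs_smooth cs_per
  have hs : SF (fun (_ : Z) t => 1 / 2 * sn t) :=
    SF.const (contDiff_const.mul sn_smooth) (fun t => by simp [sn_per t])
  have hq := hnu.mul hc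
  exact (hmu'.smul hw).add (hmu.smul (hs.smul
    ((ha2.smul (hq.compR hV)).add (ha1.smul (hq.compR hV')))))


def jB (x : W3x) : BB :=
  mkB (fun t => (1 / 2 * sn t) • x.1)
    (sinV_smooth (V := fun _ => x.1) contDiff_const 1) (fun t => by simp [sn_per t]) (fun s => by
      have := dq_sin (V := fun _ => x.1) contDiff_const 1 s
      rw [this]; exact x.2)

theorem continuous_jB : Continuous jB := by
  have h : SF (fun (x : W3x) t => (1 / 2 * sn t) • x.1) :=
    (SF.const (contDiff_const.mul sn_smooth) (fun t => by simp [sn_per t])).smul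
      (SF.param continuous_subtype_val)
  exact h.liftB _

theorem exists_adm (g : BB) : ∃ V : ℝ → W3, ContDiff ℝ (⊤ : ℕ∞) V ∧ AdmB (wB g) V := by
  have hsf : SF (fun _ : Unit => wB g) := SF.const (SF.wB.smooth g) (SF.wB.per g)
  have hcon : ContinuousOn (fun s => dq (wB g) s) (Set.Icc (0 : ℝ) (1 / 2)) := fun s hs => by
    have h1 := dq_cont hsf () hs
    have h2 : ContinuousAt (fun s : ℝ => ((), s)) s := by fun_prop
    exact (ContinuousAt.comp (f := fun s : ℝ => ((), s)) h1 h2).continuousWithinAt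
  obtain ⟨s0, -, hs0⟩ := isCompact_Icc.exists_isMinOn (s := Set.Icc (0 : ℝ) (1 / 2))
    ⟨0, by simp⟩ hcon.norm
  have hpos : 0 < ‖dq (wB g) s0‖ := norm_pos_iff.2 (dq_wB g s0)
  have hmaps : Set.MapsTo (fun c => Real.arccos c / (2 * π)) (Set.Icc (-1 : ℝ) 1)
      (Set.Icc (0 : ℝ) (1 / 2)) := fun c _ => by
    have := Real.arccos_nonneg c
    have := Real.arccos_le_pi c
    have := Real.pi_pos
    refine ⟨by positivity, ?_⟩
    rw [div_le_iff₀ (by positivity)]; linarith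
  obtain ⟨V, hV, hVc⟩ := exists_smooth_approx (D := fun c => dq (wB g) (Real.arccos c / (2 * π)))
    (hcon.comp (Real.continuous_arccos.div_const _).continuousOn hmaps) hpos
  refine ⟨V, hV, fun s => ?_⟩
  obtain ⟨r, hr, h1, h2⟩ := dq_reduce (SF.wB.per g) s
  rw [h1, h2]
  have hp := Real.pi_pos
  have h3 : Real.arccos (cs r) / (2 * π) = r := by
    unfold cs
    rw [Real.arccos_cos (by have := hr.1; positivity) (by nlinarith [hr.2])]
    field_simp
  have h4 := hVc (cs r) ⟨Real.neg_one_le_cos _, Real.cos_le_one _⟩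
  simp only [h3] at h4
  exact lt_of_lt_of_le h4 (hs0 hr)

theorem adm_open {Z : Type*} [TopologicalSpace Z] {w : Z → ℝ → W3} (hw : SF w) {V : ℝ → W3}
    (hV : ContDiff ℝ (⊤ : ℕ∞) V) {z0 : Z} (h : AdmB (w z0) V) : ∀ᶠ z in 𝓝 z0, AdmB (w z) V := by
  have := (isCompact_Icc (a := (0 : ℝ)) (b := 1 / 2)).eventually_forall_of_forall_eventually
    (x₀ := z0) (P := fun z s => ‖V (cs s) - dq (w z) s‖ < ‖dq (w z) s‖) (fun s hs => by
      have h1 := dq_cont hw z0 hs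
      have h2 : Continuous (fun p : Z × ℝ => V (cs p.2)) :=
        hV.continuous.comp (cs_smooth.continuous.comp continuous_snd)
      exact (h2.continuousAt.sub h1).norm.eventually_lt h1.norm (h s))
  filter_upwards [this] with z hz s
  obtain ⟨r, hr, h1, h2⟩ := dq_reduce (hw.per z) s
  rw [h1, h2]
  exact hz r hr

theorem AdmB.convex {w V V' : ℝ → W3} (h : AdmB w V) (h' : AdmB w V') (a : I) :
    AdmB w (fun c => (1 - (a : ℝ)) • V c + (a : ℝ) • V' c) := fun s => by
  have := (convex_ball (dq w s) ‖dq w s‖) (x := V (cs s)) (by simpa [dist_eq_norm] using h s)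
    (y := V' (cs s)) (by simpa [dist_eq_norm] using h' s) (a := 1 - (a : ℝ)) (b := a)
    (by linarith [a.2.2]) a.2.1 (by ring)
  simpa [dist_eq_norm] using this

theorem muP_zero : muP 0 = 0 := by simp [muP]
theorem muP_one : muP 1 = 1 := by norm_num [muP]
theorem nuP_one : nuP 1 = 1 := by norm_num [nuP]

theorem famB_zero (w V : ℝ → W3) : famB w V 0 = w := by
  funext t; simp [famB, muP_zero]

theorem famB_one (w V : ℝ → W3) : famB w V 1 = fun t => (1 / 2 * sn t) • V 0 := by
  funext t; simp [famB, muP_one, nuP_one]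

/-- base point -/
def s0B : W3x := ⟨(0, 1), pole_ne one_ne_zero⟩

/-- the distinguished classes -/
def PB (g : BB) : Set (Path.Homotopic.Quotient g (jB s0B)) :=
  {c | ∃ V : ℝ → W3, ContDiff ℝ (⊤ : ℕ∞) V ∧ AdmB (wB g) V ∧ ∃ x : W3x, x.1 = V 0 ∧
    ∃ a : Path g (jB x), (∀ r, wB (a r) = famB (wB g) V r) ∧ ∃ k : Path x s0B,
    c = (Path.Homotopic.Quotient.mk a).trans (Path.Homotopic.Quotient.mk (k.map continuous_jB))}

theorem PB_of_adm (g : BB) {V : ℝ → W3} (hV : ContDiff ℝ (⊤ : ℕ∞) V) (h : AdmB (wB g) V) :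
    ∃ x : W3x, x.1 = V 0 ∧ ∃ a : Path g (jB x), (∀ r, wB (a r) = famB (wB g) V r) ∧
    ∃ _ : Path x s0B, True := by
  have := simplyConnected_W3x
  refine ⟨⟨V 0, h.ne (by norm_num) (by norm_num)⟩, rfl, ?_⟩
  have hsf : SF (fun r : I => famB (wB g) V r) := by
    have := SF.famB (Z := I) (w := fun _ => wB g) (SF.const (SF.wB.smooth g) (SF.wB.per g)) hV hV
      (a := fun _ => 0) (τ := fun r => (r : ℝ)) continuous_const continuous_subtype_val
    simpa using this
  have hc := hsf.liftB (fun r s => dq_famB_ne (SF.wB.smooth g) hV h r s)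
  refine ⟨⟨⟨_, hc⟩, BB.ext' fun t => ?_, BB.ext' fun t => ?_⟩, fun r => rfl,
    PathConnectedSpace.somePath _ _, trivial⟩
  · simp [famB_zero]
  · simp [famB_one, jB]

theorem PB_nat {g g' : BB} (γ : Path g g') {V V' : ℝ → W3} (hV : ContDiff ℝ (⊤ : ℕ∞) V)
    (hV' : ContDiff ℝ (⊤ : ℕ∞) V')
    (h : ∀ θ : I, AdmB (wB (γ θ)) (fun c => (1 - (θ : ℝ)) • V c + (θ : ℝ) • V' c))
    {x x' : W3x} (hx : x.1 = V 0) (hx' : x'.1 = V' 0)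
    (a : Path g (jB x)) (ha : ∀ r, wB (a r) = famB (wB g) V r)
    (a' : Path g' (jB x')) (ha' : ∀ r, wB (a' r) = famB (wB g') V' r)
    (k : Path x s0B) (k' : Path x' s0B) :
    (Path.Homotopic.Quotient.mk a).trans (Path.Homotopic.Quotient.mk (k.map continuous_jB)) =
    (Path.Homotopic.Quotient.mk γ).trans ((Path.Homotopic.Quotient.mk a').trans
      (Path.Homotopic.Quotient.mk (k'.map continuous_jB))) := by
  have := simplyConnected_W3x
  have hsf := SF.famB (Z := I × I) (w := fun z => wB (γ z.1))
    (SF.wB.comp (by fun_prop)) hV hV' (a := fun z => (z.1 : ℝ)) (τ := fun z => (z.2 : ℝ))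
    (by fun_prop) (by fun_prop)
  have hVs : ∀ θ : ℝ, ContDiff ℝ (⊤ : ℕ∞) (fun c => (1 - θ) • V c + θ • V' c) := fun θ =>
    (hV.const_smul (1 - θ)).add (hV'.const_smul θ)
  have hG := hsf.liftB (fun z s => dq_famB_ne (SF.wB.smooth (γ z.1)) (hVs z.1) (h z.1) z.2 s)
  have hne : ∀ θ : I, (1 - (θ : ℝ)) • V 0 + (θ : ℝ) • V' 0 ≠ 0 := fun θ =>
    (h θ).ne (c := 0) (by norm_num) (by norm_num)
  have hVc : Continuous fun θ : I => (1 - (θ : ℝ)) • V 0 + (θ : ℝ) • V' 0 := by fun_prop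
  refine cls_nat jB continuous_jB γ a a' k k' _ hG
    ⟨⟨fun θ => ⟨(1 - (θ : ℝ)) • V 0 + (θ : ℝ) • V' 0, hne θ⟩, hVc.subtype_mk _⟩,
      Subtype.ext (by simp [hx]), Subtype.ext (by simp [hx'])⟩ ?_ ?_ ?_ ?_
  · intro θ; apply BB.ext'; intro t; simp [famB_zero]
  · intro r; apply BB.ext'; intro t; simp [ha]
  · intro r; apply BB.ext'; intro t; simp [ha']
  · intro θ; apply BB.ext'; intro t; simp [famB_one, jB]

theorem simplyConnected_BB : SimplyConnectedSpace BB := by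
  refine simplyConnected_of_coherent (jB s0B) PB ?_ ?_
  · rintro g c ⟨V, hV, h, x, hx, a, ha, k, rfl⟩ c' ⟨V', hV', h', x', hx', a', ha', k', rfl⟩
    have := PB_nat (Path.refl g) hV hV' (fun θ => by simpa using h.convex h' θ) hx hx'
      a ha a' ha' k k'
    rw [this, Path.Homotopic.Quotient.mk_refl, Path.Homotopic.Quotient.refl_trans]
  · intro γ θ0
    obtain ⟨V, hV, h⟩ := exists_adm (γ θ0)
    have hop := adm_open (w := fun θ => wB (γ θ)) (SF.wB.comp γ.continuous) hV h
    filter_upwards [ev_path_I hop, hop] with θ ⟨d, hd⟩ hθ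
    obtain ⟨x, hx, a, ha, k, -⟩ := PB_of_adm _ hV h
    obtain ⟨x', hx', a', ha', k', -⟩ := PB_of_adm _ hV hθ
    refine ⟨_, ⟨V, hV, h, x, hx, a, ha, k, rfl⟩, _, ⟨V, hV, hθ, x', hx', a', ha', k', rfl⟩, d, ?_⟩
    refine PB_nat (d.map γ.continuous) hV hV (fun θ => ?_) hx hx' a ha a' ha' k k'
    have := hd θ
    simpa [← add_smul] using this
end

noncomputable section
open unitInterval
/-! ### Part 6: projecting along a direction -/

/-- projection along `(1,a)` -/
def La (a : W3) : E4 →L[ℝ] W3 :=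
  ContinuousLinearMap.snd ℝ ℝ W3 - (ContinuousLinearMap.fst ℝ ℝ W3).smulRight a

@[simp] theorem La_apply (a : W3) (e : E4) : La a e = e.2 - e.1 • a := rfl

/-- `a` is a good direction for the curve. -/
def Good (f : ℝ → E4) (a : W3) : Prop := IsLoopEmb (fun t => La a (f t))

/-- straightening the first coordinate to the cosine -/
def segE (f : ℝ → E4) (a : W3) (r : ℝ) : ℝ → E4 := fun t =>
  f t + (r * (cs t - (f t).1)) • ((1, a) : E4)

theorem La_segE (f : ℝ → E4) (a : W3) (r t : ℝ) : La a (segE f a r t) = La a (f t) := by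
  simp [segE, La_apply, add_smul]

theorem SF.segE {Z : Type*} [TopologicalSpace Z] {f : Z → ℝ → E4} (hf : SF f) {a : Z → W3}
    (ha : Continuous a) {r : Z → ℝ} (hr : Continuous r) :
    SF (fun z => segE (f z) (a z) (r z)) := by
  have h1 : SF (fun z (t : ℝ) => r z * (cs t - (f z t).1)) :=
    (SF.param hr).mul ((SF.const cs_smooth cs_per).sub hf.fst)
  have h2 : SF (fun z (_ : ℝ) => ((1, a z) : E4)) := SF.param (continuous_const.prodMk ha)
  exact hf.add (h1.smul h2)

theorem SF.La {Z : Type*} [TopologicalSpace Z] {f : Z → ℝ → E4} (hf : SF f) {a : Z → W3}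
    (ha : Continuous a) : SF (fun z t => La (a z) (f z t)) :=
  hf.snd.sub (hf.fst.smul (SF.param ha))

theorem Good.segE {f : ℝ → E4} (hf : ContDiff ℝ (⊤ : ℕ∞) f) (hp : Loop1 f) {a : W3}
    (h : Good f a) (r : ℝ) : IsLoopEmb (segE f a r) := by
  have hsf := SF.segE (Z := Unit) (f := fun _ => f) (SF.const hf hp) (a := fun _ => a)
    (r := fun _ => r) continuous_const continuous_const
  refine IsLoopEmb.of_clm (hsf.smooth ()) (hsf.per ()) (_root_.La a) ?_
  have : (fun t => _root_.La a (_root_.segE f a r t)) = fun t => _root_.La a (f t) := by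
    funext t; rw [La_segE]
  rw [this]; exact h

theorem segE_zero (f : ℝ → E4) (a : W3) : segE f a 0 = f := by
  funext t; simp [segE]

theorem segE_one_fst (f : ℝ → E4) (a : W3) (t : ℝ) : (segE f a 1 t).1 = cs t := by
  simp [segE]

/-- base point -/
def b0 : BB := jB s0B

/-- classes obtained from a good direction -/
def ClsE (f : EmbS1 E4) (a : W3) : Set (Path.Homotopic.Quotient f b0.1) :=
  {c | ∃ b : BB, ∃ α : Path f b.1, (∀ r : I, crv (α r) = segE (crv f) a r) ∧ ∃ k : Path b b0,
    c = (Path.Homotopic.Quotient.mk α).trans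
      (Path.Homotopic.Quotient.mk (k.map continuous_subtype_val))}

theorem ClsE_nonempty {f : EmbS1 E4} {a : W3} (h : Good (crv f) a) : (ClsE f a).Nonempty := by
  have := simplyConnected_BB
  have hsf := SF.segE (Z := I) (f := fun _ => crv f) (SF.const (crv_emb f).1 (crv_emb f).2.1)
    (a := fun _ => a) (r := fun r => (r : ℝ)) continuous_const continuous_subtype_val
  have hc := hsf.lift (fun r => h.segE (crv_emb f).1 (crv_emb f).2.1 r)
  let b : BB := ⟨mkE (segE (crv f) a 1) (h.segE (crv_emb f).1 (crv_emb f).2.1 1),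
    fun t => segE_one_fst _ _ t⟩
  exact ⟨_, b, ⟨⟨_, hc⟩, EmbS1.ext' fun t => by simp [segE_zero], EmbS1.ext' fun t => by simp [b]⟩,
    fun r => rfl, PathConnectedSpace.somePath _ _, rfl⟩

theorem ClsE_nat {f f' : EmbS1 E4} (γ : Path f f') {a a' : W3} (A : Path a a')
    (h : ∀ θ, Good (crv (γ θ)) (A θ)) {c : Path.Homotopic.Quotient f b0.1}
    {c' : Path.Homotopic.Quotient f' b0.1} (hc : c ∈ ClsE f a) (hc' : c' ∈ ClsE f' a') :
    c = (Path.Homotopic.Quotient.mk γ).trans c' := by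
  have := simplyConnected_BB
  obtain ⟨b, α, hα, k, rfl⟩ := hc
  obtain ⟨b', α', hα', k', rfl⟩ := hc'
  have hsf := SF.segE (Z := I × I) (f := fun z => crv (γ z.1)) (SF.emb.comp (by fun_prop))
    (a := fun z => A z.1) (r := fun z => (z.2 : ℝ)) (by fun_prop) (by fun_prop)
  have hG := hsf.lift (fun z => (h z.1).segE (crv_emb _).1 (crv_emb _).2.1 z.2)
  have hκ := hG.comp (by fun_prop : Continuous fun θ : I => (θ, (1 : I)))
  refine cls_nat (S := BB) Subtype.val continuous_subtype_val γ α α' k k' _ hG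
    ⟨⟨_, hκ.subtype_mk fun θ t => by simp [segE_one_fst]⟩, ?_, ?_⟩ ?_ ?_ ?_ ?_
  · apply Subtype.ext; apply EmbS1.ext'; intro t
    have := hα 1
    simp at this
    simp [this]
  · apply Subtype.ext; apply EmbS1.ext'; intro t
    have := hα' 1
    simp at this
    simp [this]
  · intro θ; apply EmbS1.ext'; intro t; simp [segE_zero]
  · intro r; apply EmbS1.ext'; intro t; simp [hα]
  · intro r; apply EmbS1.ext'; intro t; simp [hα']
  · intro θ; rfl

theorem ev_good {Z : Type*} [TopologicalSpace Z] {f : Z → ℝ → E4} (hf : SF f) {a : Z → W3}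
    (ha : Continuous a) {z0 : Z} (h : Good (f z0) (a z0)) : ∀ᶠ z in 𝓝 z0, Good (f z) (a z) :=
  ev_emb (hf.La ha) h

theorem exists_good {f : ℝ → E4} (hf : IsLoopEmb f) : ∃ a, Good f a := by
  have hd : ContDiff ℝ (⊤ : ℕ∞) (deriv f) := by
    have := hf.1
    exact ((contDiff_infty_iff_deriv).1 this).2
  let g1 : ℝ × ℝ × ℝ → E4 := fun p => p.1 • (f p.2.1 - f p.2.2)
  let g2 : ℝ × ℝ → E4 := fun p => p.1 • deriv f p.2
  have hg1 : ContDiff ℝ 1 g1 := by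
    have h1 : ContDiff ℝ 1 f := hf.1.of_le (by simp)
    exact contDiff_fst.smul ((h1.comp (contDiff_fst.comp contDiff_snd)).sub
      (h1.comp (contDiff_snd.comp contDiff_snd)))
  have hg2 : ContDiff ℝ 1 g2 := by
    have h1 : ContDiff ℝ 1 (deriv f) := hd.of_le (by simp)
    exact contDiff_fst.smul (h1.comp contDiff_snd)
  have hdim : dimH (Set.range g1 ∪ Set.range g2) < Module.finrank ℝ E4 := by
    rw [dimH_union]
    refine max_lt (lt_of_le_of_lt hg1.dimH_range_le ?_) (lt_of_le_of_lt hg2.dimH_range_le ?_)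
    · simp [Module.finrank_prod]; norm_num
    · simp [Module.finrank_prod]; norm_num
  have hdense := dense_compl_of_dimH_lt_finrank hdim
  obtain ⟨e, he, hpos⟩ := hdense.exists_mem_open (U := {e : E4 | 0 < e.1})
    (isOpen_lt continuous_const continuous_fst) ⟨(1, 0), by simp⟩
  have hpos : 0 < e.1 := hpos
  have hsf := SF.La (Z := Unit) (f := fun _ => f) (SF.const hf.1 hf.2.1) (a := fun _ => e.1⁻¹ • e.2)
    continuous_const
  refine ⟨e.1⁻¹ • e.2, hsf.smooth (), hsf.per (), ?_, ?_⟩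
  · intro t ht
    apply he
    right
    have hdf : HasDerivAt f (deriv f t) t := (hf.1.differentiable (by simp) t).hasDerivAt
    have h2 : La (e.1⁻¹ • e.2) (deriv f t) = 0 := by
      rw [← ht]
      exact (((La (e.1⁻¹ • e.2)).hasFDerivAt.comp_hasDerivAt t hdf).deriv).symm
    rw [La_apply, sub_eq_zero] at h2
    have h3 : (deriv f t).1 ≠ 0 := by
      intro h0
      apply hf.2.2.1 t
      rw [h0, zero_smul] at h2
      exact Prod.ext h0 h2
    refine ⟨(e.1 / (deriv f t).1, t), ?_⟩
    refine Prod.ext ?_ ?_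
    · simp [g2]; field_simp
    · simp only [g2, Prod.smul_snd]
      rw [h2, smul_smul, smul_smul]
      rw [show e.1 / (deriv f t).1 * (deriv f t).1 * e.1⁻¹ = 1 by field_simp, one_smul]
  · intro s t hst
    by_contra hn
    have h2 : La (e.1⁻¹ • e.2) (f s - f t) = 0 := by
      rw [map_sub, sub_eq_zero]; exact hst
    rw [La_apply, sub_eq_zero] at h2
    have h3 : (f s - f t).1 ≠ 0 := by
      intro h0
      apply hn
      apply hf.2.2.2
      rw [← sub_eq_zero]
      rw [h0, zero_smul] at h2
      exact Prod.ext h0 h2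
    apply he
    left
    refine ⟨(e.1 / (f s - f t).1, s, t), ?_⟩
    refine Prod.ext ?_ ?_
    · simp only [g1, Prod.smul_fst, smul_eq_mul]; field_simp
    · simp only [g1, Prod.smul_snd]
      rw [h2, smul_smul, smul_smul]
      rw [show e.1 / (f s - f t).1 * (f s - f t).1 * e.1⁻¹ = 1 by field_simp, one_smul]

/-- Reduction of the main theorem. -/
theorem simplyConnected_of_cls (H : ∀ (f : EmbS1 E4) (a a' : W3), Good (crv f) a →
    Good (crv f) a' → ∀ c ∈ ClsE f a, ∀ c' ∈ ClsE f a', c = c') :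
    SimplyConnectedSpace (EmbS1 E4) := by
  refine simplyConnected_of_coherent b0.1
    (fun f => {c | ∃ a, Good (crv f) a ∧ c ∈ ClsE f a}) ?_ ?_
  · rintro f c ⟨a, ha, hc⟩ c' ⟨a', ha', hc'⟩
    exact H f a a' ha ha' c hc c' hc'
  · intro γ θ0
    obtain ⟨a, ha⟩ := exists_good (crv_emb (γ θ0))
    have hop := ev_good (f := fun θ => crv (γ θ)) (SF.emb.comp γ.continuous) (a := fun _ => a)
      continuous_const ha
    filter_upwards [ev_path_I hop, hop] with θ ⟨d, hd⟩ hθ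
    obtain ⟨c, hc⟩ := ClsE_nonempty ha
    obtain ⟨c', hc'⟩ := ClsE_nonempty hθ
    exact ⟨c, ⟨a, ha, hc⟩, c', ⟨a, hθ, hc'⟩, d,
      ClsE_nat (d.map γ.continuous) (Path.refl a) (fun θ => hd θ) hc hc'⟩

theorem pathConnected_E4 : PathConnectedSpace (EmbS1 E4) := by
  have key : ∀ f : EmbS1 E4, Nonempty (Path f b0.1) := fun f => by
    obtain ⟨a, ha⟩ := exists_good (crv_emb f)
    obtain ⟨c, -⟩ := ClsE_nonempty ha
    obtain ⟨p, -⟩ := Path.Homotopic.Quotient.mk_surjective c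
    exact ⟨p⟩
  exact ⟨⟨b0.1⟩, fun f g => ⟨(key f).some.trans (key g).some.symm⟩⟩
end

noncomputable section
open unitInterval
/-! ### Part 7: the family around a transverse double point -/

/-- the determinant of two plane vectors -/
def dt (a b : ℂ) : ℝ := a.re * b.im - a.im * b.re

theorem dt_mul (c a b : ℂ) : dt (c * a) (c * b) = Complex.normSq c * dt a b := by
  simp [dt, Complex.normSq_apply]; ring

theorem dt_bound {a b : ℂ} (h : dt a b ≠ 0) :
    ∃ c > 0, ∀ x y : ℝ, c * (|x| + |y|) ≤ ‖x • a - y • b‖ := by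
  have hb : ∀ z w : ℂ, |dt z w| ≤ 2 * ‖z‖ * ‖w‖ := fun z w => by
    have h1 := Complex.abs_re_le_norm z
    have h2 := Complex.abs_im_le_norm z
    have h3 := Complex.abs_re_le_norm w
    have h4 := Complex.abs_im_le_norm w
    calc |dt z w| ≤ |z.re * w.im| + |z.im * w.re| := by
          unfold dt; exact abs_sub _ _
      _ ≤ ‖z‖ * ‖w‖ + ‖z‖ * ‖w‖ := by rw [abs_mul, abs_mul]; gcongr
      _ = _ := by ring
  have hD : 0 < |dt a b| := abs_pos.2 h
  have hab : 0 < ‖a‖ + ‖b‖ := by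
    by_contra hn
    have : ‖a‖ = 0 := by linarith [norm_nonneg a, norm_nonneg b]
    rw [norm_eq_zero] at this
    apply h; simp [dt, this]
  refine ⟨|dt a b| / (2 * (‖a‖ + ‖b‖)), by positivity, fun x y => ?_⟩
  have e1 : dt (x • a - y • b) b = x * dt a b := by simp [dt]; ring
  have e2 : dt (x • a - y • b) a = y * dt a b := by simp [dt]; ring
  have b1 := hb (x • a - y • b) b
  have b2 := hb (x • a - y • b) a
  rw [e1, abs_mul] at b1
  rw [e2, abs_mul] at b2
  rw [div_mul_eq_mul_div, div_le_iff₀ (by positivity)]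
  nlinarith

theorem dt_equiv {a b c d : ℂ} (h : dt a b ≠ 0) (h' : dt c d ≠ 0) :
    ∃ S : ℂ ≃L[ℝ] ℂ, S a = c ∧ S b = d := by
  have key : ∀ {a b : ℂ}, dt a b ≠ 0 → LinearIndependent ℝ ![a, b] := fun {a b} h => by
    rw [LinearIndependent.pair_iff]
    intro x y hxy
    obtain ⟨c, hc, hb⟩ := dt_bound h
    have := hb x (-y)
    rw [neg_smul, sub_neg_eq_add, hxy, norm_zero] at this
    have h3 : |x| + |-y| ≤ 0 := by
      by_contra hn
      push Not at hn
      nlinarith [mul_pos hc hn]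
    rw [abs_neg] at h3
    exact ⟨abs_eq_zero.1 (le_antisymm (by linarith [abs_nonneg y]) (abs_nonneg x)),
      abs_eq_zero.1 (le_antisymm (by linarith [abs_nonneg x]) (abs_nonneg y))⟩
  have hc : Fintype.card (Fin 2) = Module.finrank ℝ ℂ := by simp
  let B := basisOfLinearIndependentOfCardEqFinrank (key h) hc
  let B' := basisOfLinearIndependentOfCardEqFinrank (key h') hc
  refine ⟨(B.equiv B' (Equiv.refl _)).toContinuousLinearEquiv, ?_, ?_⟩
  · have h1 : B 0 = a := by simp [B]
    have h2 : B' 0 = c := by simp [B']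
    have := B.equiv_apply 0 B' (Equiv.refl _)
    simpa [h1, h2] using this
  · have h1 : B 1 = b := by simp [B]
    have h2 : B' 1 = d := by simp [B']
    have := B.equiv_apply 1 B' (Equiv.refl _)
    simpa [h1, h2] using this

/-- local linear approximation of a family -/
theorem SF.approx {Z E : Type*} [TopologicalSpace Z] [NormedAddCommGroup E] [NormedSpace ℝ E]
    {f : Z → ℝ → E} (h : SF f) (z0 : Z) (s0 : ℝ) {δ : ℝ} (hδ : 0 < δ) :
    ∀ᶠ p : Z × ℝ in 𝓝 (z0, s0),
      ‖f p.1 p.2 - f p.1 s0 - (p.2 - s0) • deriv (f z0) s0‖ ≤ δ * |p.2 - s0| := by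
  have hc : Continuous fun p : Z × ℝ => ‖deriv (f p.1) p.2 - deriv (f z0) s0‖ :=
    (h.cont'.sub continuous_const).norm
  have ev := hc.continuousAt (x := (z0, s0)).eventually (gt_mem_nhds (by simpa using hδ))
  rw [nhds_prod_eq, Filter.eventually_prod_iff] at ev
  obtain ⟨pa, ha, pb, hb, hab⟩ := ev
  obtain ⟨ε, hε, hb⟩ := Metric.eventually_nhds_iff_ball.1 hb
  have e1 : ∀ᶠ p : Z × ℝ in 𝓝 (z0, s0), pa p.1 :=
    (continuous_fst.continuousAt (x := (z0, s0))).eventually ha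
  have e2 : ∀ᶠ p : Z × ℝ in 𝓝 (z0, s0), p.2 ∈ Metric.ball s0 ε :=
    (continuous_snd.continuousAt (x := (z0, s0))).eventually (Metric.ball_mem_nhds _ hε)
  filter_upwards [e1, e2] with p h1 h2
  have := (convex_ball s0 ε).norm_image_sub_le_of_norm_hasDerivWithin_le
    (f := fun t => f p.1 t - t • deriv (f z0) s0)
    (f' := fun t => deriv (f p.1) t - deriv (f z0) s0) (C := δ)
    (x := s0) (y := p.2)
    (fun x _ => by
      have h3 := ((h.diff p.1 x).hasDerivAt.sub ((hasDerivAt_id x).smul_const (deriv (f z0) s0)))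
      have h4 := h3.hasDerivWithinAt (s := Metric.ball s0 ε)
      rw [one_smul] at h4
      exact h4)
    (fun x hx => (hab h1 (hb x hx)).le) (Metric.mem_ball_self hε) h2
  rw [Real.norm_eq_abs] at this
  convert this using 2
  rw [sub_smul]; abel

/-- double points are isolated -/
theorem ev_transverse {Z : Type*} [TopologicalSpace Z] {v : Z → ℝ → ℂ} (h : SF v) {z0 : Z}
    {s0 t0 : ℝ} (h0 : ∀ z, v z s0 = v z t0) (hd : dt (deriv (v z0) s0) (deriv (v z0) t0) ≠ 0) :
    ∀ᶠ p : Z × (ℝ × ℝ) in 𝓝 (z0, (s0, t0)), v p.1 p.2.1 = v p.1 p.2.2 →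
      p.2.1 = s0 ∧ p.2.2 = t0 := by
  obtain ⟨c, hc, hb⟩ := dt_bound hd
  have e1 := h.approx z0 s0 (half_pos hc)
  have e2 := h.approx z0 t0 (half_pos hc)
  have t1 : Filter.Tendsto (fun p : Z × (ℝ × ℝ) => (p.1, p.2.1)) (𝓝 (z0, (s0, t0))) (𝓝 (z0, s0)) :=
    (by fun_prop : Continuous fun p : Z × (ℝ × ℝ) => (p.1, p.2.1)).tendsto _
  have t2 : Filter.Tendsto (fun p : Z × (ℝ × ℝ) => (p.1, p.2.2)) (𝓝 (z0, (s0, t0))) (𝓝 (z0, t0)) :=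
    (by fun_prop : Continuous fun p : Z × (ℝ × ℝ) => (p.1, p.2.2)).tendsto _
  filter_upwards [t1.eventually e1, t2.eventually e2] with p h1 h2 heq
  have h3 := hb (p.2.1 - s0) (p.2.2 - t0)
  have h4 : (p.2.1 - s0) • deriv (v z0) s0 - (p.2.2 - t0) • deriv (v z0) t0 =
     (v p.1 p.2.2 - v p.1 t0 - (p.2.2 - t0) • deriv (v z0) t0)
     - (v p.1 p.2.1 - v p.1 s0 - (p.2.1 - s0) • deriv (v z0) s0) := by
    rw [heq, h0]; abel
  have h5 := norm_sub_le (v p.1 p.2.2 - v p.1 t0 - (p.2.2 - t0) • deriv (v z0) t0)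
     (v p.1 p.2.1 - v p.1 s0 - (p.2.1 - s0) • deriv (v z0) s0)
  rw [← h4] at h5
  have h6 : |p.2.1 - s0| + |p.2.2 - t0| ≤ 0 := by
    by_contra hn
    push Not at hn
    nlinarith [mul_pos hc hn]
  constructor
  · rw [← sub_eq_zero, ← abs_eq_zero]; linarith [abs_nonneg (p.2.1 - s0), abs_nonneg (p.2.2 - t0)]
  · rw [← sub_eq_zero, ← abs_eq_zero]; linarith [abs_nonneg (p.2.1 - s0), abs_nonneg (p.2.2 - t0)]

/-- the pair is trivial, or is the given double point (up to order and periods) -/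
def Tri (s0 t0 s t : ℝ) : Prop := (∃ n : ℤ, s = t + n) ∨ (∃ m n : ℤ, s = s0 + m ∧ t = t0 + n) ∨
  (∃ m n : ℤ, s = t0 + m ∧ t = s0 + n)

theorem emb_family {E Z : Type*} [NormedAddCommGroup E] [NormedSpace ℝ E] [TopologicalSpace Z]
    [CompactSpace Z] {F : Z × ℂ → ℝ → E} (hF : SF F) {s0 t0 : ℝ}
    (himm : ∀ z t, deriv (F (z, 0)) t ≠ 0)
    (hinj : ∀ z s t, F (z, 0) s = F (z, 0) t → Tri s0 t0 s t)
    (hloc : ∀ z, ∀ᶠ p : (Z × ℂ) × (ℝ × ℝ) in 𝓝 ((z, 0), (s0, t0)), p.1.2 ≠ 0 →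
      F p.1 p.2.1 ≠ F p.1 p.2.2) :
    ∃ ε > 0, ∀ z η, η ≠ 0 → ‖η‖ < ε → IsLoopEmb (F (z, η)) := by
  have key : ∀ z : Z, ∀ᶠ w : ℂ × Z in 𝓝 (0, z), w.1 ≠ 0 → IsLoopEmb (F (w.2, w.1)) := fun z => by
    have h1 := ev_global hF (A := fun w => w.2 ≠ 0) (z0 := (z, 0)) (fun s1 t1 => by
      by_cases heq : F (z, 0) s1 = F (z, 0) t1
      · rcases hinj z s1 t1 heq with ⟨n, hn⟩ | ⟨m, n, rfl, rfl⟩ | ⟨m, n, rfl, rfl⟩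
        · exact ev_diag' hF (A := fun w => w.2 ≠ 0) hn (himm z t1)
        · refine ev_shift hF (A := fun w => w.2 ≠ 0) m n ?_
          filter_upwards [hloc z] with p hp hA h2
          exact absurd h2 (hp hA)
        · refine ev_shift hF (A := fun w => w.2 ≠ 0) m n ?_
          have hc : Continuous fun p : (Z × ℂ) × (ℝ × ℝ) => (p.1, (p.2.2, p.2.1)) := by fun_prop
          have ht := hc.tendsto ((z, 0), (t0, s0))
          filter_upwards [ht.eventually (hloc z)] with p hp hA h2
          exact absurd h2.symm (hp hA)
      · filter_upwards [ev_of_ne hF heq] with p hp _ h2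
        exact absurd h2 hp)
    have hsw : Filter.Tendsto (fun w : ℂ × Z => (w.2, w.1)) (𝓝 (0, z)) (𝓝 (z, 0)) :=
      continuous_swap.tendsto _
    filter_upwards [hsw.eventually h1, hsw.eventually (ev_imm hF (himm z))] with w h2 h3 h4
    exact ⟨hF.smooth _, hF.per _, h3, h2 h4⟩
  have := isCompact_univ.eventually_forall_of_forall_eventually (x₀ := (0 : ℂ))
    (P := fun η (z : Z) => η ≠ 0 → IsLoopEmb (F (z, η))) (fun z _ => key z)
  obtain ⟨ε, hε, h⟩ := Metric.eventually_nhds_iff.1 this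
  exact ⟨ε, hε, fun z η h0 hη => h (by simpa using hη) z (Set.mem_univ z) h0⟩

/-- families whose image under a linear family does not depend on the parameter -/
theorem loc_of_linear {E Z : Type*} [NormedAddCommGroup E] [NormedSpace ℝ E] [TopologicalSpace Z]
    {F : Z × ℂ → ℝ → E} (_ : SF F) {v : Z → ℝ → ℂ} (hv : SF v) {s0 t0 : ℝ}
    (h0 : ∀ z, v z s0 = v z t0) {z : Z} (hd : dt (deriv (v z) s0) (deriv (v z) t0) ≠ 0)
    (hl : ∀ z η s t, F (z, η) s = F (z, η) t → v z s = v z t)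
    (hη : ∀ z η, F (z, η) s0 = F (z, η) t0 → η = 0) :
    ∀ᶠ p : (Z × ℂ) × (ℝ × ℝ) in 𝓝 ((z, 0), (s0, t0)), p.1.2 ≠ 0 →
      F p.1 p.2.1 ≠ F p.1 p.2.2 := by
  have ht : Filter.Tendsto (fun p : (Z × ℂ) × (ℝ × ℝ) => (p.1.1, p.2)) (𝓝 ((z, 0), (s0, t0)))
      (𝓝 (z, (s0, t0))) :=
    (by fun_prop : Continuous fun p : (Z × ℂ) × (ℝ × ℝ) => (p.1.1, p.2)).tendsto _
  filter_upwards [ht.eventually (ev_transverse hv h0 hd)] with p hp hne heq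
  obtain ⟨h1, h2⟩ := hp (hl _ _ _ _ heq)
  rw [h1, h2] at heq
  exact hne (hη _ _ heq)

theorem homotopic_of_SF {E Y : Type*} [NormedAddCommGroup E] [NormedSpace ℝ E] [TopologicalSpace Y]
    {F : I × Y → ℝ → E} (hF : SF F) (he : ∀ z, IsLoopEmb (F z)) {G0 G1 : C(Y, EmbS1 E)}
    (h0 : ∀ y t, crv (G0 y) t = F (0, y) t) (h1 : ∀ y t, crv (G1 y) t = F (1, y) t) :
    G0.Homotopic G1 :=
  ⟨{ toFun := fun z => mkE (F z) (he z)
     continuous_toFun := hF.lift he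
     map_zero_left := fun y => EmbS1.ext' fun t => by simp [h0]
     map_one_left := fun y => EmbS1.ext' fun t => by simp [h1] }⟩
end

noncomputable section
open unitInterval
/-! ### Part 8: contracting the family around a transverse double point -/

/-- a figure eight with prescribed double point -/
def Fig (s0 t0 : ℝ) (t : ℝ) : ℂ :=
  (cs (t - (s0 + t0) / 2) : ℂ) +
    ((sn (t - (s0 + t0) / 2) * (cs (t - (s0 + t0) / 2) - cs ((t0 - s0) / 2)) : ℝ) : ℂ) * Complex.I

theorem Fig_SF (s0 t0 : ℝ) {Z : Type*} [TopologicalSpace Z] : SF (fun _ : Z => Fig s0 t0) := by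
  have h1 : SF (fun (_ : Z) t => cs (t - (s0 + t0) / 2)) :=
    SF.const (cs_smooth.comp (by fun_prop)) (fun t => by
      rw [← cs_per (t - (s0 + t0) / 2)]; congr 1; ring)
  have h2 : SF (fun (_ : Z) t => sn (t - (s0 + t0) / 2)) :=
    SF.const (sn_smooth.comp (by fun_prop)) (fun t => by
      rw [← sn_per (t - (s0 + t0) / 2)]; congr 1; ring)
  exact (h1.clm Complex.ofRealCLM).add (((h2.mul (h1.sub (SF.param continuous_const))).clm
    Complex.ofRealCLM).mul (SF.param continuous_const))

theorem Fig_deriv (s0 t0 t : ℝ) : HasDerivAt (Fig s0 t0)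
    (((-(2 * π) * sn (t - (s0 + t0) / 2) : ℝ) : ℂ) +
    ((2 * π * (cs (t - (s0 + t0) / 2) * (cs (t - (s0 + t0) / 2) - cs ((t0 - s0) / 2))
      - sn (t - (s0 + t0) / 2) ^ 2) : ℝ) : ℂ) * Complex.I) t := by
  have hs : HasDerivAt (fun t : ℝ => t - (s0 + t0) / 2) 1 t := (hasDerivAt_id t).sub_const _
  have h1 := (cs_deriv (t - (s0 + t0) / 2)).comp t hs
  have h2 := (sn_deriv (t - (s0 + t0) / 2)).comp t hs
  have h3 := (h1.ofReal_comp).add (((h2.mul (h1.sub_const (cs ((t0 - s0) / 2)))).ofReal_comp).mul_const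
    Complex.I)
  refine HasDerivAt.congr_deriv (f := Fig s0 t0) h3 ?_
  simp only [Function.comp]
  push_cast
  ring

theorem Fig_eq {s0 t0 s t : ℝ} (h : Fig s0 t0 s = Fig s0 t0 t) : Tri s0 t0 s t := by
  have hre := congrArg Complex.re h
  have him := congrArg Complex.im h
  simp only [Fig, Complex.add_re, Complex.ofReal_re, Complex.re_ofReal_mul, Complex.I_re, mul_zero,
    add_zero] at hre
  simp only [Fig, Complex.add_im, Complex.ofReal_im, Complex.im_ofReal_mul, Complex.I_im, mul_one,
    zero_add] at him
  rcases cs_eq_cs hre with ⟨n, hn⟩ | ⟨n, hn⟩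
  · exact Or.inl ⟨n, by linarith⟩
  · rw [hn, sn_per.add_int, sn_neg, cs_per.add_int, cs_neg] at him
    have h2 : sn (t - (s0 + t0) / 2) * (cs (t - (s0 + t0) / 2) - cs ((t0 - s0) / 2)) = 0 := by
      linarith
    rcases mul_eq_zero.1 h2 with h3 | h3
    · obtain ⟨k, hk⟩ := sn_eq_zero.1 h3
      exact Or.inl ⟨n - k, by push_cast; linarith⟩
    · rcases cs_eq_cs (sub_eq_zero.1 h3) with ⟨k, hk⟩ | ⟨k, hk⟩
      · exact Or.inr (Or.inl ⟨n - k, k, by push_cast; linarith, by linarith⟩)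
      · exact Or.inr (Or.inr ⟨n - k, k, by push_cast; linarith, by linarith⟩)

theorem Fig_dbl (s0 t0 : ℝ) : Fig s0 t0 s0 = Fig s0 t0 t0 := by
  simp only [Fig]
  rw [show s0 - (s0 + t0) / 2 = -((t0 - s0) / 2) by ring,
    show t0 - (s0 + t0) / 2 = (t0 - s0) / 2 by ring, cs_neg]
  simp

theorem Fig_imm {s0 t0 : ℝ} (h : ¬ ∃ n : ℤ, s0 = t0 + n) (t : ℝ) : deriv (Fig s0 t0) t ≠ 0 := by
  rw [(Fig_deriv s0 t0 t).deriv]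
  intro h0
  have hre := congrArg Complex.re h0
  have him := congrArg Complex.im h0
  simp only [Complex.add_re, Complex.ofReal_re, Complex.re_ofReal_mul, Complex.I_re, mul_zero,
    add_zero, Complex.zero_re] at hre
  simp only [Complex.add_im, Complex.ofReal_im, Complex.im_ofReal_mul, Complex.I_im, mul_one,
    zero_add, Complex.zero_im] at him
  have hp := Real.pi_pos
  have h1 : sn (t - (s0 + t0) / 2) = 0 := by
    rcases mul_eq_zero.1 hre with h | h
    · linarith
    · exact h
  rw [h1] at him
  have h2 : cs (t - (s0 + t0) / 2) - cs ((t0 - s0) / 2) = 0 := by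
    rcases mul_eq_zero.1 him with h | h
    · linarith
    · have h' : cs (t - (s0 + t0) / 2) * (cs (t - (s0 + t0) / 2) - cs ((t0 - s0) / 2)) = 0 := by
        linarith
      exact (mul_eq_zero.1 h').resolve_left (cs_ne h1)
  have h3 := cs_sq ((t0 - s0) / 2)
  rw [← sub_eq_zero.1 h2] at h3
  have h4 := cs_sq (t - (s0 + t0) / 2)
  rw [h1] at h4
  have h5 : sn ((t0 - s0) / 2) = 0 := by
    have : sn ((t0 - s0) / 2) ^ 2 = 0 := by linarith
    exact pow_eq_zero_iff (two_ne_zero) |>.1 this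
  obtain ⟨n, hn⟩ := sn_eq_zero.1 h5
  exact h ⟨-n, by push_cast; linarith⟩

theorem Fig_dt {s0 t0 : ℝ} (h : ¬ ∃ n : ℤ, s0 = t0 + n) :
    dt (deriv (Fig s0 t0) s0) (deriv (Fig s0 t0) t0) ≠ 0 := by
  have hs : sn ((t0 - s0) / 2) ≠ 0 := fun h5 => by
    obtain ⟨n, hn⟩ := sn_eq_zero.1 h5
    exact h ⟨-n, by push_cast; linarith⟩
  rw [(Fig_deriv s0 t0 s0).deriv, (Fig_deriv s0 t0 t0).deriv]
  rw [show s0 - (s0 + t0) / 2 = -((t0 - s0) / 2) by ring,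
    show t0 - (s0 + t0) / 2 = (t0 - s0) / 2 by ring, cs_neg, sn_neg]
  simp only [dt, Complex.add_re, Complex.ofReal_re, Complex.re_ofReal_mul, Complex.I_re, mul_zero,
    add_zero, Complex.add_im, Complex.ofReal_im, Complex.im_ofReal_mul, Complex.I_im, mul_one,
    zero_add]
  have hp := Real.pi_pos
  intro h0
  have : (2 * π) ^ 2 * sn ((t0 - s0) / 2) ^ 3 * (-2) = 0 := by rw [← h0]; ring
  simp [hp.ne', hs] at this

theorem pathConnected_CC : PathConnectedSpace (EmbS1 (ℂ × ℂ)) := by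
  have := pathConnected_E4
  have e : E4 ≃L[ℝ] (ℂ × ℂ) := ContinuousLinearEquiv.ofFinrankEq (by
    simp [Module.finrank_prod])
  exact (homeoE e).surjective.pathConnectedSpace (homeoE e).continuous

theorem exists_zeta {ι : Type*} [Finite ι] (c : ι → ℂ) (hc : ∀ i, c i ≠ 0) :
    ∃ ζ : ℂ, ζ ≠ 0 ∧ ∀ i, (ζ * c i).im ≠ 0 := by
  let f : Option ι → Module.Dual ℝ ℂ := fun o => match o with
    | none => Complex.imLm
    | some i => Complex.imLm ∘ₗ LinearMap.mulRight ℝ (c i)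
  obtain ⟨ζ, hζ⟩ := Module.Dual.exists_forall_ne_zero_of_forall_exists f (fun o => by
    match o with
    | none => exact ⟨Complex.I, by simp [f]⟩
    | some i => exact ⟨Complex.I / c i, by simp [f, hc i]⟩)
  refine ⟨ζ, ?_, fun i => ?_⟩
  · rintro rfl
    exact hζ none (by simp)
  · exact hζ (some i)

theorem lin_ne {a b : ℂ} (ha : a ≠ 0) (h : (b * a⁻¹).im ≠ 0) (τ : ℝ) :
    (1 - τ) • a + τ • b ≠ 0 := by
  intro h0
  have h1 : (1 - τ : ℝ) + τ * (b * a⁻¹) = (0 : ℂ) := by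
    rw [Complex.real_smul, Complex.real_smul] at h0
    field_simp
    linear_combination h0
  have h2 := congrArg Complex.im h1
  rw [Complex.add_im, Complex.ofReal_im, Complex.im_ofReal_mul, zero_add, Complex.zero_im] at h2
  have h3 : τ = 0 := (mul_eq_zero.1 h2).resolve_right h
  rw [h3] at h1
  simp at h1
end

noncomputable section
open unitInterval

section M
variable {u X : ℝ → ℂ} {χ : ℝ → ℝ} {s0 t0 : ℝ}

theorem nonint_of_ne (hχp : Loop1 χ) (hχ0 : χ s0 ≠ χ t0) : ¬ ∃ n : ℤ, s0 = t0 + n := by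
  rintro ⟨n, rfl⟩
  exact hχ0 (hχp.add_int t0 n)

/-- first deformation -/
theorem M1 (hu : ContDiff ℝ (⊤ : ℕ∞) u) (hup : Loop1 u) (hX : ContDiff ℝ (⊤ : ℕ∞) X)
    (hXp : Loop1 X) (hχ : ContDiff ℝ (⊤ : ℕ∞) χ) (hχp : Loop1 χ)
    (hu0 : u s0 = u t0) (hX0 : X s0 = X t0) (hχ0 : χ s0 ≠ χ t0)
    (himm : ∀ t, deriv u t ≠ 0) (hdt : dt (deriv u s0) (deriv u t0) ≠ 0)
    (hsep : ∀ s t, u s = u t → X s = X t → Tri s0 t0 s t)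
    (K : Set (ℝ × ℝ)) (hK : K.Finite)
    (hKu : ∀ s t, u s = u t → (∃ n : ℤ, s = t + n) ∨ ∃ p ∈ K, ∃ m n : ℤ, s = p.1 + m ∧ t = p.2 + n) :
    ∃ ζ : ℂ, ζ ≠ 0 ∧ ∃ ε > 0, ∀ (τ : I) (η : ℂ), η ≠ 0 → ‖η‖ < ε → IsLoopEmb (fun t =>
      (u t, (1 - (τ : ℝ)) • X t + (τ : ℝ) • (ζ * Fig s0 t0 t) + η * (χ t : ℂ))) := by
  let J := {p : ℝ × ℝ // p ∈ K ∧ u p.1 = u p.2 ∧ ¬ Tri s0 t0 p.1 p.2}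
  have : Finite J := (hK.subset (fun p (hp : p ∈ K ∧ u p.1 = u p.2 ∧ ¬ Tri s0 t0 p.1 p.2) =>
    hp.1)).to_subtype
  have hXJ : ∀ j : J, X j.1.1 - X j.1.2 ≠ 0 := fun j h0 =>
    j.2.2.2 (hsep _ _ j.2.2.1 (sub_eq_zero.1 h0))
  obtain ⟨ζ, hζ0, hζ⟩ := exists_zeta
    (fun j : J => (Fig s0 t0 j.1.1 - Fig s0 t0 j.1.2) * (X j.1.1 - X j.1.2)⁻¹) (fun j =>
      mul_ne_zero (fun h0 => j.2.2.2 (Fig_eq (sub_eq_zero.1 h0))) (inv_ne_zero (hXJ j)))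
  refine ⟨ζ, hζ0, ?_⟩
  have sfF := Fig_SF s0 t0 (Z := I × ℂ)
  have sf : SF (fun (z : I × ℂ) (t : ℝ) =>
      (u t, (1 - (z.1 : ℝ)) • X t + (z.1 : ℝ) • (ζ * Fig s0 t0 t) + z.2 * (χ t : ℂ))) :=
    (SF.const hu hup).prodMk ((((SF.param (by fun_prop)).smul (SF.const hX hXp)).add
      ((SF.param (by fun_prop)).smul ((SF.param continuous_const).mul sfF))).add
      ((SF.param (by fun_prop)).mul ((SF.const hχ hχp).clm Complex.ofRealCLM)))
  refine emb_family (s0 := s0) (t0 := t0) sf ?_ ?_ ?_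
  · intro z t h0
    have := ((ContinuousLinearMap.fst ℝ ℂ ℂ).hasFDerivAt.comp_hasDerivAt t
      (sf.diff (z, 0) t).hasDerivAt).deriv
    rw [h0, map_zero] at this
    exact himm t this
  · intro z s t h
    simp only [zero_mul, add_zero, Prod.mk.injEq] at h
    obtain ⟨h1, h2⟩ := h
    by_contra hn
    rcases hKu s t h1 with h3 | ⟨p, hp, m, n, rfl, rfl⟩
    · exact hn (Or.inl h3)
    have hn' : ¬ Tri s0 t0 p.1 p.2 := by
      rintro (⟨k, hk⟩ | ⟨k, l, hk, hl⟩ | ⟨k, l, hk, hl⟩)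
      · exact hn (Or.inl ⟨k + m - n, by push_cast; linarith⟩)
      · exact hn (Or.inr (Or.inl ⟨k + m, l + n, by push_cast; linarith, by push_cast; linarith⟩))
      · exact hn (Or.inr (Or.inr ⟨k + m, l + n, by push_cast; linarith, by push_cast; linarith⟩))
    simp only [hXp.add_int, (sfF.per (z, 0)).add_int, hup.add_int] at h1 h2
    let j : J := ⟨p, hp, h1, hn'⟩
    refine lin_ne (hXJ j) (b := ζ * (Fig s0 t0 p.1 - Fig s0 t0 p.2)) ?_ z ?_
    · rw [mul_assoc]; exact hζ j
    · have h5 := sub_eq_zero.2 h2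
      rw [← h5]
      simp only [j, Complex.real_smul]
      ring
  · intro z
    refine loc_of_linear (s0 := s0) (t0 := t0) sf (v := fun _ => u) (SF.const hu hup) (fun _ => hu0) hdt ?_ ?_
    · intro z η s t h
      exact congrArg Prod.fst h
    · intro z η h
      have h2 := congrArg Prod.snd h
      simp only [hX0, Fig_dbl s0 t0, add_right_inj] at h2
      by_contra hη
      exact hχ0 (Complex.ofReal_injective (mul_left_cancel₀ hη h2))

/-- second deformation -/
theorem M2 (hu : ContDiff ℝ (⊤ : ℕ∞) u) (hup : Loop1 u)
    (hχ : ContDiff ℝ (⊤ : ℕ∞) χ) (hχp : Loop1 χ)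
    (hu0 : u s0 = u t0) (hχ0 : χ s0 ≠ χ t0) {ζ : ℂ} (hζ : ζ ≠ 0) (S : ℂ ≃L[ℝ] ℂ)
    (hS : S (deriv u s0) = ζ * deriv (Fig s0 t0) s0) (hS' : S (deriv u t0) = ζ * deriv (Fig s0 t0) t0) :
    ∃ ε > 0, ∀ (τ : I) (η : ℂ), η ≠ 0 → ‖η‖ < ε → IsLoopEmb (fun t =>
      (u t - (τ : ℝ) • (S.symm η * (χ t : ℂ)),
        ζ * Fig s0 t0 t + (1 - (τ : ℝ)) • (η * (χ t : ℂ)))) := by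
  have hn := nonint_of_ne hχp hχ0
  have sfχ : SF (fun (_ : I × ℂ) t => (χ t : ℂ)) := (SF.const hχ hχp).clm Complex.ofRealCLM
  have sfF := Fig_SF s0 t0 (Z := I × ℂ)
  have sf : SF (fun (z : I × ℂ) (t : ℝ) =>
      (u t - (z.1 : ℝ) • (S.symm z.2 * (χ t : ℂ)),
        ζ * Fig s0 t0 t + (1 - (z.1 : ℝ)) • (z.2 * (χ t : ℂ)))) :=
    ((SF.const hu hup).sub ((SF.param (by fun_prop)).smul ((SF.param (by fun_prop)).mul sfχ))).prodMk
    (((SF.param continuous_const).mul sfF).add ((SF.param (by fun_prop)).smul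
      ((SF.param (by fun_prop)).mul sfχ)))
  have hFd : ∀ t, HasDerivAt (fun t => ζ * Fig s0 t0 t) (ζ * deriv (Fig s0 t0) t) t := fun t =>
    (sfF.diff (0, 0) t).hasDerivAt.const_mul ζ
  refine emb_family (s0 := s0) (t0 := t0) sf ?_ ?_ ?_
  · intro z t h0
    have := ((ContinuousLinearMap.snd ℝ ℂ ℂ).hasFDerivAt.comp_hasDerivAt t
      (sf.diff (z, 0) t).hasDerivAt).deriv
    rw [h0] at this
    have e : (⇑(ContinuousLinearMap.snd ℝ ℂ ℂ) ∘ fun t =>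
      (u t - (z : ℝ) • (S.symm 0 * (χ t : ℂ)),
        ζ * Fig s0 t0 t + (1 - (z : ℝ)) • (0 * (χ t : ℂ)))) = fun t => ζ * Fig s0 t0 t := by
      funext t; simp
    have h5 := (congrArg (fun f => deriv f t) e.symm).trans (this.trans (map_zero _))
    simp only [(hFd t).deriv] at h5
    exact mul_ne_zero hζ (Fig_imm hn t) h5
  · intro z s t h
    have h2 := congrArg Prod.snd h
    simp only [zero_mul, smul_zero, add_zero] at h2
    exact Fig_eq (mul_left_cancel₀ hζ h2)
  · intro z
    have sfv : SF (fun (τ : I) t => (1 - (τ : ℝ)) • S (u t) + (τ : ℝ) • (ζ * Fig s0 t0 t)) :=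
      ((SF.param (by fun_prop)).smul ((SF.const hu hup).clm (S : ℂ →L[ℝ] ℂ))).add
      ((SF.param (by fun_prop)).smul ((SF.param continuous_const).mul (Fig_SF s0 t0)))
    have hud : ∀ t, HasDerivAt u (deriv u t) t := fun t =>
      ((hu.differentiable (by simp)) t).hasDerivAt
    have hvd : ∀ (τ : ℝ) t, S (deriv u t) = ζ * deriv (Fig s0 t0) t →
        deriv (fun t => (1 - τ) • S (u t) + τ • (ζ * Fig s0 t0 t)) t = ζ * deriv (Fig s0 t0) t := by
      intro τ t ht
      have h1 := ((S : ℂ →L[ℝ] ℂ).hasFDerivAt.comp_hasDerivAt t (hud t)).const_smul (1 - τ)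
      have h2 := h1.add ((hFd t).const_smul τ)
      refine h2.deriv.trans ?_
      simp only [ContinuousLinearEquiv.coe_coe, ht]
      rw [← add_smul]; simp
    refine loc_of_linear (s0 := s0) (t0 := t0) sf (v := fun (τ : I) t => (1 - (τ : ℝ)) • S (u t) + (τ : ℝ) • (ζ * Fig s0 t0 t))
      sfv (fun τ => by simp only [hu0, Fig_dbl s0 t0]) ?_ ?_ ?_
    · rw [hvd z s0 hS, hvd z t0 hS', dt_mul]
      exact mul_ne_zero (by simpa using hζ) (Fig_dt hn)
    · intro τ η s t h
      have h1 := congrArg (fun p => (1 - (τ : ℝ)) • S (Prod.fst p) + (τ : ℝ) • Prod.snd p) h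
      have e : ∀ x : ℝ, (1 - (τ : ℝ)) • S (u x - (τ : ℝ) • (S.symm η * (χ x : ℂ))) + (τ : ℝ) •
          (ζ * Fig s0 t0 x + (1 - (τ : ℝ)) • (η * (χ x : ℂ))) =
          (1 - (τ : ℝ)) • S (u x) + (τ : ℝ) • (ζ * Fig s0 t0 x) := by
        intro x
        have : S (S.symm η * (χ x : ℂ)) = χ x • η := by
          rw [mul_comm, ← Complex.real_smul, map_smul, S.apply_symm_apply]
        rw [map_sub, map_smul, this]
        simp only [Complex.real_smul]
        push_cast
        ring
      simpa only [e] using h1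
    · intro τ η h
      have h1 := congrArg Prod.fst h
      have h2 := congrArg Prod.snd h
      simp only [hu0, Fig_dbl s0 t0, sub_right_inj, add_right_inj] at h1 h2
      by_contra hη
      have hne : ∀ c : ℂ, c ≠ 0 → ∀ r : ℝ, r • (c * (χ s0 : ℂ)) = r • (c * (χ t0 : ℂ)) → r = 0 := by
        intro c hc r hr
        by_contra hr0
        exact hχ0 (Complex.ofReal_injective (mul_left_cancel₀ hc (smul_right_injective ℂ hr0 hr)))
      have h3 := hne _ (by simpa using hη) _ h1
      have h4 := hne _ hη _ h2
      rw [h3] at h4; norm_num at h4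

/-- third deformation -/
theorem M3 (hu : ContDiff ℝ (⊤ : ℕ∞) u) (hup : Loop1 u)
    (hχ : ContDiff ℝ (⊤ : ℕ∞) χ) (hχp : Loop1 χ)
    (hu0 : u s0 = u t0) (hχ0 : χ s0 ≠ χ t0) {ζ : ℂ} (hζ : ζ ≠ 0) (S : ℂ ≃L[ℝ] ℂ) :
    ∃ ε > 0, ∀ (τ : I) (η : ℂ), η ≠ 0 → ‖η‖ < ε → IsLoopEmb (fun t =>
      ((1 - (τ : ℝ)) • u t - (S.symm η * (χ t : ℂ)), ζ * Fig s0 t0 t)) := by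
  have hn := nonint_of_ne hχp hχ0
  have sfχ : SF (fun (_ : I × ℂ) t => (χ t : ℂ)) := (SF.const hχ hχp).clm Complex.ofRealCLM
  have sfF := Fig_SF s0 t0 (Z := I × ℂ)
  have sf : SF (fun (z : I × ℂ) (t : ℝ) =>
      ((1 - (z.1 : ℝ)) • u t - (S.symm z.2 * (χ t : ℂ)), ζ * Fig s0 t0 t)) :=
    (((SF.param (by fun_prop)).smul (SF.const hu hup)).sub
      ((SF.param (by fun_prop)).mul sfχ)).prodMk ((SF.param continuous_const).mul sfF)
  have hFd : ∀ t, deriv (fun t => ζ * Fig s0 t0 t) t = (ζ * deriv (Fig s0 t0) t) := fun t =>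
    ((sfF.diff (0, 0) t).hasDerivAt.const_mul ζ).deriv
  refine emb_family (s0 := s0) (t0 := t0) sf ?_ ?_ ?_
  · intro z t h0
    have := ((ContinuousLinearMap.snd ℝ ℂ ℂ).hasFDerivAt.comp_hasDerivAt t
      (sf.diff (z, 0) t).hasDerivAt).deriv
    rw [h0, map_zero] at this
    exact mul_ne_zero hζ (Fig_imm hn t) ((hFd t).symm.trans this)
  · intro z s t h
    have h2 := congrArg Prod.snd h
    exact Fig_eq (mul_left_cancel₀ hζ h2)
  · intro z
    refine loc_of_linear (s0 := s0) (t0 := t0) sf (v := fun (_ : I) t => ζ * Fig s0 t0 t)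
      ((SF.param continuous_const).mul (Fig_SF s0 t0)) (fun τ => by simp only [Fig_dbl s0 t0]) ?_ ?_ ?_
    · rw [hFd, hFd, dt_mul]
      exact mul_ne_zero (by simpa using hζ) (Fig_dt hn)
    · intro τ η s t h
      exact congrArg Prod.snd h
    · intro τ η h
      have h1 := congrArg Prod.fst h
      simp only [hu0, sub_right_inj] at h1
      by_contra hη
      exact hχ0 (Complex.ofReal_injective (mul_left_cancel₀ (by simpa using hη) h1))

end M
end

noncomputable section
open unitInterval

/-- small punctured disc -/
abbrev PD (ε : ℝ) : Type := {η : ℂ // η ≠ 0 ∧ ‖η‖ < ε}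

theorem lemmaM {u X : ℝ → ℂ} {χ : ℝ → ℝ} {s0 t0 : ℝ}
    (hu : ContDiff ℝ (⊤ : ℕ∞) u) (hup : Loop1 u) (hX : ContDiff ℝ (⊤ : ℕ∞) X)
    (hXp : Loop1 X) (hχ : ContDiff ℝ (⊤ : ℕ∞) χ) (hχp : Loop1 χ)
    (hu0 : u s0 = u t0) (hX0 : X s0 = X t0) (hχ0 : χ s0 ≠ χ t0)
    (himm : ∀ t, deriv u t ≠ 0) (hdt : dt (deriv u s0) (deriv u t0) ≠ 0)
    (hsep : ∀ s t, u s = u t → X s = X t → Tri s0 t0 s t)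
    (K : Set (ℝ × ℝ)) (hK : K.Finite)
    (hKu : ∀ s t, u s = u t → (∃ n : ℤ, s = t + n) ∨ ∃ p ∈ K, ∃ m n : ℤ, s = p.1 + m ∧ t = p.2 + n) :
    ∃ ε > 0, ∃ G : C(PD ε, EmbS1 (ℂ × ℂ)), (∀ η t, crv (G η) t = (u t, X t + η.1 * (χ t : ℂ))) ∧
      G.Nullhomotopic := by
  have hn := nonint_of_ne hχp hχ0
  obtain ⟨ζ, hζ, ε1, hε1, h1⟩ := M1 hu hup hX hXp hχ hχp hu0 hX0 hχ0 himm hdt hsep K hK hKu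
  obtain ⟨S, hS, hS'⟩ := dt_equiv hdt (c := ζ * deriv (Fig s0 t0) s0) (d := ζ * deriv (Fig s0 t0) t0)
    (by rw [dt_mul]; exact mul_ne_zero (by simpa using hζ) (Fig_dt hn))
  obtain ⟨ε2, hε2, h2⟩ := M2 hu hup hχ hχp hu0 hχ0 hζ S hS hS'
  obtain ⟨ε3, hε3, h3⟩ := M3 hu hup hχ hχp hu0 hχ0 hζ S
  let ε := min ε1 (min ε2 ε3)
  have l1 : ∀ η : PD ε, ‖η.1‖ < ε1 := fun η => lt_of_lt_of_le η.2.2 (min_le_left _ _)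
  have l2 : ∀ η : PD ε, ‖η.1‖ < ε2 := fun η =>
    lt_of_lt_of_le η.2.2 ((min_le_right _ _).trans (min_le_left _ _))
  have l3 : ∀ η : PD ε, ‖η.1‖ < ε3 := fun η =>
    lt_of_lt_of_le η.2.2 ((min_le_right _ _).trans (min_le_right _ _))
  have sfχ : SF (fun (_ : I × PD ε) t => (χ t : ℂ)) := (SF.const hχ hχp).clm Complex.ofRealCLM
  have sfF := Fig_SF s0 t0 (Z := I × PD ε)
  -- the families
  let F1 : I × PD ε → ℝ → ℂ × ℂ := fun z t =>
    (u t, (1 - (z.1 : ℝ)) • X t + (z.1 : ℝ) • (ζ * Fig s0 t0 t) + z.2.1 * (χ t : ℂ))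
  have sf1 : SF F1 :=
    (SF.const hu hup).prodMk ((((SF.param (by fun_prop)).smul (SF.const hX hXp)).add
      ((SF.param (by fun_prop)).smul ((SF.param continuous_const).mul sfF))).add
      ((SF.param (by fun_prop)).mul sfχ))
  have e1 : ∀ z, IsLoopEmb (F1 z) := fun z => h1 z.1 z.2.1 z.2.2.1 (l1 z.2)
  let F2 : I × PD ε → ℝ → ℂ × ℂ := fun z t => (u t - (z.1 : ℝ) • (S.symm z.2.1 * (χ t : ℂ)),
        ζ * Fig s0 t0 t + (1 - (z.1 : ℝ)) • (z.2.1 * (χ t : ℂ)))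
  have sf2 : SF F2 :=
    ((SF.const hu hup).sub ((SF.param (by fun_prop)).smul ((SF.param (by fun_prop)).mul sfχ))).prodMk
    (((SF.param continuous_const).mul sfF).add ((SF.param (by fun_prop)).smul
      ((SF.param (by fun_prop)).mul sfχ)))
  have e2 : ∀ z, IsLoopEmb (F2 z) := fun z => h2 z.1 z.2.1 z.2.2.1 (l2 z.2)
  let F3 : I × PD ε → ℝ → ℂ × ℂ := fun z t =>
    ((1 - (z.1 : ℝ)) • u t - (S.symm z.2.1 * (χ t : ℂ)), ζ * Fig s0 t0 t)
  have sf3 : SF F3 :=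
    (((SF.param (by fun_prop)).smul (SF.const hu hup)).sub
      ((SF.param (by fun_prop)).mul sfχ)).prodMk ((SF.param continuous_const).mul sfF)
  have e3 : ∀ z, IsLoopEmb (F3 z) := fun z => h3 z.1 z.2.1 z.2.2.1 (l3 z.2)
  -- the last homotopy
  have pc := pathConnected_CC
  have sfF1 := Fig_SF s0 t0 (Z := Unit)
  have sfχ1 : SF (fun (_ : Unit) t => (χ t : ℂ)) := (SF.const hχ hχp).clm Complex.ofRealCLM
  have sfa : SF (fun (_ : Unit) t => ((χ t : ℂ), ζ * Fig s0 t0 t)) :=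
    sfχ1.prodMk ((SF.param continuous_const).mul sfF1)
  have ea : IsLoopEmb (fun t => ((χ t : ℂ), ζ * Fig s0 t0 t)) := by
    refine ⟨sfa.smooth (), sfa.per (), ?_, ?_⟩
    · intro t h0
      have := ((ContinuousLinearMap.snd ℝ ℂ ℂ).hasFDerivAt.comp_hasDerivAt t
        (sfa.diff () t).hasDerivAt).deriv
      rw [h0, map_zero] at this
      have h5 : deriv (fun t => ζ * Fig s0 t0 t) t = (ζ * deriv (Fig s0 t0) t) :=
        ((sfF1.diff () t).hasDerivAt.const_mul ζ).deriv
      exact mul_ne_zero hζ (Fig_imm hn t) (h5.symm.trans this)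
    · intro s t h
      have i1 : χ s = χ t := Complex.ofReal_injective (congrArg Prod.fst h)
      have i2 := Fig_eq (mul_left_cancel₀ hζ (congrArg Prod.snd h))
      rcases i2 with h | ⟨m, n, rfl, rfl⟩ | ⟨m, n, rfl, rfl⟩
      · exact h
      · rw [hχp.add_int, hχp.add_int] at i1; exact absurd i1 hχ0
      · rw [hχp.add_int, hχp.add_int] at i1; exact absurd i1.symm hχ0
  have eb : ∃ b : EmbS1 (ℂ × ℂ), ∀ t, (crv b t).1 = 0 := by
    have sfb : SF (fun (_ : Unit) t => ((0 : ℂ), (cs t : ℂ) + (sn t : ℂ) * Complex.I)) :=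
      (SF.param continuous_const).prodMk (((SF.const cs_smooth cs_per).clm Complex.ofRealCLM).add
        (((SF.const sn_smooth sn_per).clm Complex.ofRealCLM).mul (SF.param continuous_const)))
    refine ⟨mkE (fun t => ((0 : ℂ), (cs t : ℂ) + (sn t : ℂ) * Complex.I))
      ⟨sfb.smooth (), sfb.per (), ?_, ?_⟩, fun t => rfl⟩
    · intro t h0
      have h4 := ((ContinuousLinearMap.snd ℝ ℂ ℂ).hasFDerivAt.comp_hasDerivAt t
        (sfb.diff () t).hasDerivAt).deriv
      rw [h0, map_zero] at h4
      have h5 : HasDerivAt (fun t => (cs t : ℂ) + (sn t : ℂ) * Complex.I)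
          (((-(2 * π) * sn t : ℝ) : ℂ) + ((2 * π * cs t : ℝ) : ℂ) * Complex.I) t :=
        (cs_deriv t).ofReal_comp.add ((sn_deriv t).ofReal_comp.mul_const _)
      have h6 := h5.deriv.symm.trans h4
      have hp := Real.pi_pos
      have h7 := congrArg Complex.re h6
      have h8 := congrArg Complex.im h6
      simp [-Complex.ofReal_mul, hp.ne'] at h7 h8
      exact cs_ne h7 h8
    · intro s t h
      have h6 := congrArg Prod.snd h
      have h7 := congrArg Complex.re h6
      have h8 := congrArg Complex.im h6
      simp at h7 h8
      rcases cs_eq_cs h7 with h9 | ⟨n, rfl⟩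
      · exact h9
      · rw [sn_per.add_int, sn_neg] at h8
        obtain ⟨k, hk⟩ := sn_eq_zero.1 (show sn t = 0 by linarith)
        exact ⟨n - k, by push_cast; linarith⟩
  obtain ⟨b, hb⟩ := eb
  let k : Path (mkE _ ea) b := PathConnectedSpace.somePath _ _
  let F4 : I × PD ε → ℝ → ℂ × ℂ := fun z t =>
    (-(S.symm z.2.1) * (crv (k z.1) t).1, (crv (k z.1) t).2)
  have sfk : SF (fun (z : I × PD ε) => crv (k z.1)) := SF.emb.comp (by fun_prop)
  have sf4 : SF F4 := ((SF.param (by fun_prop)).mul sfk.fst).prodMk sfk.snd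
  have e4 : ∀ z, IsLoopEmb (F4 z) := fun z => by
    refine (crv_emb (k z.1)).clm (((ContinuousLinearMap.mul ℝ ℂ (-(S.symm z.2.1))).prodMap
      (ContinuousLinearMap.id ℝ ℂ))) ?_
    intro p q hpq
    have hne : -(S.symm z.2.1) ≠ 0 := by simpa using z.2.2.1
    have q1 := congrArg Prod.fst hpq
    have q2 := congrArg Prod.snd hpq
    exact Prod.ext (mul_left_cancel₀ hne q1) q2
  have slice : ∀ {F : I × PD ε → ℝ → ℂ × ℂ} (hF : SF F) (he : ∀ z, IsLoopEmb (F z)) (i : I),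
      ∃ G : C(PD ε, EmbS1 (ℂ × ℂ)), ∀ y t, crv (G y) t = F (i, y) t := fun {F} hF he i =>
    ⟨⟨fun y => mkE (F (i, y)) (he _), (hF.lift he).comp (by fun_prop)⟩, fun y t => rfl⟩
  obtain ⟨G0, hG0⟩ := slice sf1 e1 0
  obtain ⟨G1, hG1⟩ := slice sf1 e1 1
  obtain ⟨G2, hG2⟩ := slice sf2 e2 1
  obtain ⟨G3, hG3⟩ := slice sf3 e3 1
  refine ⟨ε, by positivity, G0, fun η t => by rw [hG0]; simp [F1], b, ?_⟩
  refine (homotopic_of_SF sf1 e1 hG0 hG1).trans ?_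
  refine (homotopic_of_SF sf2 e2 (G1 := G2) (fun y t => by rw [hG1]; simp [F1, F2]) hG2).trans ?_
  refine (homotopic_of_SF sf3 e3 (G1 := G3) (fun y t => by rw [hG2]; simp [F2, F3]) hG3).trans ?_
  refine homotopic_of_SF sf4 e4 (fun y t => by rw [hG3]; simp [F3, F4]) (fun y t => ?_)
  have : k 1 = b := k.target
  simp only [ContinuousMap.const_apply, F4, this, hb, mul_zero]
  exact Prod.ext (hb t) rfl
end

noncomputable section
open unitInterval
/-! ### Part 11: triangles of embeddings -/

theorem triangle_null {X Y : Type*} [TopologicalSpace X] [TopologicalSpace Y]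
    (G : C(Y, X)) (hG : G.Nullhomotopic) {y1 y2 y3 : Y}
    (p : Path y1 y2) (q : Path y2 y3) (r : Path y1 y3)
    {x1 x2 x3 : X} (p' : Path x1 x2) (q' : Path x2 x3) (r' : Path x1 x3)
    (hp : ∀ θ, p' θ = G (p θ)) (hq : ∀ θ, q' θ = G (q θ)) (hr : ∀ θ, r' θ = G (r θ)) :
    (Path.Homotopic.Quotient.mk p').trans (Path.Homotopic.Quotient.mk q') =
    Path.Homotopic.Quotient.mk r' := by
  obtain rfl : x1 = G y1 := by simpa using hp 0
  obtain rfl : x2 = G y2 := by simpa using hp 1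
  obtain rfl : x3 = G y3 := by simpa using hq 1
  have e1 : p' = p.map G.continuous := by ext θ; simp [hp]
  have e2 : q' = q.map G.continuous := by ext θ; simp [hq]
  have e3 : r' = r.map G.continuous := by ext θ; simp [hr]
  rw [e1, e2, e3, ← Path.Homotopic.Quotient.mk_trans, ← Path.map_trans]
  exact Path.Homotopic.Quotient.eq.2 (homotopic_of_nullhomotopic G hG _ _)

/-- segments in a subset of the plane -/
def segY {Y : Set ℂ} (v w : ℂ) (h : ∀ θ : I, v + (θ : ℝ) • (w - v) ∈ Y) :
    Path (⟨v, by simpa using h 0⟩ : Y) ⟨w, by simpa using h 1⟩ where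
  toFun θ := ⟨v + (θ : ℝ) • (w - v), h θ⟩
  continuous_toFun := by fun_prop
  source' := by simp
  target' := by simp

/-- the linear family of curves -/
def Hfam (f : ℝ → E4) (a b : W3) (η : ℂ) : ℝ → E4 := fun t =>
  f t + (cs t - (f t).1) • ((η.re, η.re • a + η.im • b) : E4)

theorem segE_eq_Hfam (f : ℝ → E4) (a b : W3) (ρ r : ℝ) :
    segE f (a + ρ • b) r = Hfam f a b ⟨r, r * ρ⟩ := by
  funext t
  simp only [segE, Hfam, mul_comm r, mul_smul]
  congr 2
  refine Prod.ext (by simp) ?_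
  simp [smul_comm r ρ]

theorem SF.Hfam {Z : Type*} [TopologicalSpace Z] {f : Z → ℝ → E4} (hf : SF f) (a b : W3)
    {η : Z → ℂ} (hη : Continuous η) : SF (fun z => Hfam (f z) a b (η z)) :=
  hf.add (((SF.const cs_smooth cs_per).sub hf.fst).smul (SF.param (by fun_prop)))

theorem Hfam_fst (f : ℝ → E4) (a b : W3) {η : ℂ} (h : η.re = 1) (t : ℝ) :
    (Hfam f a b η t).1 = cs t := by
  simp [Hfam, h]

theorem cls_of_null {f : EmbS1 E4} {a b : W3} {ρ1 ρ2 : ℝ} {Y : Set ℂ} (G : C(Y, EmbS1 E4))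
    (hG : ∀ y, crv (G y) = Hfam (crv f) a b y) (hnull : G.Nullhomotopic)
    (h1 : ∀ r : I, (⟨r, r * ρ1⟩ : ℂ) ∈ Y) (h2 : ∀ r : I, (⟨r, r * ρ2⟩ : ℂ) ∈ Y)
    (h12 : ∀ θ : I, (⟨1, ρ1 + θ * (ρ2 - ρ1)⟩ : ℂ) ∈ Y)
    {c1 : Path.Homotopic.Quotient f b0.1} (hc1 : c1 ∈ ClsE f (a + ρ1 • b))
    {c2 : Path.Homotopic.Quotient f b0.1} (hc2 : c2 ∈ ClsE f (a + ρ2 • b)) : c1 = c2 := by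
  have := simplyConnected_BB
  obtain ⟨b1, α1, hα1, k1, rfl⟩ := hc1
  obtain ⟨b2, α2, hα2, k2, rfl⟩ := hc2
  have e1 : ∀ (ρ : ℝ) (θ : I), (0 : ℂ) + (θ : ℝ) • ((⟨1, ρ⟩ : ℂ) - 0) = ⟨θ, θ * ρ⟩ := by
    intro ρ θ; apply Complex.ext <;> simp
  have e2 : ∀ θ : I, (⟨1, ρ1⟩ : ℂ) + (θ : ℝ) • ((⟨1, ρ2⟩ : ℂ) - ⟨1, ρ1⟩) =
      ⟨1, ρ1 + θ * (ρ2 - ρ1)⟩ := by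
    intro θ; apply Complex.ext <;> simp
  let p1 := segY (Y := Y) 0 ⟨1, ρ1⟩ (fun θ => by rw [e1]; exact h1 θ)
  let p2 := segY (Y := Y) 0 ⟨1, ρ2⟩ (fun θ => by rw [e1]; exact h2 θ)
  let p12 := segY (Y := Y) ⟨1, ρ1⟩ ⟨1, ρ2⟩ (fun θ => by rw [e2]; exact h12 θ)
  have v1 : ∀ θ, ((p1 θ : Y) : ℂ) = ⟨θ, θ * ρ1⟩ := fun θ => e1 ρ1 θ
  have v2 : ∀ θ, ((p2 θ : Y) : ℂ) = ⟨θ, θ * ρ2⟩ := fun θ => e1 ρ2 θ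
  have v12 : ∀ θ, ((p12 θ : Y) : ℂ) = ⟨1, ρ1 + θ * (ρ2 - ρ1)⟩ := fun θ => e2 θ
  have w1 : ∀ θ, α1 θ = G (p1 θ) := fun θ => EmbS1.ext' fun t => by
    rw [hα1, hG, v1, segE_eq_Hfam]
  have w2 : ∀ θ, α2 θ = G (p2 θ) := fun θ => EmbS1.ext' fun t => by
    rw [hα2, hG, v2, segE_eq_Hfam]
  let κ : Path b1 b2 :=
    { toFun := fun θ => ⟨G (p12 θ), fun t => by rw [hG, Hfam_fst]; rw [v12]⟩
      continuous_toFun := by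
        refine Continuous.subtype_mk ?_ _
        exact G.continuous.comp p12.continuous
      source' := Subtype.ext (by
        have := w1 1
        rw [α1.target, p1.target] at this
        rw [this]; simp)
      target' := Subtype.ext (by
        have := w2 1
        rw [α2.target, p2.target] at this
        rw [this]; simp) }
  have t1 := triangle_null G hnull p1 p12 p2 α1 (κ.map continuous_subtype_val) α2 w1 (fun θ => rfl) w2
  have t2 : Path.Homotopic.Quotient.mk (k1.map continuous_subtype_val) =
      (Path.Homotopic.Quotient.mk (κ.map continuous_subtype_val)).trans
        (Path.Homotopic.Quotient.mk (k2.map continuous_subtype_val)) := by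
    rw [← Path.Homotopic.Quotient.mk_trans, ← Path.map_trans]
    exact Path.Homotopic.Quotient.eq.2
      ((SimplyConnectedSpace.paths_homotopic k1 (κ.trans k2)).map ⟨_, continuous_subtype_val⟩)
  rw [t2, ← Path.Homotopic.Quotient.trans_assoc, t1]

/-- convex families are nullhomotopic -/
theorem null_convex {E : Type*} [NormedAddCommGroup E] [NormedSpace ℝ E] {T : Set ℂ}
    (hT : Convex ℝ T) (hne : T.Nonempty) (G : C(T, EmbS1 E)) : G.Nullhomotopic := by
  have := hT.contractibleSpace hne
  exact (id_nullhomotopic T).comp_right G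

/-- shrinking a convex set minus a point towards this point -/
theorem null_punctured {E : Type*} [NormedAddCommGroup E] [NormedSpace ℝ E] {T : Set ℂ}
    (hT : Convex ℝ T) (hb : Bornology.IsBounded T) {η0 : ℂ} (h0 : η0 ∈ T)
    (G : C((T \ {η0} : Set ℂ), EmbS1 E)) {ε : ℝ} (hε : 0 < ε) (G' : C(PD ε, EmbS1 E))
    (hG' : G'.Nullhomotopic) (hGG : ∀ (y : (T \ {η0} : Set ℂ)) (η : PD ε), y.1 = η0 + η.1 →
      G y = G' η) : G.Nullhomotopic := by
  obtain ⟨R, hR⟩ := hb.subset_closedBall η0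
  let δ : ℝ := min 1 (ε / (2 * (|R| + 1)))
  have hδ : 0 < δ := by positivity
  have hδ1 : δ ≤ 1 := min_le_left _ _
  have hδR : δ * |R| < ε := by
    have h1 : δ ≤ ε / (2 * (|R| + 1)) := min_le_right _ _
    have h2 : ε / (2 * (|R| + 1)) * |R| ≤ ε / (2 * (|R| + 1)) * (|R| + 1) := by gcongr; linarith
    have h3 : ε / (2 * (|R| + 1)) * (|R| + 1) = ε / 2 := by field_simp
    have h4 : δ * |R| ≤ ε / (2 * (|R| + 1)) * |R| := by gcongr
    linarith
  let lam : I → ℝ := fun τ => 1 - τ * (1 - δ)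
  have hl0 : ∀ τ, 0 < lam τ := fun τ => by
    have := τ.2.2; have := τ.2.1; simp only [lam]; nlinarith
  have hl1 : ∀ τ, lam τ ≤ 1 := fun τ => by
    have := τ.2.2; have := τ.2.1; simp only [lam]; nlinarith
  let Sh : I × (T \ {η0} : Set ℂ) → (T \ {η0} : Set ℂ) := fun z =>
    ⟨η0 + lam z.1 • (z.2.1 - η0), by
      refine ⟨?_, ?_⟩
      · exact hT.add_smul_sub_mem h0 z.2.2.1 ⟨(hl0 z.1).le, hl1 z.1⟩
      · simp only [Set.mem_singleton_iff, add_eq_left, smul_eq_zero, not_or]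
        exact ⟨(hl0 z.1).ne', sub_ne_zero.2 z.2.2.2⟩⟩
  have hSh : Continuous Sh := by
    refine Continuous.subtype_mk ?_ _
    simp only [lam]
    fun_prop
  let q : C((T \ {η0} : Set ℂ), PD ε) := ⟨fun y => ⟨δ • (y.1 - η0), by
      refine ⟨smul_ne_zero hδ.ne' (sub_ne_zero.2 y.2.2), ?_⟩
      rw [norm_smul, Real.norm_of_nonneg hδ.le]
      have := hR y.2.1
      rw [Metric.mem_closedBall, dist_eq_norm] at this
      exact lt_of_le_of_lt (by gcongr; exact this.trans (le_abs_self R)) hδR⟩, by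
      refine Continuous.subtype_mk ?_ _; fun_prop⟩
  obtain ⟨y, hy⟩ := hG'.comp_left q
  refine ⟨y, ContinuousMap.Homotopic.trans ?_ hy⟩
  refine ⟨{ toFun := fun z => G (Sh z), continuous_toFun := G.continuous.comp hSh,
            map_zero_left := fun x => ?_, map_one_left := fun x => ?_ }⟩
  · congr 1; apply Subtype.ext; simp [Sh, lam]
  · refine hGG _ _ ?_
    simp [Sh, lam, q]
end

noncomputable section
open unitInterval
/-! ### Part 12: pencils of directions -/

/-- nontrivial double points -/
def Dbl (u : ℝ → ℂ) (s t : ℝ) : Prop := u s = u t ∧ ¬ ∃ n : ℤ, s = t + n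

theorem emb_of_sep {u Y : ℝ → ℂ} (hu : ContDiff ℝ (⊤ : ℕ∞) u) (hup : Loop1 u)
    (hY : ContDiff ℝ (⊤ : ℕ∞) Y) (hYp : Loop1 Y) (himm : ∀ t, deriv u t ≠ 0)
    (h : ∀ s t, Dbl u s t → Y s ≠ Y t) : IsLoopEmb (fun t => (u t, Y t)) := by
  have sf : SF (fun (_ : Unit) t => (u t, Y t)) := (SF.const hu hup).prodMk (SF.const hY hYp)
  refine ⟨sf.smooth (), sf.per (), ?_, ?_⟩
  · intro t h0
    have := ((ContinuousLinearMap.fst ℝ ℂ ℂ).hasFDerivAt.comp_hasDerivAt t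
      (sf.diff () t).hasDerivAt).deriv
    rw [h0, map_zero] at this
    exact himm t this
  · intro s t hst
    by_contra hn
    exact h s t ⟨congrArg Prod.fst hst, hn⟩ (congrArg Prod.snd hst)

/-- The generic data for a pencil of directions. -/
structure Pencil (u X : ℝ → ℂ) (χ : ℝ → ℝ) (K : Set (ℝ × ℝ)) : Prop where
  hu : ContDiff ℝ (⊤ : ℕ∞) u
  hup : Loop1 u
  hX : ContDiff ℝ (⊤ : ℕ∞) X
  hXp : Loop1 X
  hχ : ContDiff ℝ (⊤ : ℕ∞) χ
  hχp : Loop1 χ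
  himm : ∀ t, deriv u t ≠ 0
  hK : K.Finite
  hKu : ∀ s t, u s = u t → (∃ n : ℤ, s = t + n) ∨ ∃ p ∈ K, ∃ m n : ℤ, s = p.1 + m ∧ t = p.2 + n
  hdt : ∀ s t, Dbl u s t → dt (deriv u s) (deriv u t) ≠ 0
  hcs : ∀ s t, Dbl u s t → (X s).re + χ s ≠ (X t).re + χ t
  hsep : ∀ s t, Dbl u s t → X s ≠ X t
  hslope : ∀ s t s' t', Dbl u s t → Dbl u s' t' → (X s).re ≠ (X t).re → (X s').re ≠ (X t').re →
    ((X s).im - (X t).im) * ((X s').re - (X t').re) =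
      ((X s').im - (X t').im) * ((X s).re - (X t).re) → Tri s' t' s t

namespace Pencil
variable {u X : ℝ → ℂ} {χ : ℝ → ℝ} {K : Set (ℝ × ℝ)}

theorem dbl_K (P : Pencil u X χ K) {s t : ℝ} (h : Dbl u s t) : ∃ p ∈ K, Dbl u p.1 p.2 ∧ u s = u p.1 ∧ u t = u p.2 ∧
    X s = X p.1 ∧ X t = X p.2 := by
  rcases P.hKu s t h.1 with h1 | ⟨p, hp, m, n, rfl, rfl⟩
  · exact absurd h1 h.2
  · refine ⟨p, hp, ⟨?_, ?_⟩, P.hup.add_int _ _, P.hup.add_int _ _, P.hXp.add_int _ _,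
      P.hXp.add_int _ _⟩
    · have := h.1; rwa [P.hup.add_int, P.hup.add_int] at this
    · rintro ⟨k, hk⟩
      exact h.2 ⟨k + m - n, by push_cast; linarith⟩

theorem emb (P : Pencil u X χ K) {η : ℂ} (h : ∀ s t, Dbl u s t → X s + η * (χ s : ℂ) ≠ X t + η * (χ t : ℂ)) :
    IsLoopEmb (fun t => (u t, X t + η * (χ t : ℂ))) := by
  have sf : SF (fun (_ : Unit) t => X t + η * (χ t : ℂ)) := (SF.const P.hX P.hXp).add
    ((SF.param continuous_const).mul ((SF.const P.hχ P.hχp).clm Complex.ofRealCLM))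
  exact emb_of_sep P.hu P.hup (sf.smooth ()) (sf.per ()) P.himm h

/-- what happens at bad parameters -/
theorem bad (P : Pencil u X χ K) {r ρ s t : ℝ} (h : Dbl u s t)
    (he : X s + (⟨r, r * ρ⟩ : ℂ) * (χ s : ℂ) = X t + (⟨r, r * ρ⟩ : ℂ) * (χ t : ℂ)) :
    (X s).re ≠ (X t).re ∧ (X s).im - (X t).im = ρ * ((X s).re - (X t).re) ∧
    χ s ≠ χ t ∧ r ≠ 1 := by
  have hre := congrArg Complex.re he
  have him := congrArg Complex.im he
  simp at hre him
  have h1 : (X s).im - (X t).im = ρ * ((X s).re - (X t).re) := by linear_combination him - ρ * hre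
  have h2 : (X s).re ≠ (X t).re := fun h2 => P.hsep s t h (Complex.ext h2 (by
    rw [h2] at h1; simp at h1; linarith))
  refine ⟨h2, h1, ?_, ?_⟩
  · intro h3; rw [h3] at hre; exact h2 (by linarith)
  · rintro rfl
    exact P.hcs s t h (by linarith)

/-- the finite set of bad slopes -/
theorem exists_slopes (P : Pencil u X χ K) : ∃ S : Set ℝ, S.Finite ∧ ∀ ρ, ρ ∈ S ↔ ∃ s t, Dbl u s t ∧
    (X s).re ≠ (X t).re ∧ (X s).im - (X t).im = ρ * ((X s).re - (X t).re) := by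
  refine ⟨_, ?_, fun ρ => Iff.rfl⟩
  refine (P.hK.image (fun p => ((X p.1).im - (X p.2).im) / ((X p.1).re - (X p.2).re))).subset ?_
  rintro ρ ⟨s, t, h, h1, h2⟩
  obtain ⟨p, hp, -, -, -, e1, e2⟩ := P.dbl_K h
  refine ⟨p, hp, ?_⟩
  rw [e1, e2] at h1 h2
  simp only
  rw [h2, mul_div_assoc, div_self (sub_ne_zero.2 h1), mul_one]

end Pencil

/-- a triangle in the plane -/
def Trg (ρ1 ρ2 : ℝ) : Set ℂ := {η | 0 ≤ η.re ∧ η.re ≤ 1 ∧ ρ1 * η.re ≤ η.im ∧ η.im ≤ ρ2 * η.re}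

theorem Trg_convex (ρ1 ρ2 : ℝ) : Convex ℝ (Trg ρ1 ρ2) := by
  intro x hx y hy c d hc hd hcd
  obtain ⟨h1, h2, h3, h4⟩ := hx
  obtain ⟨g1, g2, g3, g4⟩ := hy
  simp only [Trg, Set.mem_ofPred_eq, Complex.add_re, Complex.add_im, Complex.smul_re,
    Complex.smul_im, smul_eq_mul]
  refine ⟨by positivity, ?_, ?_, ?_⟩ <;> nlinarith

theorem Trg_bounded (ρ1 ρ2 : ℝ) : Bornology.IsBounded (Trg ρ1 ρ2) := by
  refine (Metric.isBounded_closedBall (x := (0 : ℂ)) (r := 1 + (|ρ1| + |ρ2|))).subset ?_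
  rintro x ⟨h1, h2, h3, h4⟩
  rw [Metric.mem_closedBall, dist_zero_right]
  refine (Complex.norm_le_abs_re_add_abs_im x).trans ?_
  have e1 : |x.re| ≤ 1 := by rw [abs_of_nonneg h1]; exact h2
  have e2 : |x.im| ≤ |ρ1| + |ρ2| := by
    have q1 := neg_abs_le ρ1
    have q2 := le_abs_self ρ2
    have q3 := abs_nonneg ρ1
    have q4 := abs_nonneg ρ2
    rw [abs_le]; constructor <;> nlinarith
  linarith

theorem Trg_form {ρ1 ρ2 : ℝ} (h : ρ1 ≤ ρ2) {η : ℂ} (hη : η ∈ Trg ρ1 ρ2) :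
    ∃ r ρ : ℝ, η = ⟨r, r * ρ⟩ ∧ r ∈ I ∧ ρ1 ≤ ρ ∧ ρ ≤ ρ2 := by
  obtain ⟨h1, h2, h3, h4⟩ := hη
  rcases h1.eq_or_lt with h0 | h0
  · refine ⟨0, ρ1, ?_, by simp, le_rfl, h⟩
    apply Complex.ext
    · exact h0.symm
    · rw [← h0] at h3 h4; simp at h3 h4 ⊢; linarith
  · refine ⟨η.re, η.im / η.re, ?_, ⟨h1, h2⟩, by rwa [le_div_iff₀ h0], by rwa [div_le_iff₀ h0]⟩
    apply Complex.ext
    · rfl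
    · simp; field_simp

theorem Trg_mem {ρ1 ρ2 r ρ : ℝ} (hr : r ∈ I) (h1 : ρ1 ≤ ρ) (h2 : ρ ≤ ρ2) :
    (⟨r, r * ρ⟩ : ℂ) ∈ Trg ρ1 ρ2 := by
  refine ⟨hr.1, hr.2, ?_, ?_⟩ <;> simp only <;> nlinarith [hr.1]
end

noncomputable section
open unitInterval
/-! ### Part 13: the pencil theorem -/

theorem ClsE_nonempty' {f : EmbS1 E4} {a : W3} (h : ∀ r : I, IsLoopEmb (segE (crv f) a r)) :
    (ClsE f a).Nonempty := by
  have := simplyConnected_BB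
  have hsf := SF.segE (Z := I) (f := fun _ => crv f) (SF.const (crv_emb f).1 (crv_emb f).2.1)
    (a := fun _ => a) (r := fun r => (r : ℝ)) continuous_const continuous_subtype_val
  have hc := hsf.lift h
  let b : BB := ⟨mkE (segE (crv f) a (1 : I)) (h 1), fun t => by
    simpa using segE_one_fst (crv f) a t⟩
  exact ⟨_, b, ⟨⟨_, hc⟩, EmbS1.ext' fun t => by simp [segE_zero], EmbS1.ext' fun t => by simp [b]⟩,
    fun r => rfl, PathConnectedSpace.somePath _ _, rfl⟩

theorem Dbl.symm {u : ℝ → ℂ} {s t : ℝ} (h : Dbl u s t) : Dbl u t s :=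
  ⟨h.1.symm, fun ⟨n, hn⟩ => h.2 ⟨-n, by push_cast; linarith⟩⟩

/-- local statement -/
theorem pencil_local {u X : ℝ → ℂ} {χ : ℝ → ℝ} {K : Set (ℝ × ℝ)} (P : Pencil u X χ K)
    {f : EmbS1 E4} {a b : W3} (Λ : ℂ × ℂ →L[ℝ] E4) (hi : Function.Injective Λ)
    (hΛ : ∀ η t, Hfam (crv f) a b η t = Λ (u t, X t + η * (χ t : ℂ)))
    {S : Set ℝ} (hS : ∀ ρ, ρ ∈ S ↔ ∃ s t, Dbl u s t ∧
      (X s).re ≠ (X t).re ∧ (X s).im - (X t).im = ρ * ((X s).re - (X t).re))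
    {ρ0 ρ1 ρ2 : ℝ} (h12 : ρ1 ≤ ρ2) (hloc : ∀ ρ ∈ S, ρ1 ≤ ρ → ρ ≤ ρ2 → ρ = ρ0)
    (h1 : ρ1 ∉ S) (h2 : ρ2 ∉ S)
    {c1 : Path.Homotopic.Quotient f b0.1} (hc1 : c1 ∈ ClsE f (a + ρ1 • b))
    {c2 : Path.Homotopic.Quotient f b0.1} (hc2 : c2 ∈ ClsE f (a + ρ2 • b)) : c1 = c2 := by
  have emb : ∀ η : ℂ, (∀ s t, Dbl u s t → X s + η * (χ s : ℂ) ≠ X t + η * (χ t : ℂ)) →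
      IsLoopEmb (Hfam (crv f) a b η) := by
    intro η h
    have := (P.emb h).clm Λ hi
    convert this using 2
    exact hΛ _ _
  have sf : ∀ Y : Set ℂ, SF (fun y : Y => Hfam (crv f) a b y) := fun Y =>
    SF.Hfam (f := fun _ => crv f) (SF.const (crv_emb f).1 (crv_emb f).2.1) a b
      continuous_subtype_val
  have e1 : ∀ r : I, (⟨r, r * ρ1⟩ : ℂ) ∈ Trg ρ1 ρ2 := fun r => Trg_mem r.2 le_rfl h12
  have e2 : ∀ r : I, (⟨r, r * ρ2⟩ : ℂ) ∈ Trg ρ1 ρ2 := fun r => Trg_mem r.2 h12 le_rfl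
  have e12 : ∀ θ : I, (⟨1, ρ1 + θ * (ρ2 - ρ1)⟩ : ℂ) ∈ Trg ρ1 ρ2 := fun θ => by
    have := Trg_mem (r := 1) (ρ := ρ1 + θ * (ρ2 - ρ1)) (ρ1 := ρ1) (ρ2 := ρ2) ⟨zero_le_one, le_rfl⟩
      (by nlinarith [θ.2.1]) (by nlinarith [θ.2.2])
    simpa using this
  by_cases hA : ∀ η ∈ Trg ρ1 ρ2, ∀ s t, Dbl u s t → X s + η * (χ s : ℂ) ≠ X t + η * (χ t : ℂ)
  · let G : C(Trg ρ1 ρ2, EmbS1 E4) := ⟨_, (sf _).lift (fun y => emb y (hA y y.2))⟩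
    exact cls_of_null G (fun y => by simp [G]) (null_convex (Trg_convex _ _) ⟨_, e1 0⟩ G)
      e1 e2 e12 hc1 hc2
  · push Not at hA
    obtain ⟨η0, hη0, s0, t0, hd0, he0⟩ := hA
    obtain ⟨r0, ρ', hr0, hrI, hρ1, hρ2⟩ := Trg_form h12 hη0
    have hb0 := P.bad hd0 (by rw [← hr0]; exact he0)
    have hρ' : ρ' = ρ0 := hloc _ ((hS _).2 ⟨s0, t0, hd0, hb0.1, hb0.2.1⟩) hρ1 hρ2
    subst hρ'
    have uniq : ∀ η ∈ Trg ρ1 ρ2, ∀ s t, Dbl u s t → X s + η * (χ s : ℂ) = X t + η * (χ t : ℂ) →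
        Tri s0 t0 s t ∧ η = η0 := by
      intro η hη s t hd he
      obtain ⟨r, ρ, hr, -, q1, q2⟩ := Trg_form h12 hη
      have hb := P.bad hd (by rw [← hr]; exact he)
      have hρ : ρ = ρ' := hloc _ ((hS _).2 ⟨s, t, hd, hb.1, hb.2.1⟩) q1 q2
      subst hρ
      have tri := P.hslope s t s0 t0 hd hd0 hb.1 hb0.1 (by rw [hb.2.1, hb0.2.1]; ring)
      refine ⟨tri, ?_⟩
      have hχ : (χ s0 : ℂ) - χ t0 ≠ 0 := by
        rw [sub_ne_zero]; exact_mod_cast hb0.2.2.1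
      apply mul_right_cancel₀ hχ
      rcases tri with h | ⟨m, n, rfl, rfl⟩ | ⟨m, n, rfl, rfl⟩
      · exact absurd h hd.2
      · rw [P.hXp.add_int, P.hXp.add_int, P.hχp.add_int, P.hχp.add_int] at he
        linear_combination he - he0
      · rw [P.hXp.add_int, P.hXp.add_int, P.hχp.add_int, P.hχp.add_int] at he
        linear_combination - he - he0
    have hne : ∀ y : (Trg ρ1 ρ2 \ {η0} : Set ℂ), ∀ s t, Dbl u s t →
        X s + y * (χ s : ℂ) ≠ X t + y * (χ t : ℂ) := fun y s t hd he =>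
      y.2.2 (uniq y y.2.1 s t hd he).2
    let G : C((Trg ρ1 ρ2 \ {η0} : Set ℂ), EmbS1 E4) := ⟨_, (sf _).lift (fun y => emb y (hne y))⟩
    have sfX : SF (fun (_ : Unit) t => X t + η0 * (χ t : ℂ)) := (SF.const P.hX P.hXp).add
      ((SF.param continuous_const).mul ((SF.const P.hχ P.hχp).clm Complex.ofRealCLM))
    obtain ⟨ε, hε, GM, hGM, hnull⟩ := lemmaM (X := fun t => X t + η0 * (χ t : ℂ)) P.hu P.hup
      (sfX.smooth ()) (sfX.per ()) P.hχ P.hχp hd0.1 he0 hb0.2.2.1 P.himm (P.hdt _ _ hd0)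
      (fun s t hu hX => by
        by_cases h : ∃ n : ℤ, s = t + n
        · exact Or.inl h
        · exact (uniq η0 hη0 s t ⟨hu, h⟩ hX).1) K P.hK P.hKu
    have nG : G.Nullhomotopic := by
      refine null_punctured (Trg_convex _ _) (Trg_bounded _ _) hη0 G hε ((mapE Λ hi).comp GM)
        (hnull.comp_right _) ?_
      intro y η hy
      apply EmbS1.ext'
      intro t
      simp only [ContinuousMap.comp_apply, crv_mapE, hGM, G, ContinuousMap.coe_mk, crv_mkE, hΛ]
      rw [hy]; congr 2; ring
    refine cls_of_null G (fun y => by simp [G]) nG (fun r => ⟨e1 r, ?_⟩) (fun r => ⟨e2 r, ?_⟩)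
      (fun θ => ⟨e12 θ, ?_⟩) hc1 hc2
    · rintro rfl
      have hb := P.bad hd0 he0
      exact h1 ((hS _).2 ⟨s0, t0, hd0, hb.1, hb.2.1⟩)
    · rintro rfl
      have hb := P.bad hd0 he0
      exact h2 ((hS _).2 ⟨s0, t0, hd0, hb.1, hb.2.1⟩)
    · intro h
      rw [Set.mem_singleton_iff, hr0] at h
      exact hb0.2.2.2 (congrArg Complex.re h).symm

theorem pencil_main {u X : ℝ → ℂ} {χ : ℝ → ℝ} {K : Set (ℝ × ℝ)} (P : Pencil u X χ K)
    {f : EmbS1 E4} {a b : W3} (Λ : ℂ × ℂ →L[ℝ] E4) (hi : Function.Injective Λ)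
    (hΛ : ∀ η t, Hfam (crv f) a b η t = Λ (u t, X t + η * (χ t : ℂ)))
    {ρ1 ρ2 : ℝ} (h1 : ∀ s t, Dbl u s t → (X s).re ≠ (X t).re →
      (X s).im - (X t).im ≠ ρ1 * ((X s).re - (X t).re))
    (h2 : ∀ s t, Dbl u s t → (X s).re ≠ (X t).re →
      (X s).im - (X t).im ≠ ρ2 * ((X s).re - (X t).re))
    {c1 : Path.Homotopic.Quotient f b0.1} (hc1 : c1 ∈ ClsE f (a + ρ1 • b))
    {c2 : Path.Homotopic.Quotient f b0.1} (hc2 : c2 ∈ ClsE f (a + ρ2 • b)) : c1 = c2 := by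
  obtain ⟨S, hSf, hS⟩ := P.exists_slopes
  have hne : ∀ ρ, ρ ∉ S → (ClsE f (a + ρ • b)).Nonempty := by
    intro ρ hρ
    apply ClsE_nonempty'
    intro r
    rw [segE_eq_Hfam]
    have := (P.emb (η := ⟨r, r * ρ⟩) (fun s t hd he => hρ ((hS _).2 ⟨s, t, hd, ?_, ?_⟩))).clm Λ hi
    · convert this using 2
      exact hΛ _ _
    · exact (P.bad hd he).1
    · exact (P.bad hd he).2.1
  let R : ℝ → ℝ → Prop := fun x y => ∃ N ∈ 𝓝 x, ∃ N' ∈ 𝓝 y, ∀ ρ ∈ N \ S, ∀ ρ' ∈ N' \ S,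
    ∀ c ∈ ClsE f (a + ρ • b), ∀ c' ∈ ClsE f (a + ρ' • b), c = c'
  have hdense : Dense Sᶜ := hSf.countable.dense_compl ℝ
  have hR : ∀ x y, R x y := by
    intro x y
    refine PreconnectedSpace.induction₂' R ?_ ?_ x y
    · intro x
      have hT : {y | y ∈ (S \ {x})ᶜ} ∈ 𝓝 x := (hSf.subset Set.sdiff_subset).isClosed.isOpen_compl.mem_nhds
        (by simp)
      obtain ⟨δ, hδ, hball⟩ := Metric.mem_nhds_iff.1 hT
      filter_upwards [Metric.ball_mem_nhds x hδ] with y hy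
      have key : ∀ ρ ∈ Metric.ball x δ \ S, ∀ ρ' ∈ Metric.ball x δ \ S,
          ∀ c ∈ ClsE f (a + ρ • b), ∀ c' ∈ ClsE f (a + ρ' • b), c = c' := by
        have key0 : ∀ ρ ∈ Metric.ball x δ \ S, ∀ ρ' ∈ Metric.ball x δ \ S, ρ ≤ ρ' →
          ∀ c ∈ ClsE f (a + ρ • b), ∀ c' ∈ ClsE f (a + ρ' • b), c = c' := by
          intro ρ hρ ρ' hρ' hle c hc c' hc'
          refine pencil_local P Λ hi hΛ hS (ρ0 := x) hle ?_ hρ.2 hρ'.2 hc hc'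
          intro τ hτ k1 k2
          by_contra hx
          have : τ ∈ Metric.ball x δ := by
            have a1 := hρ.1; have a2 := hρ'.1
            rw [Real.ball_eq_Ioo] at *
            exact ⟨lt_of_lt_of_le a1.1 k1, lt_of_le_of_lt k2 a2.2⟩
          exact hball this ⟨hτ, hx⟩
        intro ρ hρ ρ' hρ' c hc c' hc'
        rcases le_total ρ ρ' with h | h
        · exact key0 ρ hρ ρ' hρ' h c hc c' hc'
        · exact (key0 ρ' hρ' ρ hρ h c' hc' c hc).symm
      have hy' := Metric.isOpen_ball.mem_nhds hy
      have hx' := Metric.ball_mem_nhds x hδ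
      exact ⟨⟨_, hx', _, hy', key⟩, ⟨_, hy', _, hx', key⟩⟩
    · refine ⟨?_⟩
      rintro x y z ⟨N, hN, N', hN', h⟩ ⟨M, hM, M', hM', h'⟩
      refine ⟨N, hN, M', hM', ?_⟩
      intro ρ hρ ρ' hρ' c hc c' hc'
      obtain ⟨τ, hτ, hτS⟩ := (mem_closure_iff_nhds.1 (hdense y)) _ (Filter.inter_mem hN' hM)
      obtain ⟨d, hd⟩ := hne τ hτS
      rw [h ρ hρ τ ⟨hτ.1, hτS⟩ c hc d hd, h' τ ⟨hτ.2, hτS⟩ ρ' hρ' d hd c' hc']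
  obtain ⟨N, hN, N', hN', h⟩ := hR ρ1 ρ2
  refine h ρ1 ⟨mem_of_mem_nhds hN, ?_⟩ ρ2 ⟨mem_of_mem_nhds hN', ?_⟩ c1 hc1 c2 hc2
  · rw [hS]; rintro ⟨s, t, hd, e1, e2⟩; exact h1 s t hd e1 e2
  · rw [hS]; rintro ⟨s, t, hd, e1, e2⟩; exact h2 s t hd e1 e2
end

noncomputable section
open unitInterval
/-! ### Part 14: genericity -/

/-- Haar measure -/
abbrev μ3 : MeasureTheory.Measure W3 := MeasureTheory.Measure.addHaar

theorem ae_regular (g : W3 → W3) (g' : W3 → W3 →L[ℝ] W3) (h : ∀ p, HasFDerivAt g (g' p) p) :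
    ∀ᵐ b : W3 ∂μ3, ∀ p, g p = b → Function.Injective (g' p) := by
  have h0 := MeasureTheory.addHaar_image_eq_zero_of_det_fderivWithin_eq_zero
    μ3 (f := g) (f' := g')
    (s := {p | (g' p).det = 0}) (fun p _ => (h p).hasFDerivWithinAt) (fun p hp => hp)
  have h1 := MeasureTheory.measure_eq_zero_iff_ae_notMem.1 h0
  filter_upwards [h1] with b hb p hp
  have hdet : LinearMap.det ((g' p : W3 →L[ℝ] W3) : W3 →ₗ[ℝ] W3) ≠ 0 := fun h2 => hb ⟨p, h2, hp⟩
  exact (LinearMap.equivOfDetNeZero _ hdet).injective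

/-- evaluating at the first parameter -/
theorem hasFDerivAt_re {v : ℝ → W3} (hv : Differentiable ℝ v) (p : W3) :
    HasFDerivAt (fun p : W3 => v p.1.re)
      ((ContinuousLinearMap.toSpanSingleton ℝ (deriv v p.1.re)).comp
        (Complex.reCLM.comp (ContinuousLinearMap.fst ℝ ℂ ℝ))) p :=
  HasFDerivAt.comp (g := v) p (f := fun p : W3 => p.1.re) (hv p.1.re).hasDerivAt.hasFDerivAt
    (Complex.reCLM.comp (ContinuousLinearMap.fst ℝ ℂ ℝ)).hasFDerivAt

theorem hasFDerivAt_im {v : ℝ → W3} (hv : Differentiable ℝ v) (p : W3) :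
    HasFDerivAt (fun p : W3 => v p.1.im)
      ((ContinuousLinearMap.toSpanSingleton ℝ (deriv v p.1.im)).comp
        (Complex.imCLM.comp (ContinuousLinearMap.fst ℝ ℂ ℝ))) p :=
  HasFDerivAt.comp (g := v) p (f := fun p : W3 => p.1.im) (hv p.1.im).hasDerivAt.hasFDerivAt
    (Complex.imCLM.comp (ContinuousLinearMap.fst ℝ ℂ ℝ)).hasFDerivAt

theorem ae_avoid {v : ℝ → W3} (hv : Differentiable ℝ v) :
    ∀ᵐ b : W3 ∂μ3, ∀ r s : ℝ, r • v s ≠ b := by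
  have := ae_regular (fun p => p.2 • v p.1.re) _
    (fun p => (ContinuousLinearMap.snd ℝ ℂ ℝ).hasFDerivAt.smul (hasFDerivAt_re hv p))
  filter_upwards [this] with b hb r s h
  have h1 := @hb (⟨s, 0⟩, r) h (Complex.I, 0) 0 (by simp)
  simp at h1

theorem ae_chord {w : ℝ → W3} (hw : Differentiable ℝ w) :
    ∀ᵐ b : W3 ∂μ3, ∀ r s t : ℝ, r • (w s - w t) = b → ∀ c d e : ℝ,
      c • (w s - w t) + r • (d • deriv w s - e • deriv w t) = 0 → c = 0 ∧ d = 0 ∧ e = 0 := by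
  have := ae_regular (fun p => p.2 • (w p.1.re - w p.1.im)) _
    (fun p => (ContinuousLinearMap.snd ℝ ℂ ℝ).hasFDerivAt.smul
      ((hasFDerivAt_re hw p).sub (hasFDerivAt_im hw p)))
  filter_upwards [this] with b hb r s t h c d e h2
  have h1 := @hb (⟨s, t⟩, r) h (⟨d, e⟩, c) 0 (by
    rw [map_zero]
    simpa [add_comm] using h2)
  have h3 := congrArg Prod.fst h1
  have h4 := congrArg Prod.snd h1
  exact ⟨h4, congrArg Complex.re h3, congrArg Complex.im h3⟩

/-- finiteness of double points -/
theorem finite_dbl {u : ℝ → ℂ} (hu : ContDiff ℝ (⊤ : ℕ∞) u) (hup : Loop1 u)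
    (himm : ∀ t, deriv u t ≠ 0) (hdt : ∀ s t, Dbl u s t → dt (deriv u s) (deriv u t) ≠ 0) :
    ∃ K : Set (ℝ × ℝ), K.Finite ∧ (∀ p ∈ K, Dbl u p.1 p.2) ∧ ∀ s t, u s = u t →
      (∃ n : ℤ, s = t + n) ∨ ∃ p ∈ K, ∃ m n : ℤ, s = p.1 + m ∧ t = p.2 + n := by
  have sf : SF (fun (_ : Unit) => u) := SF.const hu hup
  have pull : ∀ (p0 : ℝ × ℝ) (A : ℝ × ℝ → Prop), (∀ᶠ p : Unit × (ℝ × ℝ) in 𝓝 ((), p0), A p.2) →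
      ∀ᶠ p in 𝓝 p0, A p := fun p0 A h =>
    (by fun_prop : Continuous fun p : ℝ × ℝ => ((), p)).continuousAt.eventually h
  refine ⟨{p | Dbl u p.1 p.2} ∩ (I ×ˢ I), ?_, fun p hp => hp.1, ?_⟩
  · refine (isCompact_Icc.prod isCompact_Icc).induction_on
      (p := fun C => ({p | Dbl u p.1 p.2} ∩ C).Finite) (by simp)
      (fun C D hCD h => h.subset (by gcongr)) (fun C D hC hD => by
        rw [Set.inter_union_distrib_left]; exact hC.union hD) ?_
    rintro ⟨s0, t0⟩ -
    suffices h : ∀ᶠ p in 𝓝 (s0, t0), Dbl u p.1 p.2 → p = (s0, t0) by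
      refine ⟨_, mem_nhdsWithin_of_mem_nhds h, (Set.finite_singleton (s0, t0)).subset ?_⟩
      rintro p ⟨h1, h2⟩
      exact h2 h1
    by_cases h1 : u s0 = u t0
    · by_cases h2 : ∃ n : ℤ, s0 = t0 + n
      · obtain ⟨n, hn⟩ := h2
        have := pull (s0, t0) (fun p => True → u p.1 = u p.2 → ∃ n : ℤ, p.1 = p.2 + n)
          (ev_diag' sf (A := fun _ => True) (z0 := ()) hn (himm t0))
        filter_upwards [this] with p hp hd
        exact absurd (hp trivial hd.1) hd.2
      · have := pull (s0, t0) (fun p => u p.1 = u p.2 → p.1 = s0 ∧ p.2 = t0)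
          (ev_transverse sf (z0 := ()) (fun _ => h1) (hdt _ _ ⟨h1, h2⟩))
        filter_upwards [this] with p hp hd
        exact Prod.ext (hp hd.1).1 (hp hd.1).2
    · have := pull (s0, t0) (fun p => u p.1 ≠ u p.2) (ev_of_ne sf (z0 := ()) h1)
      filter_upwards [this] with p hp hd
      exact absurd hd.1 hp
  · intro s t hst
    by_cases h : ∃ n : ℤ, s = t + n
    · exact Or.inl h
    right
    have e1 : s = Int.fract s + (⌊s⌋ : ℤ) := (Int.fract_add_floor s).symm
    have e2 : t = Int.fract t + (⌊t⌋ : ℤ) := (Int.fract_add_floor t).symm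
    refine ⟨(Int.fract s, Int.fract t), ⟨⟨?_, ?_⟩, ⟨Int.fract_nonneg _, (Int.fract_lt_one _).le⟩,
      Int.fract_nonneg _, (Int.fract_lt_one _).le⟩, _, _, e1, e2⟩
    · rw [e1, e2, hup.add_int, hup.add_int] at hst; exact hst
    · rintro ⟨n, hn⟩
      exact h ⟨n + ⌊s⌋ - ⌊t⌋, by push_cast; simp only at hn; linarith⟩

/-- smooth periodic functions -/
def SPer : Submodule ℝ (ℝ → ℝ) where
  carrier := {ξ | ContDiff ℝ (⊤ : ℕ∞) ξ ∧ Loop1 ξ}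
  add_mem' := fun h1 h2 => ⟨h1.1.add h2.1, fun t => by simp [h1.2 t, h2.2 t]⟩
  zero_mem' := ⟨contDiff_const, fun t => rfl⟩
  smul_mem' := fun c _ h => ⟨contDiff_const.smul h.1, fun t => by simp [h.2 t]⟩

/-- a bump vanishing exactly at q mod 1 -/
def vz (q t : ℝ) : ℝ := 1 - cs (t - q)

theorem vz_self (q : ℝ) : vz q q = 0 := by simp [vz, cs]

theorem vz_ne {q t : ℝ} (h : ¬ ∃ n : ℤ, t = q + n) : vz q t ≠ 0 := by
  intro h0
  have h1 : cs (t - q) = cs 0 := by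
    have : cs 0 = 1 := by simp [cs]
    rw [this]; unfold vz at h0; linarith
  rcases cs_eq_cs h1 with ⟨n, hn⟩ | ⟨n, hn⟩ <;> exact h ⟨n, by linarith⟩

theorem vz_smooth (q : ℝ) : ContDiff ℝ (⊤ : ℕ∞) (vz q) := by
  unfold vz cs; fun_prop

theorem vz_per (q : ℝ) : Loop1 (vz q) := fun t => by
  unfold vz; rw [show t + 1 - q = (t - q) + 1 by ring, cs_per]

theorem exists_bump (p q1 q2 q3 : ℝ) (h1 : ¬ ∃ n : ℤ, p = q1 + n) (h2 : ¬ ∃ n : ℤ, p = q2 + n)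
    (h3 : ¬ ∃ n : ℤ, p = q3 + n) : ∃ ξ ∈ SPer, ξ p ≠ 0 ∧ ξ q1 = 0 ∧ ξ q2 = 0 ∧ ξ q3 = 0 := by
  refine ⟨fun t => vz q1 t * vz q2 t * vz q3 t, ⟨?_, ?_⟩, ?_, ?_, ?_, ?_⟩
  · exact ((vz_smooth _).mul (vz_smooth _)).mul (vz_smooth _)
  · intro t; simp [vz_per _ t]
  · exact mul_ne_zero (mul_ne_zero (vz_ne h1) (vz_ne h2)) (vz_ne h3)
  all_goals simp [vz_self]

theorem exists_sep {s t s' t' : ℝ} (h : ¬ ∃ n : ℤ, s = t + n) (hT : ¬ Tri s' t' s t)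
    {A B : ℝ} (hA : A ≠ 0) : ∃ ξ ∈ SPer, (ξ s - ξ t) * A - (ξ s' - ξ t') * B ≠ 0 := by
  have h' : ¬ ∃ n : ℤ, t = s + n := fun ⟨n, hn⟩ => h ⟨-n, by push_cast; linarith⟩
  by_cases c1 : (∃ n : ℤ, s = s' + n) ∨ ∃ n : ℤ, s = t' + n
  · have c2 : ¬ ∃ n : ℤ, t = s' + n := by
      rintro ⟨n, hn⟩
      rcases c1 with ⟨m, hm⟩ | ⟨m, hm⟩
      · exact h ⟨m - n, by push_cast; linarith⟩
      · exact hT (Or.inr (Or.inr ⟨m, n, hm, hn⟩))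
    have c3 : ¬ ∃ n : ℤ, t = t' + n := by
      rintro ⟨n, hn⟩
      rcases c1 with ⟨m, hm⟩ | ⟨m, hm⟩
      · exact hT (Or.inr (Or.inl ⟨m, n, hm, hn⟩))
      · exact h ⟨m - n, by push_cast; linarith⟩
    obtain ⟨ξ, hξ, e1, e2, e3, e4⟩ := exists_bump t s s' t' h' c2 c3
    exact ⟨ξ, hξ, by simp [e1, e2, e3, e4, hA]⟩
  · push Not at c1
    obtain ⟨ξ, hξ, e1, e2, e3, e4⟩ := exists_bump s t s' t' h (fun ⟨n, hn⟩ => c1.1 n hn)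
      (fun ⟨n, hn⟩ => c1.2 n hn)
    exact ⟨ξ, hξ, by simp [e1, e2, e3, e4, hA]⟩

/-- a function separating slopes -/
theorem exists_xi {K : Set (ℝ × ℝ)} (hK : K.Finite) {x : ℝ → ℝ}
    (hd : ∀ p ∈ K, ¬ ∃ n : ℤ, p.1 = p.2 + n) : ∃ ξ ∈ SPer, ∀ p ∈ K, ∀ q ∈ K, x q.1 ≠ x q.2 →
      ¬ Tri q.1 q.2 p.1 p.2 →
      (ξ p.1 - ξ p.2) * (x q.1 - x q.2) - (ξ q.1 - ξ q.2) * (x p.1 - x p.2) ≠ 0 := by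
  let J := {z : (ℝ × ℝ) × (ℝ × ℝ) | z.1 ∈ K ∧ z.2 ∈ K ∧ x z.2.1 ≠ x z.2.2 ∧
    ¬ Tri z.2.1 z.2.2 z.1.1 z.1.2}
  have hJ : J.Finite := (hK.prod hK).subset fun z hz => ⟨hz.1, hz.2.1⟩
  have := hJ.to_subtype
  let pr : ℝ → Module.Dual ℝ (ℝ → ℝ) := fun t => LinearMap.proj t
  obtain ⟨ξ, hξ, h⟩ := Module.Dual.exists_forall_mem_ne_zero_of_forall_exists SPer
    (fun z : J => (x z.1.2.1 - x z.1.2.2) • (pr z.1.1.1 - pr z.1.1.2) -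
      (x z.1.1.1 - x z.1.1.2) • (pr z.1.2.1 - pr z.1.2.2)) (by
      rintro ⟨⟨p, q⟩, hp, hq, hx, hT⟩
      obtain ⟨ξ, hξ, e⟩ := exists_sep (hd p hp) hT (B := x p.1 - x p.2) (sub_ne_zero.2 hx)
      refine ⟨ξ, hξ, ?_⟩
      simp only [pr, LinearMap.sub_apply, LinearMap.smul_apply, LinearMap.proj_apply, smul_eq_mul]
      rw [mul_comm, mul_comm (x p.1 - x p.2)]; exact e)
  refine ⟨ξ, hξ, fun p hp q hq hx hT => ?_⟩
  have e := h ⟨(p, q), hp, hq, hx, hT⟩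
  simp only [pr, LinearMap.sub_apply, LinearMap.smul_apply, LinearMap.proj_apply, smul_eq_mul] at e
  rw [mul_comm, mul_comm (ξ q.1 - ξ q.2)]; exact e

/-- slopes become distinct after a small perturbation -/
theorem exists_eps {K : Set (ℝ × ℝ)} (hK : K.Finite) {x z : ℝ → ℝ} {ξ : ℝ → ℝ}
    (hξ : ∀ p ∈ K, ∀ q ∈ K, x q.1 ≠ x q.2 → ¬ Tri q.1 q.2 p.1 p.2 →
      (ξ p.1 - ξ p.2) * (x q.1 - x q.2) - (ξ q.1 - ξ q.2) * (x p.1 - x p.2) ≠ 0) :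
    ∃ B : Set ℝ, B.Finite ∧ ∀ ε ∉ B, ∀ p ∈ K, ∀ q ∈ K, x q.1 ≠ x q.2 →
      ((z p.1 + ε * ξ p.1) - (z p.2 + ε * ξ p.2)) * (x q.1 - x q.2) =
      ((z q.1 + ε * ξ q.1) - (z q.2 + ε * ξ q.2)) * (x p.1 - x p.2) → Tri q.1 q.2 p.1 p.2 := by
  refine ⟨(fun y : (ℝ × ℝ) × (ℝ × ℝ) =>
    ((z y.2.1 - z y.2.2) * (x y.1.1 - x y.1.2) - (z y.1.1 - z y.1.2) * (x y.2.1 - x y.2.2)) /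
    ((ξ y.1.1 - ξ y.1.2) * (x y.2.1 - x y.2.2) - (ξ y.2.1 - ξ y.2.2) * (x y.1.1 - x y.1.2))) ''
    (K ×ˢ K), (hK.prod hK).image _, ?_⟩
  intro ε hε p hp q hq hx he
  by_contra hT
  refine hε ⟨(p, q), ⟨hp, hq⟩, ?_⟩
  simp only
  rw [div_eq_iff (hξ p hp q hq hx hT)]
  linear_combination -he
end

noncomputable section
open unitInterval
/-! ### Part 15: conclusion -/

/-- the linear map recovering the curve from its coordinates -/
def Lam (T : W3 ≃L[ℝ] W3) (a : W3) : ℂ × ℂ →L[ℝ] E4 :=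
  (Complex.reCLM.comp (ContinuousLinearMap.snd ℝ ℂ ℂ)).prod
    ((T.symm : W3 →L[ℝ] W3).comp ((ContinuousLinearMap.fst ℝ ℂ ℂ).prod
      (Complex.imCLM.comp (ContinuousLinearMap.snd ℝ ℂ ℂ))) +
    (Complex.reCLM.comp (ContinuousLinearMap.snd ℝ ℂ ℂ)).smulRight a)

theorem Lam_apply (T : W3 ≃L[ℝ] W3) (a : W3) (u X : ℂ) :
    Lam T a (u, X) = (X.re, T.symm (u, X.im) + X.re • a) := rfl

theorem Lam_inj (T : W3 ≃L[ℝ] W3) (a : W3) : Function.Injective (Lam T a) := by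
  rintro ⟨u, X⟩ ⟨u', X'⟩ h
  rw [Lam_apply, Lam_apply] at h
  have h1 : X.re = X'.re := congrArg Prod.fst h
  have h2 := congrArg Prod.snd h
  simp only [h1, add_left_inj] at h2
  have h3 := T.symm.injective h2
  have h4 : u = u' := congrArg Prod.fst h3
  have h5 : X.im = X'.im := congrArg Prod.snd h3
  exact Prod.ext h4 (Complex.ext h1 h5)

/-- the pencil theorem in coordinates, assuming distinct slopes -/
theorem coord_eq {f : EmbS1 E4} {a b : W3} (T : W3 ≃L[ℝ] W3) (hT : T b = (0, 1))
    (ha : Good (crv f) a) (hb : Good (crv f) (a + b)) {u : ℝ → ℂ} {z : ℝ → ℝ}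
    (huz : ∀ t, T (La a (crv f t)) = (u t, z t)) {K : Set (ℝ × ℝ)}
    (himm : ∀ t, deriv u t ≠ 0) (hdt : ∀ s t, Dbl u s t → dt (deriv u s) (deriv u t) ≠ 0)
    (hcs : ∀ s t, Dbl u s t → cs s ≠ cs t) (hK : K.Finite) 
    (hKu : ∀ s t, u s = u t → (∃ n : ℤ, s = t + n) ∨
      ∃ p ∈ K, ∃ m n : ℤ, s = p.1 + m ∧ t = p.2 + n)
    (hsl : ∀ p ∈ K, ∀ q ∈ K, (crv f q.1).1 ≠ (crv f q.2).1 →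
      (z p.1 - z p.2) * ((crv f q.1).1 - (crv f q.2).1) =
      (z q.1 - z q.2) * ((crv f p.1).1 - (crv f p.2).1) → Tri q.1 q.2 p.1 p.2)
    {c1 : Path.Homotopic.Quotient f b0.1} (hc1 : c1 ∈ ClsE f a)
    {c2 : Path.Homotopic.Quotient f b0.1} (hc2 : c2 ∈ ClsE f (a + b)) : c1 = c2 := by
  have sff : SF (fun (_ : Unit) => crv f) := SF.const (crv_emb f).1 (crv_emb f).2.1
  have sfw := (sff.La (a := fun _ => a) continuous_const).clm (T : W3 →L[ℝ] W3)
  have sfu : SF (fun (_ : Unit) => u) := by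
    convert sfw.fst using 3 with _ t; exact (congrArg Prod.fst (huz t)).symm
  have sfz : SF (fun (_ : Unit) => z) := by
    convert sfw.snd using 3 with _ t; exact (congrArg Prod.snd (huz t)).symm
  have sfx := sff.fst
  let x : ℝ → ℝ := fun t => (crv f t).1
  let X : ℝ → ℂ := fun t => ⟨x t, z t⟩
  have sfX : SF (fun (_ : Unit) => X) := by
    have := (sfx.prodMk sfz).clm (Complex.equivRealProdCLM.symm : ℝ × ℝ →L[ℝ] ℂ)
    exact this
  have sfχ : SF (fun (_ : Unit) t => cs t - x t) := (SF.const cs_smooth cs_per).sub sfx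
  have hx : Loop1 x := sfx.per ()
  have hz : Loop1 z := sfz.per ()
  have hup : Loop1 u := sfu.per ()
  have hsepw : ∀ s t, Dbl u s t → z s ≠ z t := by
    intro s t hd he
    refine hd.2 (ha.2.2.2 s t (T.injective ?_))
    simp only
    rw [huz, huz, hd.1, he]
  have P : Pencil u X (fun t => cs t - x t) K :=
    { hu := sfu.smooth ()
      hup := hup
      hX := sfX.smooth ()
      hXp := sfX.per ()
      hχ := sfχ.smooth ()
      hχp := sfχ.per ()
      himm := himm
      hK := hK
      hKu := hKu
      hdt := hdt
      hcs := fun s t hd h => hcs s t hd (by simpa [X] using h)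
      hsep := fun s t hd h => hsepw s t hd (congrArg Complex.im h)
      hslope := by
        intro s t s' t' hd hd' h1 h2 he
        rcases hKu s t hd.1 with h | ⟨p, hp, m, n, rfl, rfl⟩
        · exact Or.inl h
        rcases hKu s' t' hd'.1 with h | ⟨q, hq, m', n', rfl, rfl⟩
        · exact absurd h hd'.2
        simp only [X, hx.add_int, hz.add_int] at h1 h2 he
        rcases hsl p hp q hq h2 he with ⟨k, hk⟩ | ⟨k, l, hk, hl⟩ | ⟨k, l, hk, hl⟩
        · left; exact ⟨k + m - n, by push_cast; linarith⟩
        · right; left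
          exact ⟨k + m - m', l + n - n', by push_cast; linarith, by push_cast; linarith⟩
        · right; right
          exact ⟨k + m - n', l + n - m', by push_cast; linarith, by push_cast; linarith⟩ }
  have hTs : T.symm ((0 : ℂ), (1 : ℝ)) = b := by rw [← hT]; simp
  refine pencil_main P (Lam T a) (Lam_inj T a) (a := a) (b := b) (ρ1 := 0) (ρ2 := 1) ?_ ?_ ?_
    (by simpa using hc1) (by simpa using hc2)
  · intro η t
    rw [Lam_apply]
    have e1 : (u t, (X t + η * ((cs t - x t : ℝ) : ℂ)).im) =
        T (La a (crv f t)) + (η.im * (cs t - x t)) • T b := by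
      rw [huz, hT]
      refine Prod.ext (by simp) (by simp [X])
    rw [e1, ← map_smul, ← map_add, T.symm_apply_apply]
    refine Prod.ext ?_ ?_
    · simp [Hfam, X, x]; ring
    · simp only [Hfam, La_apply, X, x]
      simp
      module
  · intro s t hd _ h
    refine hsepw s t hd ?_
    simp [X] at h
    linarith
  · intro s t hd _ h
    refine hd.2 (hb.2.2.2 s t (T.injective ?_))
    have e : ∀ t, T (La (a + b) (crv f t)) = (u t, z t - x t) := by
      intro t
      have : La (a + b) (crv f t) = La a (crv f t) - x t • b := by
        simp only [La_apply, x]; module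
      rw [this, map_sub, map_smul, hT, huz]
      simp
    simp only [e]
    rw [hd.1]
    simp [X] at h
    congr 1; linarith

theorem generic_eq {f : EmbS1 E4} {a b : W3} (ha : Good (crv f) a) (hb : Good (crv f) (a + b))
    (g1 : ∀ r s : ℝ, r • deriv (fun t => La a (crv f t)) s ≠ b)
    (g2 : ∀ r s : ℝ, r • (La a (crv f s) - La a (crv f (-s))) ≠ b)
    (g3 : ∀ r s t : ℝ, r • (La a (crv f s) - La a (crv f t)) = b → ∀ c d e : ℝ,
      c • (La a (crv f s) - La a (crv f t)) + r • (d • deriv (fun t => La a (crv f t)) s -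
        e • deriv (fun t => La a (crv f t)) t) = 0 → c = 0 ∧ d = 0 ∧ e = 0)
    {c1 : Path.Homotopic.Quotient f b0.1} (hc1 : c1 ∈ ClsE f a)
    {c2 : Path.Homotopic.Quotient f b0.1} (hc2 : c2 ∈ ClsE f (a + b)) : c1 = c2 := by
  have hb0 : b ≠ 0 := fun h => g1 0 0 (by simp [h])
  obtain ⟨T, hT⟩ := SeparatingDual.exists_continuousLinearEquiv_apply_eq (R := ℝ) hb0
    (y := ((0, 1) : W3)) (by simp [Prod.ext_iff])
  have sff : SF (fun (_ : Unit) => crv f) := SF.const (crv_emb f).1 (crv_emb f).2.1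
  set w : ℝ → W3 := fun t => La a (crv f t) with hw
  have sfw0 : SF (fun (_ : Unit) => w) := sff.La (a := fun _ => a) continuous_const
  have sfw := sfw0.clm (T : W3 →L[ℝ] W3)
  let u : ℝ → ℂ := fun t => (T (w t)).1
  let z : ℝ → ℝ := fun t => (T (w t)).2
  have sfu : SF (fun (_ : Unit) => u) := sfw.fst
  have hdT : ∀ t, T (deriv w t) = (deriv u t, deriv z t) := by
    intro t
    have h0 : HasDerivAt w (deriv w t) t := (sfw0.diff () t).hasDerivAt
    have h1 := (T : W3 →L[ℝ] W3).hasFDerivAt.comp_hasDerivAt t h0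
    have h2 := (ContinuousLinearMap.fst ℝ ℂ ℝ).hasFDerivAt.comp_hasDerivAt t h1
    have h3 := (ContinuousLinearMap.snd ℝ ℂ ℝ).hasFDerivAt.comp_hasDerivAt t h1
    exact Prod.ext h2.deriv.symm h3.deriv.symm
  have hTs : ∀ (v : W3) (ζ : ℝ), T v = (0, ζ) → v = ζ • b := by
    intro v ζ h
    apply T.injective
    rw [h, map_smul, hT]; simp
  have himm : ∀ t, deriv u t ≠ 0 := by
    intro t h0
    have h1 := hTs _ _ (by rw [hdT t, h0])
    have h2 : deriv z t ≠ 0 := fun h2 => ha.2.2.1 t (by rw [h2, zero_smul] at h1; exact h1)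
    apply g1 (deriv z t)⁻¹ t
    rw [h1, smul_smul, inv_mul_cancel₀ h2, one_smul]
  have hD : ∀ s t, Dbl u s t → w s - w t = (z s - z t) • b ∧ z s - z t ≠ 0 := by
    intro s t hd
    have h1 := hTs (w s - w t) (z s - z t) (by
      rw [map_sub]; exact Prod.ext (sub_eq_zero.2 hd.1) rfl)
    refine ⟨h1, fun h2 => hd.2 (ha.2.2.2 s t ?_)⟩
    rw [h2, zero_smul, sub_eq_zero] at h1
    exact h1
  have hD' : ∀ s t, Dbl u s t → (z s - z t)⁻¹ • (w s - w t) = b := by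
    intro s t hd
    obtain ⟨h1, h2⟩ := hD s t hd
    rw [h1, smul_smul, inv_mul_cancel₀ h2, one_smul]
  have hcs : ∀ s t, Dbl u s t → cs s ≠ cs t := by
    intro s t hd he
    rcases cs_eq_cs he with h | ⟨n, rfl⟩
    · exact hd.2 h
    · have hwp : Loop1 w := sfw0.per ()
      have := hD' _ _ hd
      rw [hwp.add_int] at this
      refine g2 (z (-t + n) - z t)⁻¹ (-t) (Eq.trans ?_ this)
      rw [neg_neg]
  have hdt : ∀ s t, Dbl u s t → dt (deriv u s) (deriv u t) ≠ 0 := by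
    intro s t hd h0
    obtain ⟨h1, h2⟩ := hD s t hd
    have key : ∀ d e : ℝ, d • deriv u s = e • deriv u t → e = 0 := by
      intro d e hde
      have h3 := hTs (d • deriv w s - e • deriv w t) (d * deriv z s - e * deriv z t) (by
        rw [map_sub, map_smul, map_smul, hdT, hdT]
        exact Prod.ext (sub_eq_zero.2 hde) rfl)
      have := g3 _ s t (hD' s t hd) (-((z s - z t)⁻¹ * (z s - z t)⁻¹ *
        (d * deriv z s - e * deriv z t))) d e (by
          change _ • (w s - w t) + _ = _
          rw [h3, h1, smul_smul, smul_smul, ← add_smul]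
          rw [show -((z s - z t)⁻¹ * (z s - z t)⁻¹ * (d * deriv z s - e * deriv z t)) * (z s - z t) +
            (z s - z t)⁻¹ * (d * deriv z s - e * deriv z t) = 0 by field_simp; ring, zero_smul])
      exact this.2.2
    have k1 := key (deriv u t).re (deriv u s).re (by
      unfold dt at h0
      apply Complex.ext <;> simp <;> linarith)
    have k2 := key (deriv u t).im (deriv u s).im (by
      unfold dt at h0
      apply Complex.ext <;> simp <;> linarith)
    exact himm s (Complex.ext k1 k2)
  obtain ⟨K, hK, hKd, hKu⟩ := finite_dbl (sfu.smooth ()) (sfu.per ()) himm hdt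
  obtain ⟨ξ, hξ, hξK⟩ := exists_xi hK (x := fun t => (crv f t).1) (fun p hp => (hKd p hp).2)
  obtain ⟨B, hB, hBK⟩ := exists_eps hK (x := fun t => (crv f t).1) (z := z) hξK
  -- the perturbation
  let F : ℝ → ℝ → E4 := fun ε t => crv f t + (ε * ξ t) • ((0, b) : E4)
  have sfF : SF F := (SF.const (crv_emb f).1 (crv_emb f).2.1).add
    (((SF.param continuous_id).mul (SF.const hξ.1 hξ.2)).smul (SF.param continuous_const))
  have F0 : F 0 = crv f := by funext t; simp [F]
  have ev1 := ev_good sfF (a := fun _ => a) continuous_const (z0 := 0) (by rw [F0]; exact ha)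
  have ev2 := ev_good sfF (a := fun _ => a + b) continuous_const (z0 := 0) (by rw [F0]; exact hb)
  obtain ⟨δ, hδ, hball⟩ := Metric.mem_nhds_iff.1 (ev1.and ev2)
  obtain ⟨ε, hεB, hεδ⟩ := (hB.countable.dense_compl ℝ).exists_mem_open
    (Metric.isOpen_ball (x := (0 : ℝ)) (ε := δ)) ⟨0, Metric.mem_ball_self hδ⟩
  have hI : ∀ θ : I, Good (F (θ * ε)) a ∧ Good (F (θ * ε)) (a + b) := by
    intro θ
    refine hball ?_
    rw [Metric.mem_ball, dist_zero_right] at hεδ ⊢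
    rw [norm_mul, Real.norm_of_nonneg θ.2.1]
    nlinarith [norm_nonneg ε, θ.2.2]
  have hemb : ∀ θ : I, IsLoopEmb (F (θ * ε)) := fun θ =>
    IsLoopEmb.of_clm (sfF.smooth _) (sfF.per _) (La a) (hI θ).1
  have hcont := (sfF.comp (by fun_prop : Continuous fun θ : I => (θ : ℝ) * ε)).lift hemb
  let f' : EmbS1 E4 := mkE (F ((1 : I) * ε)) (hemb 1)
  let γ : Path f f' :=
    { toFun := fun θ => mkE (F (θ * ε)) (hemb θ)
      continuous_toFun := hcont
      source' := EmbS1.ext' fun t => by simp [F0]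
      target' := rfl }
  have hf' : ∀ t, crv f' t = F ε t := fun t => by simp [f']
  have hγ1 : ∀ θ, Good (crv (γ θ)) a := fun θ => (hI θ).1
  have hγ2 : ∀ θ, Good (crv (γ θ)) (a + b) := fun θ => (hI θ).2
  have ga : Good (crv f') a := (hI 1).1
  have gb : Good (crv f') (a + b) := (hI 1).2
  obtain ⟨d1, hd1⟩ := ClsE_nonempty ga
  obtain ⟨d2, hd2⟩ := ClsE_nonempty gb
  rw [ClsE_nat γ (Path.refl a) hγ1 hc1 hd1, ClsE_nat γ (Path.refl (a + b)) hγ2 hc2 hd2]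
  congr 1
  have hx : ∀ t, (crv f' t).1 = (crv f t).1 := fun t => by simp [hf', F]
  refine coord_eq T hT ga gb (u := u) (z := fun t => z t + ε * ξ t) ?_ himm hdt hcs hK hKu ?_
    hd1 hd2
  · intro t
    have : La a (crv f' t) = w t + (ε * ξ t) • b := by
      rw [hf']; simp [F, hw]; module
    rw [this, map_add, map_smul, hT]
    exact Prod.ext (by simp [u]) (by simp [z])
  · intro p hp q hq h1 h2
    simp only [hx] at h1 h2
    exact hBK ε hεB p hp q hq h1 h2

theorem simplyConnected_E4 : SimplyConnectedSpace (EmbS1 E4) := by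
  refine simplyConnected_of_cls ?_
  intro f a a' ha ha' c hc c' hc'
  have sff : SF (fun (_ : W3) => crv f) := SF.const (crv_emb f).1 (crv_emb f).2.1
  have sfw : SF (fun (_ : Unit) t => La a (crv f t)) :=
    (SF.const (crv_emb f).1 (crv_emb f).2.1).La (f := fun _ => crv f) (a := fun _ => a)
      continuous_const
  have dw : Differentiable ℝ (fun t => La a (crv f t)) := sfw.diff ()
  have ddw : Differentiable ℝ (deriv (fun t => La a (crv f t))) :=
    ((contDiff_infty_iff_deriv).1 (sfw.smooth ())).2.differentiable (by simp)
  have ae := (ae_avoid ddw).and ((ae_avoid (v := fun s => La a (crv f s) - La a (crv f (-s)))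
    (dw.sub (dw.comp differentiable_neg))).and (ae_chord dw))
  have hdense := MeasureTheory.Measure.dense_of_ae ae
  obtain ⟨δ, hδ, hball⟩ := Metric.mem_nhds_iff.1
    (ev_good sff (a := fun a'' => a'') continuous_id (z0 := a') ha')
  obtain ⟨b, ⟨g1, g2, g3⟩, hb⟩ := hdense.exists_mem_open
    (Metric.isOpen_ball (x := a' - a) (ε := δ)) ⟨_, Metric.mem_ball_self hδ⟩
  have hb' : a + b ∈ Metric.ball a' δ := by
    rw [Metric.mem_ball, dist_eq_norm] at hb ⊢
    rwa [show a + b - a' = b - (a' - a) by abel]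
  have hgb : Good (crv f) (a + b) := hball hb'
  obtain ⟨d, hd⟩ := ClsE_nonempty hgb
  rw [generic_eq ha hgb g1 g2 g3 hc hd]
  have hseg : ∀ θ : I, (a + b) + (θ : ℝ) • (a' - (a + b)) ∈ Metric.ball a' δ := fun θ =>
    (convex_ball a' δ).add_smul_sub_mem hb' (Metric.mem_ball_self hδ) θ.2
  let A : Path (a + b) a' :=
    { toFun := fun θ => (a + b) + (θ : ℝ) • (a' - (a + b))
      continuous_toFun := by fun_prop
      source' := by simp
      target' := by simp }
  have := ClsE_nat (Path.refl f) A (fun θ => hball (hseg θ)) hd hc'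
  rw [this, Path.Homotopic.Quotient.mk_refl, Path.Homotopic.Quotient.refl_trans]

theorem main_thm : SimplyConnectedSpace (EmbS1 V4) := by
  have := simplyConnected_E4
  have L : E4 ≃L[ℝ] V4 := ContinuousLinearEquiv.ofFinrankEq (by simp [Module.finrank_prod])
  exact (homeoE L).symm.toHomotopyEquiv.simplyConnectedSpace
end

/-- **The space of smooth embeddings of the circle into ℝ⁴, with the C¹-topology, is simply
connected**: it is path-connected and every loop in it is contractible. -/
theorem embS1_R4_simplyConnected : SimplyConnectedSpace (EmbS1 V4) := by
  exact main_thm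

end
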